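/- arXiv:2206.04552 — 2 statements merged into one kernel-verified Lean document; each statement's English description precedes it below -/
import Mathlib

section
/- Separation for squared-exponential and inverse multiquadric kernels (Corollary 2): let T : X → X be a bounded linear operator whose adjoint T* is surjective, and assume ∫ ‖x‖² dQ(x) < ∞ and ∫ ‖C DU(x)‖² dQ(x) < ∞. If k is either the SE-T kernel k(x,y) = exp(−½ ‖Tx − Ty‖²) or the IMQ-T kernel k(x,y) = (‖Tx − Ty‖² + 1)^{−1/2}, then ∫_X ∫_X h_v(x,x') dQ(x) dQ(x') = 0 if and only if Q = P. -/
open MeasureTheory ProbabilityTheory Complex Filter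
open scoped RealInnerProductSpace

/-- The vectorised Stein kernel `h_v` associated to the kernel `k`, the covariance
operator `C` (with eigenbasis `e` and eigenvalues `l`) and the potential gradient `DU`. -/
noncomputable def steinKernelHv {X : Type*} [NormedAddCommGroup X] [InnerProductSpace ℝ X]
    (k : X → X → ℝ) (C : X →L[ℝ] X) (DU : X → X) (e : ℕ → X) (l : ℕ → ℝ)
    (x x' : X) : ℝ :=
  (∑' i, l i ^ 2 *
      fderiv ℝ (fun y1 => fderiv ℝ (fun x1 => k x1 y1) x (e i)) x' (e i))
  - fderiv ℝ (fun x1 => k x1 x') x (C x' + C (C (DU x')))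
  - fderiv ℝ (fun y1 => k x y1) x' (C x + C (C (DU x)))
  + k x x' * ⟪x + C (DU x), x' + C (DU x')⟫

lemma ksd_ode (p V b : ℝ → ℝ) (hp : Continuous p) (hp0 : ∀ s, 0 ≤ p s)
    (hV : ∀ s, HasDerivAt V (b s) s)
    (hbm : Measurable b)
    (hbp : Integrable (fun s => b s * p s))
    (H : ∀ v1 v2, p v2 - p v1 = - ∫ s in v1..v2, b s * p s) :
    ∃ c : ℝ, ∀ s, p s * Real.exp (V s) = c := by
  have hVc : Continuous V := continuous_iff_continuousAt.2 fun s => (hV s).continuousAt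
  by_cases h : ∃ s0, 0 < p s0
  swap
  · push Not at h
    refine ⟨0, fun s => ?_⟩
    rw [le_antisymm (h s) (hp0 s), zero_mul]
  obtain ⟨s0, hs0⟩ := h
  set c := p s0 * Real.exp (V s0) with hc
  have hcpos : 0 < c := by positivity
  let S : Set ℝ := {s | p s * Real.exp (V s) = c}
  have hclosed : IsClosed S := isClosed_eq (by fun_prop) continuous_const
  have hopen : IsOpen S := by
    rw [isOpen_iff_mem_nhds]
    intro s1 hs1
    have hs1' : p s1 * Real.exp (V s1) = c := hs1
    have hps1 : 0 < p s1 := by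
      by_contra hh
      have : p s1 = 0 := le_antisymm (not_lt.1 hh) (hp0 s1)
      rw [this, zero_mul] at hs1'
      linarith
    -- lower bound near s1
    have hnear : ∀ᶠ s in nhds s1, p s1 / 2 < p s :=
      (hp.tendsto s1).eventually (lt_mem_nhds (by linarith))
    obtain ⟨d, hd, hdp⟩ := Metric.eventually_nhds_iff_ball.1 hnear
    let bt : ℝ → ℝ := (Metric.ball s1 d).indicator b
    have hbt : Integrable bt := by
      refine (hbp.norm.const_mul (2 / p s1)).mono'
        ((hbm.indicator Metric.isOpen_ball.measurableSet).aestronglyMeasurable) ?_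
      refine Eventually.of_forall fun s => ?_
      by_cases hs : s ∈ Metric.ball s1 d
      · simp only [bt, Set.indicator_of_mem hs]
        have h1 := hdp s hs
        rw [norm_mul, Real.norm_of_nonneg (hp0 s)]
        have : 1 ≤ 2 / p s1 * p s := by
          rw [div_mul_eq_mul_div, le_div_iff₀ hps1]; linarith
        calc ‖b s‖ = ‖b s‖ * 1 := by ring
          _ ≤ ‖b s‖ * (2 / p s1 * p s) := by gcongr
          _ = _ := by ring
      · simp only [bt, Set.indicator_of_notMem hs]
        rw [norm_zero]; positivity
    have hG : Continuous fun s => ∫ r in s1..s, |bt r| :=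
      intervalIntegral.continuous_primitive (fun _ _ => hbt.abs.intervalIntegrable) s1
    have hG0 : ∀ᶠ s in nhds s1, abs (∫ r in s1..s, abs (bt r)) < 1 / 2 := by
      have h1 := hG.abs.tendsto s1
      simp only [intervalIntegral.integral_same, abs_zero] at h1
      exact h1.eventually (gt_mem_nhds (by norm_num))
    obtain ⟨d', hd', hdG⟩ := Metric.eventually_nhds_iff_ball.1 hG0
    set r := min d d' / 2 with hr
    have hrpos : 0 < r := by positivity
    have hrd : r < d := by
      have := min_le_left d d'; rw [hr]; linarith [lt_min hd hd']
    have hrd' : r < d' := by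
      have := min_le_right d d'; rw [hr]; linarith [lt_min hd hd']
    have hsub : ∀ s ∈ Metric.closedBall s1 r, s ∈ Metric.ball s1 d ∧ s ∈ Metric.ball s1 d' := by
      intro s hs
      rw [Metric.mem_closedBall] at hs
      exact ⟨by rw [Metric.mem_ball]; linarith, by rw [Metric.mem_ball]; linarith⟩
    have huIcc : ∀ s ∈ Metric.closedBall s1 r, Set.uIcc s1 s ⊆ Metric.closedBall s1 r := by
      intro s hs
      have : Convex ℝ (Metric.closedBall s1 r) := convex_closedBall s1 r
      rw [← segment_eq_uIcc]
      exact this.segment_subset (Metric.mem_closedBall_self hrpos.le) hs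
    let D : ℝ → ℝ := fun s => p s - c * Real.exp (-V s)
    have hDc : Continuous D := by fun_prop
    have hDeq : ∀ s ∈ Metric.closedBall s1 r, D s = - ∫ t in s1..s, bt t * D t := by
      intro s hs
      have hIntg : IntervalIntegrable (fun t => bt t * (-(c * Real.exp (-V t)))) volume s1 s :=
        (hbt.intervalIntegrable).mul_continuousOn (by fun_prop)
      have hint2 : IntervalIntegrable (fun t => bt t * p t) volume s1 s :=
        (hbt.intervalIntegrable).mul_continuousOn (by fun_prop)
      have e1 : ∫ t in s1..s, bt t * (-(c * Real.exp (-V t)))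
          = c * Real.exp (-V s) - c * Real.exp (-V s1) := by
        apply intervalIntegral.integral_eq_sub_of_hasDerivAt (f := fun t => c * Real.exp (-V t))
        · intro t ht
          have htb := (hsub t (huIcc s hs ht)).1
          have := ((hV t).neg.exp).const_mul c
          have hbt' : bt t = b t := Set.indicator_of_mem htb b
          rw [hbt']
          exact this.congr_deriv (by simp only [Pi.neg_apply]; ring)
        · exact hIntg
      have e2 : ∫ t in s1..s, bt t * p t = ∫ t in s1..s, b t * p t := by
        apply intervalIntegral.integral_congr
        intro t ht
        have htb := (hsub t (huIcc s hs ht)).1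
        simp only [bt, Set.indicator_of_mem htb]
      have e3 : ∫ t in s1..s, bt t * D t
          = (∫ t in s1..s, bt t * p t) + ∫ t in s1..s, bt t * (-(c * Real.exp (-V t))) := by
        rw [← intervalIntegral.integral_add hint2 hIntg]
        congr 1; ext t; simp only [D]; ring
      rw [e3, e1, e2]
      have h4 := H s1 s
      have h5 : c * Real.exp (-V s1) = p s1 := by
        rw [← hs1', mul_assoc, ← Real.exp_add]; simp
      simp only [D]; linarith
    obtain ⟨sm, hsm, hmax⟩ := (isCompact_closedBall s1 r).exists_isMaxOn
      ⟨s1, Metric.mem_closedBall_self hrpos.le⟩ (hDc.abs.continuousOn)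
    have hDm : |D sm| ≤ |D sm| * (1 / 2) := by
      have h1 := hDeq sm hsm
      have h2 : |∫ t in s1..sm, bt t * D t| ≤ abs (∫ t in s1..sm, |bt t| * |D sm|) := by
        refine intervalIntegral.norm_integral_le_abs_of_norm_le
          (f := fun t => bt t * D t) (g := fun t => |bt t| * |D sm|) ?_ ?_
        · refine (ae_restrict_iff' measurableSet_uIoc).2 (Eventually.of_forall fun t ht => ?_)
          rw [norm_mul]
          have : t ∈ Metric.closedBall s1 r := huIcc sm hsm (Set.uIoc_subset_uIcc ht)
          exact mul_le_mul_of_nonneg_left (hmax this) (norm_nonneg _)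
        · exact (hbt.abs.mul_const _).intervalIntegrable
      rw [intervalIntegral.integral_mul_const, abs_mul, abs_abs] at h2
      have h3 := hdG sm (hsub sm hsm).2
      calc |D sm| = |∫ t in s1..sm, bt t * D t| := by
            conv_lhs => rw [h1, abs_neg]
        _ ≤ _ := h2
        _ ≤ 1 / 2 * |D sm| := by gcongr
        _ = _ := by ring
    have hDm0 : |D sm| = 0 := le_antisymm (by linarith [abs_nonneg (D sm)]) (abs_nonneg _)
    refine Filter.mem_of_superset (Metric.closedBall_mem_nhds s1 hrpos) fun s hs => ?_
    have h1 : |D s| ≤ |D sm| := hmax hs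
    have h2 : D s = 0 := abs_eq_zero.1 (le_antisymm (h1.trans hDm0.le) (abs_nonneg _))
    change p s * Real.exp (V s) = c
    have h3 : p s = c * Real.exp (-V s) := by simp only [D] at h2; linarith
    rw [h3, mul_assoc, ← Real.exp_add]; simp
  have huniv : S = Set.univ := IsClopen.eq_univ ⟨hclosed, hopen⟩ ⟨s0, rfl⟩
  exact ⟨c, fun s => by
    have : s ∈ S := by rw [huniv]; trivial
    exact this⟩

/-- One-dimensional uniqueness: a finite measure with logarithmic derivative minus the derivative of V
is a multiple of `exp (-V)`. -/
lemma ksd_oneD (κ : Measure ℝ) [IsFiniteMeasure κ] (V b : ℝ → ℝ)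
    (hV : ∀ s, HasDerivAt V (b s) s) (hbm : Measurable b) (hb : Integrable b κ)
    (H : ∀ r1 r2 : ℚ, r1 < r2 → (κ (Set.Ioc (r1 : ℝ) r2)).toReal
      = ∫ v in (r1 : ℝ)..r2, -(∫ s in Set.Iic v, b s ∂κ)) :
    ∃ c : ℝ, κ.withDensity (fun s => ENNReal.ofReal (Real.exp (V s)))
      = ENNReal.ofReal c • volume := by
  have hVc : Continuous V := continuous_iff_continuousAt.2 fun s => (hV s).continuousAt
  set p : ℝ → ℝ := fun v => -(∫ s in Set.Iic v, b s ∂κ) with hp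
  set L := ∫ s, ‖b s‖ ∂κ with hL
  have hpb : ∀ v, ‖p v‖ ≤ L := by
    intro v
    simp only [hp, norm_neg]
    refine (norm_integral_le_integral_norm _).trans ?_
    exact setIntegral_le_integral hb.norm (Eventually.of_forall fun _ => norm_nonneg _)
  have hL0 : 0 ≤ L := (norm_nonneg _).trans (hpb 0)
  have hle : ∀ r1 r2 : ℚ, r1 < r2 → (κ (Set.Ioc (r1 : ℝ) r2)).toReal ≤ L * (r2 - r1) := by
    intro r1 r2 h12
    rw [H r1 r2 h12]
    have h0 : (r1 : ℝ) < r2 := by exact_mod_cast h12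
    refine (le_abs_self _).trans ?_
    have := intervalIntegral.norm_integral_le_of_norm_le_const (a := (r1 : ℝ)) (b := r2) (f := p)
      (C := L) (fun x _ => hpb x)
    rwa [abs_of_pos (by linarith), Real.norm_eq_abs] at this
  have : NullSingletonClass κ := by
    refine ⟨fun x => ?_⟩
    have key : ∀ ε > 0, (κ {x}).toReal ≤ ε := by
      intro ε hε
      set η := ε / (2 * (L + 1)) with hη
      have hηpos : 0 < η := by positivity
      obtain ⟨r1, h1, h1'⟩ := exists_rat_btwn (show x - η < x by linarith)
      obtain ⟨r2, h2, h2'⟩ := exists_rat_btwn (show x < x + η by linarith)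
      have hlt : r1 < r2 := by exact_mod_cast h1'.trans h2
      have hsub : ({x} : Set ℝ) ⊆ Set.Ioc (r1 : ℝ) r2 := by
        intro y hy; rw [Set.mem_singleton_iff] at hy; subst hy; exact ⟨h1', h2.le⟩
      calc (κ {x}).toReal ≤ (κ (Set.Ioc (r1 : ℝ) r2)).toReal :=
            ENNReal.toReal_mono (measure_ne_top _ _) (measure_mono hsub)
        _ ≤ L * (r2 - r1) := hle _ _ hlt
        _ ≤ (L + 1) * (2 * η) := by
            apply mul_le_mul <;> linarith
        _ = ε := by rw [hη]; field_simp
    have := le_of_forall_pos_le_add (a := (κ {x}).toReal) (b := 0) (fun ε hε => by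
      simpa using key ε hε)
    have h0 : (κ {x}).toReal = 0 := le_antisymm this ENNReal.toReal_nonneg
    exact ((ENNReal.toReal_eq_zero_iff _).1 h0).resolve_right (measure_ne_top _ _)
  have hpd : ∀ v1 v2, p v2 - p v1 = -∫ s in v1..v2, b s ∂κ := by
    intro v1 v2
    simp only [hp]
    rw [← intervalIntegral.integral_Iic_sub_Iic hb.integrableOn hb.integrableOn]
    ring
  have hpc : Continuous p := by
    have h1 : p = fun v => p 0 + -∫ s in (0 : ℝ)..v, b s ∂κ := by
      ext v; rw [← hpd 0 v]; ring
    rw [h1]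
    exact continuous_const.add (intervalIntegral.continuous_primitive
      (fun _ _ => hb.intervalIntegrable) 0).neg
  have hp0 : ∀ s, 0 ≤ p s := by
    intro s
    by_contra hneg
    push Not at hneg
    obtain ⟨d, hd, hdp⟩ := Metric.eventually_nhds_iff_ball.1
      ((hpc.tendsto s).eventually (gt_mem_nhds hneg))
    obtain ⟨r1, h1, h1'⟩ := exists_rat_btwn (show s - d < s by linarith)
    obtain ⟨r2, h2, h2'⟩ := exists_rat_btwn (show s < s + d by linarith)
    have hlt' : (r1 : ℝ) < r2 := h1'.trans h2
    have hlt : r1 < r2 := by exact_mod_cast hlt'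
    have h3 := H r1 r2 hlt
    have h4 : ∫ v in (r1 : ℝ)..r2, p v < 0 := by
      have := intervalIntegral.intervalIntegral_pos_of_pos_on (f := fun v => - p v)
        (hpc.neg.intervalIntegrable (r1 : ℝ) r2) (fun x hx => by
          have : p x < 0 := hdp x (by
            rw [Metric.mem_ball, Real.dist_eq, abs_lt]
            exact ⟨by linarith [hx.1], by linarith [hx.2]⟩)
          linarith) hlt'
      rw [intervalIntegral.integral_neg] at this
      linarith
    have h5 : 0 ≤ (κ (Set.Ioc (r1 : ℝ) r2)).toReal := ENNReal.toReal_nonneg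
    rw [h3] at h5
    exact absurd h4 (not_lt.2 h5)
  have hκ : κ = volume.withDensity (fun s => ENNReal.ofReal (p s)) := by
    apply Real.measure_ext_Ioo_rat
    intro r1 r2
    rcases lt_or_ge r1 r2 with hlt | hge
    · have hlt' : (r1 : ℝ) < r2 := by exact_mod_cast hlt
      rw [withDensity_apply _ measurableSet_Ioo, measure_congr (Ioo_ae_eq_Ioc (μ := κ)),
        ← ENNReal.ofReal_toReal (measure_ne_top κ _), H r1 r2 hlt,
        intervalIntegral.integral_of_le hlt'.le, ofReal_integral_eq_lintegral_ofReal,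
        ← restrict_Ioo_eq_restrict_Ioc]
      · exact (hpc.intervalIntegrable (r1 : ℝ) r2).1
      · exact Eventually.of_forall hp0
    · have : (r2 : ℝ) ≤ r1 := by exact_mod_cast hge
      rw [Set.Ioo_eq_empty (not_lt.2 this)]; simp
  have hpm : Measurable fun s => (p s).toNNReal := by fun_prop
  have hκ' : κ = volume.withDensity (fun s => (((p s).toNNReal : NNReal) : ENNReal)) := hκ
  have hbp : Integrable (fun s => b s * p s) := by
    have h1 := hb
    rw [hκ', integrable_withDensity_iff_integrable_smul hpm] at h1
    refine h1.congr (Eventually.of_forall fun s => ?_)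
    simp only [NNReal.smul_def, Real.coe_toNNReal _ (hp0 s), smul_eq_mul]; ring
  have hode : ∀ v1 v2, p v2 - p v1 = - ∫ s in v1..v2, b s * p s := by
    have aux : ∀ v1 v2, v1 ≤ v2 → p v2 - p v1 = - ∫ s in v1..v2, b s * p s := by
      intro v1 v2 h12
      rw [hpd, intervalIntegral.integral_of_le h12, intervalIntegral.integral_of_le h12]
      conv_lhs => rw [hκ', restrict_withDensity measurableSet_Ioc,
        integral_withDensity_eq_integral_smul hpm]
      congr 1
      refine integral_congr_ae (Eventually.of_forall fun s => ?_)
      simp only [NNReal.smul_def, Real.coe_toNNReal _ (hp0 s), smul_eq_mul]; ring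
    intro v1 v2
    rcases le_total v1 v2 with h | h
    · exact aux v1 v2 h
    · rw [intervalIntegral.integral_symm, ← aux v2 v1 h]; ring
  obtain ⟨c, hc⟩ := ksd_ode p V b hpc hp0 hV hbm hbp hode
  refine ⟨c, ?_⟩
  conv_lhs => rw [hκ]
  rw [← withDensity_mul _ (by fun_prop) (by fun_prop)]
  have : ((fun s => ENNReal.ofReal (p s)) * fun s => ENNReal.ofReal (Real.exp (V s)))
      = fun _ => ENNReal.ofReal c := by
    ext s
    simp only [Pi.mul_apply]
    rw [← ENNReal.ofReal_mul (hp0 s), hc]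
  rw [this, withDensity_const]

/-- Finite measures with finite and equal moment generating functionals agree. -/
lemma ksd_mgf_ext {X : Type*} [NormedAddCommGroup X] [InnerProductSpace ℝ X] [CompleteSpace X]
    [MeasurableSpace X] [BorelSpace X] [SecondCountableTopology X]
    (μ ν : Measure X) [IsFiniteMeasure μ] [IsFiniteMeasure ν]
    (hμ : ∀ z : X, Integrable (fun x => Real.exp ⟪x, z⟫) μ)
    (h : ∀ z : X, ∫ x, Real.exp ⟪x, z⟫ ∂μ = ∫ x, Real.exp ⟪x, z⟫ ∂ν) : μ = ν := by
  apply Measure.ext_of_charFun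
  ext z
  have hmgf : mgf (fun x => ⟪x, z⟫) μ = mgf (fun x => ⟪x, z⟫) ν := by
    ext t
    have := h (t • z)
    simp only [real_inner_smul_right] at this
    exact this
  have hmass : μ = 0 ↔ ν = 0 := by
    have h0 := h 0
    simp only [inner_zero_right, Real.exp_zero, integral_const, smul_eq_mul, mul_one] at h0
    rw [← Measure.measure_univ_eq_zero, ← Measure.measure_univ_eq_zero,
      ← measureReal_eq_zero_iff, ← measureReal_eq_zero_iff, h0]
  have hE := eqOn_complexMGF_of_mgf' hmgf hmass
  have hset : integrableExpSet (fun x => ⟪x, z⟫) μ = Set.univ := by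
    ext t
    simp only [Set.mem_univ, iff_true, integrableExpSet, Set.mem_ofPred_eq]
    have := hμ (t • z)
    simpa only [real_inner_smul_right] using this
  have := hE (x := I) (by rw [hset]; simp)
  simp only [complexMGF] at this
  rw [charFun_apply, charFun_apply]
  simpa [mul_comm] using this

lemma ksd_shift_measure {X : Type*} [NormedAddCommGroup X] [InnerProductSpace ℝ X]
    [CompleteSpace X]
    [MeasurableSpace X] [BorelSpace X] [SecondCountableTopology X]
    (ρ : Measure X) [IsFiniteMeasure ρ] (e : X) (b : X → ℝ) (hbm : Measurable b)
    (hR : ∀ z : X, Integrable (fun x => Real.exp ⟪x, z⟫) ρ)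
    (hbR : ∀ z : X, Integrable (fun x => b x * Real.exp ⟪x, z⟫) ρ)
    (hS : ∀ z : X, ⟪z, e⟫ * ∫ x, Real.exp ⟪x, z⟫ ∂ρ = ∫ x, b x * Real.exp ⟪x, z⟫ ∂ρ)
    (t : ℝ) (ht : 0 < t) :
    ρ.map (fun x => x + t • e) + ((volume.restrict (Set.Ioc 0 t)).prod
        (ρ.withDensity (fun x => ENNReal.ofReal (-b x)))).map (fun q : ℝ × X => q.2 + q.1 • e)
    = ρ + ((volume.restrict (Set.Ioc 0 t)).prod
        (ρ.withDensity (fun x => ENNReal.ofReal (b x)))).map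
          (fun q : ℝ × X => q.2 + q.1 • e) := by
  have hb1 : Integrable b ρ := by simpa using hbR 0
  -- general facts about the positive and negative parts
  have key : ∀ c : X → ℝ, Measurable c → (∀ z : X, Integrable (fun x => c x * Real.exp ⟪x, z⟫) ρ) →
      IsFiniteMeasure (ρ.withDensity (fun x => ENNReal.ofReal (c x))) ∧
      ∀ z : X, Integrable (fun x => Real.exp ⟪x, z⟫) (((volume.restrict (Set.Ioc 0 t)).prod
        (ρ.withDensity (fun x => ENNReal.ofReal (c x)))).map (fun q : ℝ × X => q.2 + q.1 • e)) ∧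
      ∫ x, Real.exp ⟪x, z⟫ ∂(((volume.restrict (Set.Ioc 0 t)).prod
        (ρ.withDensity (fun x => ENNReal.ofReal (c x)))).map (fun q : ℝ × X => q.2 + q.1 • e))
        = (∫ s in Set.Ioc 0 t, Real.exp (s * ⟪e, z⟫)) * ∫ x, max (c x) 0 * Real.exp ⟪x, z⟫ ∂ρ := by
    intro c hc hci
    have hc1 : Integrable c ρ := by simpa using hci 0
    have hfin : IsFiniteMeasure (ρ.withDensity (fun x => ENNReal.ofReal (c x))) :=
      isFiniteMeasure_withDensity_ofReal hc1.2
    refine ⟨hfin, fun z => ?_⟩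
    have hmeas : Measurable fun q : ℝ × X => q.2 + q.1 • e := by fun_prop
    have hnn : Measurable fun x => (c x).toNNReal := by fun_prop
    have hi1 : Integrable (fun x => Real.exp ⟪x, z⟫)
        (ρ.withDensity (fun x => ENNReal.ofReal (c x))) := by
      change Integrable _ (ρ.withDensity (fun x => (((c x).toNNReal : NNReal) : ENNReal)))
      rw [integrable_withDensity_iff_integrable_smul hnn]
      refine (hci z).mono (by fun_prop) (Eventually.of_forall fun x => ?_)
      rw [NNReal.smul_def, smul_eq_mul, norm_mul, norm_mul, Real.coe_toNNReal']
      gcongr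
      rw [Real.norm_eq_abs, Real.norm_eq_abs, abs_of_nonneg (le_max_right _ _)]
      exact max_le (le_abs_self _) (abs_nonneg _)
    have hi2 : Integrable (fun s => Real.exp (s * ⟪e, z⟫)) (volume.restrict (Set.Ioc 0 t)) :=
      (Continuous.integrableOn_Ioc (by fun_prop))
    have hprod : ∀ q : ℝ × X, Real.exp ⟪q.2 + q.1 • e, z⟫
        = Real.exp (q.1 * ⟪e, z⟫) * Real.exp ⟪q.2, z⟫ := by
      intro q
      rw [inner_add_left, real_inner_smul_left, Real.exp_add, mul_comm]
    constructor
    · rw [integrable_map_measure (by fun_prop) hmeas.aemeasurable]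
      refine (hi2.mul_prod hi1).congr (Eventually.of_forall fun q => ?_)
      exact (hprod q).symm
    · rw [integral_map hmeas.aemeasurable (by fun_prop)]
      simp_rw [hprod]
      rw [integral_prod_mul (fun s : ℝ => Real.exp (s * ⟪e, z⟫)) (fun x : X => Real.exp ⟪x, z⟫)]
      congr 1
      change ∫ x, _ ∂(ρ.withDensity (fun x => (((c x).toNNReal : NNReal) : ENNReal))) = _
      rw [integral_withDensity_eq_integral_smul hnn]
      simp only [NNReal.smul_def, smul_eq_mul, Real.coe_toNNReal']
  obtain ⟨hf1, h1⟩ := key b hbm hbR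
  obtain ⟨hf2, h2⟩ := key (fun x => -b x) hbm.neg (fun z => by
    simp only [neg_mul]; exact (hbR z).neg)
  have hmt : Measurable fun x : X => x + t • e := by fun_prop
  have hsh : ∀ z x : X, Real.exp ⟪x + t • e, z⟫ = Real.exp (t * ⟪e, z⟫) * Real.exp ⟪x, z⟫ := by
    intro z x
    rw [inner_add_left, real_inner_smul_left, Real.exp_add, mul_comm]
  have hI : ∀ z : X, Integrable (fun x => Real.exp ⟪x, z⟫) (ρ.map (fun x => x + t • e)) := by
    intro z
    rw [integrable_map_measure (by fun_prop) hmt.aemeasurable]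
    refine ((hR z).const_mul (Real.exp (t * ⟪e, z⟫))).congr (Eventually.of_forall fun x => ?_)
    exact (hsh z x).symm
  apply ksd_mgf_ext
  · intro z
    exact (hI z).add_measure (h2 z).1
  · intro z
    rw [integral_add_measure (hI z) (h2 z).1, integral_add_measure (hR z) (h1 z).1,
      (h1 z).2, (h2 z).2, integral_map hmt.aemeasurable (by fun_prop)]
    simp_rw [hsh z]
    rw [integral_const_mul]
    set Mz := ∫ x, Real.exp ⟪x, z⟫ ∂ρ
    set ζ := ⟪e, z⟫
    set J := ∫ s in Set.Ioc 0 t, Real.exp (s * ζ)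
    have hJ : ζ * J = Real.exp (t * ζ) - 1 := by
      have h3 : ∫ s in (0 : ℝ)..t, ζ * Real.exp (s * ζ) = Real.exp (t * ζ) - Real.exp (0 * ζ) := by
        apply intervalIntegral.integral_eq_sub_of_hasDerivAt (f := fun s => Real.exp (s * ζ))
        · intro s _
          have := ((hasDerivAt_id s).mul_const ζ).exp
          exact this.congr_deriv (by simp; ring)
        · exact Continuous.intervalIntegrable (by fun_prop) _ _
      rw [intervalIntegral.integral_const_mul, intervalIntegral.integral_of_le ht.le] at h3
      simpa using h3
    have hdiff : (∫ x, max (b x) 0 * Real.exp ⟪x, z⟫ ∂ρ)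
        - ∫ x, max (-b x) 0 * Real.exp ⟪x, z⟫ ∂ρ = ζ * Mz := by
      have hpos : ∀ c : X → ℝ, Measurable c →
          Integrable (fun x => c x * Real.exp ⟪x, z⟫) ρ →
          Integrable (fun x => max (c x) 0 * Real.exp ⟪x, z⟫) ρ := by
        intro c hcm hc
        refine hc.mono (by fun_prop) (Eventually.of_forall fun x => ?_)
        rw [norm_mul, norm_mul]
        gcongr
        rw [Real.norm_eq_abs, Real.norm_eq_abs, abs_of_nonneg (le_max_right _ _)]
        exact max_le (le_abs_self _) (abs_nonneg _)
      rw [← integral_sub (hpos b hbm (hbR z)) (hpos (fun x => -b x) hbm.neg (by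
        simp only [neg_mul]; exact (hbR z).neg))]
      rw [show ζ = ⟪z, e⟫ from real_inner_comm _ _, hS z]
      refine integral_congr_ae (Eventually.of_forall fun x => ?_)
      simp only
      rw [← sub_mul]
      congr 1
      rcases le_total 0 (b x) with h | h
      · rw [max_eq_left h, max_eq_right (by linarith)]; ring
      · rw [max_eq_right h, max_eq_left (by linarith)]; ring
    have : (∫ x, max (b x) 0 * Real.exp ⟪x, z⟫ ∂ρ)
      = (∫ x, max (-b x) 0 * Real.exp ⟪x, z⟫ ∂ρ) + ζ * Mz := by linarith
    rw [this]
    linear_combination (-Mz) * hJ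

/-- One-dimensional Fubini computation. -/
lemma ksd_fubini_1d (κ : Measure ℝ) [IsFiniteMeasure κ] (b : ℝ → ℝ) (hb : Integrable b κ)
    (r t : ℝ) (ht : 0 < t) :
    ∫ v in (r - t)..r, -(∫ s in Set.Iic v, b s ∂κ)
      = -∫ s, max (min t (r - s)) 0 * b s ∂κ := by
  rw [intervalIntegral.integral_neg, intervalIntegral.integral_of_le (by linarith)]
  congr 1
  have h1 : ∀ v, ∫ s in Set.Iic v, b s ∂κ = ∫ s, (Set.Iic v).indicator b s ∂κ := fun v =>
    (integral_indicator measurableSet_Iic).symm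
  simp_rw [h1]
  have hS : MeasurableSet {q : ℝ × ℝ | q.2 ≤ q.1} := measurableSet_le measurable_snd measurable_fst
  have hIntg : Integrable (Function.uncurry fun v s => (Set.Iic v).indicator b s)
      ((volume.restrict (Set.Ioc (r - t) r)).prod κ) := by
    have h2 : Integrable (fun q : ℝ × ℝ => b q.2)
        ((volume.restrict (Set.Ioc (r - t) r)).prod κ) := hb.comp_snd _
    refine (h2.indicator hS).congr (Eventually.of_forall fun q => ?_)
    simp only [Function.uncurry, Set.indicator, Set.mem_Iic]
    rfl
  rw [integral_integral_swap hIntg]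
  refine integral_congr_ae (Eventually.of_forall fun s => ?_)
  simp only
  have h3 : ∀ v, (Set.Iic v).indicator b s = (Set.Ici s).indicator (fun _ => b s) v := by
    intro v
    simp only [Set.indicator, Set.mem_Iic, Set.mem_Ici]
  simp_rw [h3]
  rw [integral_indicator measurableSet_Ici, Measure.restrict_restrict measurableSet_Ici,
    integral_const, smul_eq_mul, measureReal_restrict_apply_univ]
  congr 1
  have h4 : (Set.Ici s ∩ Set.Ioc (r - t) r : Set ℝ) =ᵐ[volume] Set.Ioc (max (r - t) s) r := by
    have h5 : (Set.Ioi s ∩ Set.Ioc (r - t) r : Set ℝ) = Set.Ioc (max (r - t) s) r := by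
      ext v; simp only [Set.mem_inter_iff, Set.mem_Ioi, Set.mem_Ioc, max_lt_iff]; tauto
    rw [← h5]
    exact (Ioi_ae_eq_Ici.symm).inter (ae_eq_refl _)
  rw [measureReal_congr h4, Real.volume_real_Ioc]
  congr 1
  rcases le_total (r - t) s with h | h
  · rw [max_eq_right h, min_eq_right (by linarith)]
  · rw [max_eq_left h, min_eq_left (by linarith)]; ring

lemma ksd_resample {X : Type*} [NormedAddCommGroup X] [InnerProductSpace ℝ X]
    [CompleteSpace X]
    [MeasurableSpace X] [BorelSpace X] [SecondCountableTopology X]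
    (ρ : Measure X) [IsFiniteMeasure ρ] (e : X) (he : ⟪e, e⟫ = 1)
    (lam : NNReal) (hlam : lam ≠ 0) (b : X → ℝ) (hbm : Measurable b)
    (hR : ∀ z : X, Integrable (fun x => Real.exp ⟪x, z⟫) ρ)
    (hbR : ∀ z : X, Integrable (fun x => b x * Real.exp ⟪x, z⟫) ρ)
    (hS : ∀ z : X, ⟪z, e⟫ * ∫ x, Real.exp ⟪x, z⟫ ∂ρ = ∫ x, b x * Real.exp ⟪x, z⟫ ∂ρ)
    (W : X → ℝ) (hWm : Measurable W)
    (hW : ∀ (z : X) (s : ℝ), HasDerivAt (fun s : ℝ => W (z + s • e))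
      (b (z + s • e) - ⟪z + s • e, e⟫ / lam) s)
    (f : X → ENNReal) (hf : Measurable f) :
    ∫⁻ x, f x * ENNReal.ofReal (Real.exp (W x)) ∂ρ
      = ∫⁻ x, (∫⁻ s, f (x + (s - ⟪x, e⟫) • e) ∂(gaussianReal 0 lam))
          * ENNReal.ofReal (Real.exp (W x)) ∂ρ := by
  have hb1 : Integrable b ρ := by simpa using hbR 0
  set π : X → X × ℝ := fun x => (x - ⟪x, e⟫ • e, ⟪x, e⟫) with hπ
  have hπm : Measurable π := by fun_prop
  have hπinv : ∀ x, (π x).1 + (π x).2 • e = x := fun x => by simp [hπ]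
  set ρ2 := ρ.map π with hρ2
  have : IsFiniteMeasure ρ2 := by rw [hρ2]; infer_instance
  -- disintegration formula
  have hdis : ∀ G : X × ℝ → ENNReal, Measurable G →
      ∫⁻ x, G (π x) ∂ρ = ∫⁻ z, ∫⁻ s, G (z, s) ∂(ρ2.condKernel z) ∂ρ2.fst := by
    intro G hG
    rw [Measure.lintegral_condKernel hG, hρ2, lintegral_map hG hπm]
  -- orthogonality
  have horth : ∀ᵐ z ∂ρ2.fst, ⟪z, e⟫ = 0 := by
    rw [Measure.fst, hρ2, Measure.map_map measurable_fst hπm]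
    rw [ae_map_iff (measurable_fst.comp hπm).aemeasurable
      (measurableSet_eq_fun (by fun_prop) (by fun_prop))]
    refine Eventually.of_forall fun x => ?_
    simp only [Function.comp, hπ, inner_sub_left, real_inner_smul_left, he]
    ring
  -- integrability on fibres
  have hbint : ∀ᵐ z ∂ρ2.fst, Integrable (fun s : ℝ => b (z + s • e)) (ρ2.condKernel z) := by
    have h1 : ∫⁻ x, ‖b x‖ₑ ∂ρ < ⊤ := hb1.2
    have h2 := hdis (fun q => ‖b (q.1 + q.2 • e)‖ₑ) (by fun_prop)
    simp only [hπinv] at h2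
    rw [h2] at h1
    have h3 := ae_lt_top' (Measurable.aemeasurable (by
      exact Measurable.lintegral_kernel_prod_right' (κ := ρ2.condKernel)
        (f := fun q : X × ℝ => ‖b (q.1 + q.2 • e)‖ₑ) (by fun_prop))) h1.ne
    filter_upwards [h3] with z hz
    exact ⟨(hbm.comp (by fun_prop : Measurable fun s : ℝ => z + s • e)).aestronglyMeasurable, hz⟩
  -- the identity on fibres
  have hfib : ∀ r t : ℝ, 0 < t → ∀ᵐ z ∂ρ2.fst,
      ρ2.condKernel z (Set.Iic (r - t))
        + ∫⁻ s, ENNReal.ofReal (-b (z + s • e)) * ENNReal.ofReal (min t (r - s)) ∂(ρ2.condKernel z)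
      = ρ2.condKernel z (Set.Iic r)
        + ∫⁻ s, ENNReal.ofReal (b (z + s • e)) * ENNReal.ofReal (min t (r - s))
            ∂(ρ2.condKernel z) := by
    intro r t ht
    have hmk : ∀ c : X → ℝ, Measurable c → Measurable fun z =>
        ∫⁻ s, ENNReal.ofReal (c (z + s • e)) * ENNReal.ofReal (min t (r - s))
          ∂(ρ2.condKernel z) := by
      intro c hc
      exact Measurable.lintegral_kernel_prod_right' (κ := ρ2.condKernel)
        (f := fun q : X × ℝ => ENNReal.ofReal (c (q.1 + q.2 • e))
          * ENNReal.ofReal (min t (r - q.2))) (by fun_prop)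
    have hms : ∀ r', Measurable fun z => ρ2.condKernel z (Set.Iic r') := fun r' =>
      Kernel.measurable_coe _ measurableSet_Iic
    refine ae_eq_of_forall_setLIntegral_eq_of_sigmaFinite
      ((hms _).add (hmk (fun x => -b x) hbm.neg)) ((hms _).add (hmk b hbm)) ?_
    intro A hA _
    rw [lintegral_add_left (hms _), lintegral_add_left (hms _),
      Measure.setLIntegral_condKernel_eq_measure_prod hA measurableSet_Iic,
      Measure.setLIntegral_condKernel_eq_measure_prod hA measurableSet_Iic]
    have hD : MeasurableSet (π ⁻¹' (A ×ˢ Set.Iic r)) := hπm (hA.prod measurableSet_Iic)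
    have hsh : ∀ (x : X) (v : ℝ), π (x + v • e) = ((π x).1, (π x).2 + v) := by
      intro x v
      simp only [hπ, inner_add_left, real_inner_smul_left, he, mul_one, Prod.mk.injEq, and_true]
      rw [add_smul]; abel
    have hpart : ∀ c : X → ℝ, Measurable c → Integrable c ρ →
        (((volume.restrict (Set.Ioc 0 t)).prod (ρ.withDensity (fun x => ENNReal.ofReal (c x)))).map
          (fun q : ℝ × X => q.2 + q.1 • e)) (π ⁻¹' (A ×ˢ Set.Iic r))
        = ∫⁻ z in A, ∫⁻ s, ENNReal.ofReal (c (z + s • e)) * ENNReal.ofReal (min t (r - s))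
          ∂(ρ2.condKernel z) ∂ρ2.fst := by
      intro c hc hci
      have hfin : IsFiniteMeasure (ρ.withDensity (fun x => ENNReal.ofReal (c x))) :=
        isFiniteMeasure_withDensity_ofReal hci.2
      have hm : Measurable fun q : ℝ × X => q.2 + q.1 • e := by fun_prop
      rw [Measure.map_apply hm hD, Measure.prod_apply_symm (hm hD)]
      have hx : ∀ x : X, (volume.restrict (Set.Ioc 0 t)) ((fun v : ℝ => (v, x)) ⁻¹'
          ((fun q : ℝ × X => q.2 + q.1 • e) ⁻¹' (π ⁻¹' (A ×ˢ Set.Iic r))))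
          = (π ⁻¹' (A ×ˢ Set.univ)).indicator (fun x => ENNReal.ofReal (min t (r - (π x).2))) x := by
        intro x
        have hset : ((fun v : ℝ => (v, x)) ⁻¹'
          ((fun q : ℝ × X => q.2 + q.1 • e) ⁻¹' (π ⁻¹' (A ×ˢ Set.Iic r))))
          = {v : ℝ | (π x).1 ∈ A ∧ (π x).2 + v ≤ r} := by
          ext v
          simp only [Set.mem_preimage, hsh, Set.mem_prod, Set.mem_Iic, Set.mem_ofPred_eq]
        rw [hset]
        by_cases hxA : (π x).1 ∈ A
        · rw [Set.indicator_of_mem (by exact ⟨hxA, trivial⟩)]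
          have h2 : {v : ℝ | (π x).1 ∈ A ∧ (π x).2 + v ≤ r} = Set.Iic (r - (π x).2) := by
            ext v
            simp only [hxA, true_and, Set.mem_ofPred_eq, Set.mem_Iic]
            constructor <;> intro h <;> linarith
          rw [h2, Measure.restrict_apply measurableSet_Iic, Set.inter_comm]
          have h3 : Set.Ioc 0 t ∩ Set.Iic (r - (π x).2) = Set.Ioc 0 (min t (r - (π x).2)) := by
            ext v; simp only [Set.mem_inter_iff, Set.mem_Ioc, Set.mem_Iic, le_min_iff]; tauto
          rw [h3, Real.volume_Ioc, sub_zero]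
        · rw [Set.indicator_of_notMem (by intro h; exact hxA h.1)]
          have h2 : {v : ℝ | (π x).1 ∈ A ∧ (π x).2 + v ≤ r} = ∅ := by
            ext v; simp [hxA]
          rw [h2, measure_empty]
      simp_rw [hx]
      have hA' : MeasurableSet (A ×ˢ (Set.univ : Set ℝ)) := hA.prod MeasurableSet.univ
      rw [lintegral_indicator (hπm hA'),
        setLIntegral_withDensity_eq_setLIntegral_mul _ (by fun_prop) (by fun_prop) (hπm hA')]
      rw [Measure.setLIntegral_condKernel_univ_right (f := fun q : X × ℝ =>
        ENNReal.ofReal (c (q.1 + q.2 • e)) * ENNReal.ofReal (min t (r - q.2)))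
        (by fun_prop) hA, hρ2, setLIntegral_map hA' (by fun_prop) hπm]
      simp only [Pi.mul_apply, hπinv]
    have hmain := congrArg (fun m : Measure X => m (π ⁻¹' (A ×ˢ Set.Iic r)))
      (ksd_shift_measure ρ e b hbm hR hbR hS t ht)
    simp only [Measure.add_apply] at hmain
    rw [hpart b hbm hb1, hpart (fun x => -b x) hbm.neg hb1.neg,
      Measure.map_apply (by fun_prop) hD] at hmain
    have hmap : ∀ r', ρ2 (A ×ˢ Set.Iic r') = ρ (π ⁻¹' (A ×ˢ Set.Iic r')) := fun r' => by
      rw [hρ2, Measure.map_apply hπm (hA.prod measurableSet_Iic)]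
    rw [hmap, hmap, ← hmain]
    congr 2
    ext x
    simp only [Set.mem_preimage, hsh, Set.mem_prod, Set.mem_Iic]
    constructor <;> rintro ⟨h1, h2⟩ <;> exact ⟨h1, by linarith⟩
  have hfibQ : ∀ᵐ z ∂ρ2.fst, ∀ r t : ℚ, 0 < t →
      ρ2.condKernel z (Set.Iic ((r : ℝ) - t))
        + ∫⁻ s, ENNReal.ofReal (-b (z + s • e)) * ENNReal.ofReal (min (t : ℝ) (r - s))
            ∂(ρ2.condKernel z)
      = ρ2.condKernel z (Set.Iic (r : ℝ))
        + ∫⁻ s, ENNReal.ofReal (b (z + s • e)) * ENNReal.ofReal (min (t : ℝ) (r - s))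
            ∂(ρ2.condKernel z) := by
    rw [ae_all_iff]; intro r
    rw [ae_all_iff]; intro t
    by_cases ht : 0 < t
    · filter_upwards [hfib r t (by exact_mod_cast ht)] with z hz _
      exact hz
    · exact Eventually.of_forall fun z h => absurd h ht
  -- structure of the fibres
  have hstruct : ∀ᵐ z ∂ρ2.fst, ∃ c : ENNReal, (ρ2.condKernel z).withDensity
      (fun s => ENNReal.ofReal (Real.exp (W (z + s • e)))) = c • gaussianReal 0 lam := by
    filter_upwards [hfibQ, hbint, horth] with z hz hbz hoz
    set κ := ρ2.condKernel z with hκ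
    have hlam' : (lam : ℝ) ≠ 0 := by exact_mod_cast hlam
    have hin : ∀ s : ℝ, ⟪z + s • e, e⟫ = s := by
      intro s; simp only [inner_add_left, real_inner_smul_left, he, hoz]; ring
    obtain ⟨c, hc⟩ := ksd_oneD κ (fun s => W (z + s • e) + s ^ 2 / (2 * lam))
      (fun s => b (z + s • e)) (by
        intro s
        have h1 := (hW z s).add (((hasDerivAt_id s).pow 2).div_const (2 * (lam : ℝ)))
        refine h1.congr_deriv ?_
        rw [hin]; simp; field_simp; ring) (by fun_prop) hbz (by
        intro r1 r2 h12
        have h12' : (r1 : ℝ) < r2 := by exact_mod_cast h12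
        have h2 := hz r2 (r2 - r1) (by linarith)
        push_cast at h2
        rw [show (r2 : ℝ) - (r2 - r1) = r1 by ring] at h2
        have h3 := ksd_fubini_1d κ (fun s => b (z + s • e)) hbz r2 (r2 - r1) (by linarith)
        rw [show (r2 : ℝ) - (r2 - r1) = r1 by ring] at h3
        rw [h3]
        -- convert to real integrals
        set t : ℝ := (r2 : ℝ) - r1 with ht
        have ht0 : 0 < t := by rw [ht]; linarith
        have hreal : ∀ c : ℝ → ℝ, Integrable c κ →
            ∫⁻ s, ENNReal.ofReal (c s) * ENNReal.ofReal (min t (r2 - s)) ∂κ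
              = ENNReal.ofReal (∫ s, max (min t (r2 - s)) 0 * max (c s) 0 ∂κ) ∧
            Integrable (fun s => max (min t (r2 - s)) 0 * max (c s) 0) κ := by
          intro c hc
          have hi : Integrable (fun s => max (min t (r2 - s)) 0 * max (c s) 0) κ := by
            refine (hc.pos_part).bdd_mul (c := t) (by fun_prop) (Eventually.of_forall fun s => ?_)
            rw [Real.norm_of_nonneg (le_max_right _ _)]
            exact max_le (min_le_left _ _) ht0.le
          refine ⟨?_, hi⟩
          rw [ofReal_integral_eq_lintegral_ofReal hi (Eventually.of_forall fun s =>
            mul_nonneg (le_max_right _ _) (le_max_right _ _))]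
          refine lintegral_congr fun s => ?_
          rw [ENNReal.ofReal_mul (le_max_right _ _), mul_comm]
          congr 1 <;> rw [ENNReal.ofReal_max] <;> simp
        obtain ⟨e1, i1⟩ := hreal _ hbz
        obtain ⟨e2, i2⟩ := hreal (fun s => -b (z + s • e)) hbz.neg
        rw [e1, e2] at h2
        have h4 := congrArg ENNReal.toReal h2
        rw [ENNReal.toReal_add (measure_ne_top _ _) ENNReal.ofReal_ne_top,
          ENNReal.toReal_add (measure_ne_top _ _) ENNReal.ofReal_ne_top,
          ENNReal.toReal_ofReal (integral_nonneg fun s =>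
            mul_nonneg (le_max_right _ _) (le_max_right _ _)),
          ENNReal.toReal_ofReal (integral_nonneg fun s =>
            mul_nonneg (le_max_right _ _) (le_max_right _ _))] at h4
        have h5 : (∫ s, max (min t (r2 - s)) 0 * max (b (z + s • e)) 0 ∂κ)
            - ∫ s, max (min t (r2 - s)) 0 * max (-b (z + s • e)) 0 ∂κ
            = ∫ s, max (min t (r2 - s)) 0 * b (z + s • e) ∂κ := by
          rw [← integral_sub i1 i2]
          refine integral_congr_ae (Eventually.of_forall fun s => ?_)
          simp only
          rw [← mul_sub]
          congr 1
          rcases le_total 0 (b (z + s • e)) with h | h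
          · rw [max_eq_left h, max_eq_right (by linarith)]; ring
          · rw [max_eq_right h, max_eq_left (by linarith)]; ring
        have h6 : (κ (Set.Ioc (r1 : ℝ) r2)).toReal
            = (κ (Set.Iic (r2 : ℝ))).toReal - (κ (Set.Iic (r1 : ℝ))).toReal := by
          rw [show Set.Ioc (r1 : ℝ) r2 = Set.Iic (r2 : ℝ) \ Set.Iic (r1 : ℝ) by
            ext v; simp only [Set.mem_Ioc, Set.mem_diff, Set.mem_Iic, not_le]; tauto, measure_sdiff (Set.Iic_subset_Iic.2 h12'.le)
            measurableSet_Iic.nullMeasurableSet (measure_ne_top _ _),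
            ENNReal.toReal_sub_of_le (measure_mono (Set.Iic_subset_Iic.2 h12'.le))
              (measure_ne_top _ _)]
        linarith)
    refine ⟨ENNReal.ofReal c * ENNReal.ofReal (Real.sqrt (2 * Real.pi * lam)), ?_⟩
    have hWz : Measurable fun s : ℝ => W (z + s • e) := by fun_prop
    have h1 : (fun s : ℝ => ENNReal.ofReal (Real.exp (W (z + s • e))))
        = (fun s => ENNReal.ofReal (Real.exp (W (z + s • e) + s ^ 2 / (2 * lam))))
          * (fun s => ENNReal.ofReal (Real.exp (-(s ^ 2 / (2 * lam))))) := by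
      ext s
      rw [Pi.mul_apply, ← ENNReal.ofReal_mul (Real.exp_pos _).le, ← Real.exp_add]
      congr 2; ring
    rw [h1, withDensity_mul _ (by fun_prop) (by fun_prop), hc, withDensity_smul_measure,
      gaussianReal_of_var_ne_zero _ hlam, mul_smul]
    congr 1
    rw [← withDensity_smul _ (measurable_gaussianPDF _ _)]
    congr 1
    ext s
    simp only [Pi.smul_apply, smul_eq_mul, gaussianPDF, gaussianPDFReal]
    rw [← ENNReal.ofReal_mul (by positivity)]
    congr 1
    have : Real.sqrt (2 * Real.pi * lam) ≠ 0 := by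
      have : 0 < (lam : ℝ) := by exact_mod_cast pos_iff_ne_zero.2 hlam
      positivity
    rw [← mul_assoc, mul_inv_cancel₀ this, one_mul, sub_zero, neg_div]
  -- conclusion
  have hL := hdis (fun q => f (q.1 + q.2 • e) * ENNReal.ofReal (Real.exp (W (q.1 + q.2 • e))))
    (by fun_prop)
  have hgm : Measurable fun z : X => ∫⁻ s, f (z + s • e) ∂(gaussianReal 0 lam) :=
    Measurable.lintegral_prod_right' (f := fun q : X × ℝ => f (q.1 + q.2 • e)) (by fun_prop)
  have hRr := hdis (fun q => (∫⁻ s, f (q.1 + s • e) ∂(gaussianReal 0 lam))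
    * ENNReal.ofReal (Real.exp (W (q.1 + q.2 • e)))) (by fun_prop)
  simp only [hπinv] at hL hRr
  have hx : ∀ (x : X) (s : ℝ), x + (s - ⟪x, e⟫) • e = (π x).1 + s • e := by
    intro x s; simp only [hπ, sub_smul]; abel
  simp_rw [hx]
  rw [hL, hRr]
  refine lintegral_congr_ae ?_
  filter_upwards [hstruct] with z hz
  obtain ⟨c, hc⟩ := hz
  have hWz : Measurable fun s : ℝ => ENNReal.ofReal (Real.exp (W (z + s • e))) := by fun_prop
  have e1 := lintegral_withDensity_eq_lintegral_mul (ρ2.condKernel z) hWz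
    (g := fun s : ℝ => f (z + s • e)) (by fun_prop)
  have e2 := lintegral_withDensity_eq_lintegral_mul (ρ2.condKernel z) hWz
    (g := fun _ : ℝ => ∫⁻ s, f (z + s • e) ∂(gaussianReal 0 lam)) (by fun_prop)
  rw [hc] at e1 e2
  rw [lintegral_smul_measure] at e1 e2
  simp only [Pi.mul_apply] at e1 e2
  calc _ = ∫⁻ s, ENNReal.ofReal (Real.exp (W (z + s • e))) * f (z + s • e) ∂(ρ2.condKernel z) :=
        lintegral_congr fun s => mul_comm _ _
    _ = c • ∫⁻ s, f (z + s • e) ∂(gaussianReal 0 lam) := e1.symm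
    _ = c • ∫⁻ _ : ℝ, (∫⁻ s, f (z + s • e) ∂(gaussianReal 0 lam)) ∂(gaussianReal 0 lam) := by
        rw [lintegral_const, measure_univ, mul_one]
    _ = _ := e2
    _ = _ := lintegral_congr fun s => mul_comm _ _

section
variable {X : Type*} [NormedAddCommGroup X] [InnerProductSpace ℝ X] [CompleteSpace X]
    [MeasurableSpace X] [BorelSpace X] [SecondCountableTopology X]

lemma ksd_Ce_inner (C : X →L[ℝ] X) (hCsa : IsSelfAdjoint C)
    (e : HilbertBasis ℕ ℝ X) (l : ℕ → ℝ) (hCe : ∀ i, C (e i) = l i • e i) (y : X) (i : ℕ) :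
    ⟪C y, e i⟫ = l i * ⟪y, e i⟫ := by
  have h := (ContinuousLinearMap.isSelfAdjoint_iff_isSymmetric.1 hCsa) y (e i)
  simp only [ContinuousLinearMap.coe_coe] at h
  rw [h, hCe, real_inner_smul_right]

lemma ksd_C_nonneg (C : X →L[ℝ] X) (hCsa : IsSelfAdjoint C)
    (e : HilbertBasis ℕ ℝ X) (l : ℕ → ℝ) (hl : ∀ i, 0 < l i)
    (hCe : ∀ i, C (e i) = l i • e i) (y : X) : 0 ≤ ⟪C y, y⟫ := by
  have h := e.hasSum_inner_mul_inner (C y) y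
  rw [← h.tsum_eq]
  refine tsum_nonneg fun i => ?_
  rw [ksd_Ce_inner C hCsa e l hCe, real_inner_comm (e i) y]
  have := (hl i).le
  rw [mul_assoc]
  exact mul_nonneg this (mul_self_nonneg _)

lemma ksd_e_self (e : HilbertBasis ℕ ℝ X) (i : ℕ) : ⟪e i, e i⟫ = (1 : ℝ) := by
  rw [real_inner_self_eq_norm_sq, e.orthonormal.1 i]; norm_num

lemma ksd_charFun_NC (C : X →L[ℝ] X) (hpos : ∀ y : X, 0 ≤ ⟪C y, y⟫)
    (NC : Measure X) [IsProbabilityMeasure NC]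
    (hNC : ∀ y : X, Measure.map (fun x => ⟪y, x⟫) NC
      = gaussianReal 0 (Real.toNNReal ⟪C y, y⟫)) (t : X) :
    ∫ x, cexp (⟪x, t⟫ * I) ∂NC = cexp (-((⟪C t, t⟫ : ℝ) : ℂ) / 2) := by
  have h1 : charFun (Measure.map (fun x => ⟪t, x⟫) NC) 1 = ∫ x, cexp (⟪x, t⟫ * I) ∂NC := by
    rw [charFun_apply_real, integral_map (by fun_prop) (by fun_prop)]
    refine integral_congr_ae (Eventually.of_forall fun x => ?_)
    simp only [real_inner_comm t x]
    simp
  rw [← h1, hNC, charFun_gaussianReal]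
  congr 1
  simp only [ofReal_one, mul_one, ofReal_zero, zero_mul, one_pow]
  have : (((Real.toNNReal ⟪C t, t⟫ : NNReal) : ℝ) : ℂ) = ((⟪C t, t⟫ : ℝ) : ℂ) := by
    rw [Real.coe_toNNReal _ (hpos t)]
  rw [this]; ring

lemma ksd_NC_resample (C : X →L[ℝ] X) (hCsa : IsSelfAdjoint C)
    (e : HilbertBasis ℕ ℝ X) (l : ℕ → ℝ) (hl : ∀ i, 0 < l i)
    (hCe : ∀ i, C (e i) = l i • e i)
    (NC : Measure X) [IsProbabilityMeasure NC]
    (hNC : ∀ y : X, Measure.map (fun x => ⟪y, x⟫) NC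
      = gaussianReal 0 (Real.toNNReal ⟪C y, y⟫)) (i : ℕ) :
    (NC.prod (gaussianReal 0 (Real.toNNReal (l i)))).map
      (fun q : X × ℝ => q.1 + (q.2 - ⟪q.1, e i⟫) • e i) = NC := by
  have hpos := ksd_C_nonneg C hCsa e l hl hCe
  have hm : Measurable (fun q : X × ℝ => q.1 + (q.2 - ⟪q.1, e i⟫) • e i) := by fun_prop
  have : IsProbabilityMeasure ((NC.prod (gaussianReal 0 (Real.toNNReal (l i)))).map
      (fun q : X × ℝ => q.1 + (q.2 - ⟪q.1, e i⟫) • e i)) :=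
    Measure.isProbabilityMeasure_map hm.aemeasurable
  refine Measure.ext_of_charFun ?_
  ext t
  rw [charFun_apply, charFun_apply, integral_map hm.aemeasurable (by fun_prop),
    ksd_charFun_NC C hpos NC hNC]
  have h1 : ∀ q : X × ℝ, cexp ((⟪q.1 + (q.2 - ⟪q.1, e i⟫) • e i, t⟫ : ℝ) * I)
      = cexp ((⟪q.1, t - ⟪t, e i⟫ • e i⟫ : ℝ) * I) * cexp (((⟪t, e i⟫ : ℝ) : ℂ) * (q.2 : ℂ) * I) := by
    intro q
    rw [← Complex.exp_add, ← add_mul]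
    congr 2
    norm_cast
    simp only [inner_add_left, real_inner_smul_left, inner_sub_right, real_inner_smul_right]
    rw [real_inner_comm t (e i)]; ring
  simp_rw [h1]
  rw [integral_prod_mul (fun x : X => cexp ((⟪x, t - ⟪t, e i⟫ • e i⟫ : ℝ) * I))
    (fun s : ℝ => cexp (((⟪t, e i⟫ : ℝ) : ℂ) * (s : ℂ) * I)), ksd_charFun_NC C hpos NC hNC,
    ← charFun_apply_real, charFun_gaussianReal, ← Complex.exp_add]
  congr 1
  have : (((Real.toNNReal (l i) : NNReal) : ℝ) : ℂ) = ((l i : ℝ) : ℂ) := by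
    rw [Real.coe_toNNReal _ (hl i).le]
  rw [this]
  have h2 : ⟪C (t - ⟪t, e i⟫ • e i), t - ⟪t, e i⟫ • e i⟫ = ⟪C t, t⟫ - l i * ⟪t, e i⟫ ^ 2 := by
    simp only [map_sub, map_smul, hCe, inner_sub_left, inner_sub_right, real_inner_smul_left,
      real_inner_smul_right, ksd_Ce_inner C hCsa e l hCe, ksd_e_self]
    rw [real_inner_comm t (e i)]; ring
  rw [h2]
  push_cast
  ring

lemma ksd_Pn_le (e : HilbertBasis ℕ ℝ X) (n : ℕ) (y : X) :
    ‖∑ i ∈ Finset.range n, ⟪y, e i⟫ • e i‖ ≤ ‖y‖ := by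
  set p := ∑ i ∈ Finset.range n, ⟪y, e i⟫ • e i with hp
  have h1 : ⟪p, p⟫ = ⟪p, y⟫ := by
    have : ∀ j ∈ Finset.range n, ⟪e j, p⟫ = ⟪y, e j⟫ := by
      intro j hj
      rw [hp]
      exact e.orthonormal.inner_right_sum (fun i => ⟪y, e i⟫) hj
    conv_lhs => lhs; rw [hp]
    conv_rhs => rw [hp]
    rw [sum_inner, sum_inner]
    refine Finset.sum_congr rfl fun j hj => ?_
    rw [real_inner_smul_left, real_inner_smul_left, this j hj, real_inner_comm y]
  have h2 : ‖p‖ * ‖p‖ ≤ ‖p‖ * ‖y‖ := by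
    rw [← real_inner_self_eq_norm_mul_norm, h1]; exact real_inner_le_norm _ _
  by_cases h : ‖p‖ = 0
  · rw [h]; exact norm_nonneg _
  · exact le_of_mul_le_mul_left h2 (lt_of_le_of_ne (norm_nonneg _) (Ne.symm h))

lemma ksd_Pn_tendsto (e : HilbertBasis ℕ ℝ X) (y : X) :
    Tendsto (fun n => ∑ i ∈ Finset.range n, ⟪y, e i⟫ • e i) atTop (nhds y) := by
  have h := (e.hasSum_repr y).tendsto_sum_nat
  refine h.congr fun n => Finset.sum_congr rfl fun i _ => ?_
  rw [e.repr_apply_apply, real_inner_comm]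

lemma ksd_M_n (C : X →L[ℝ] X) (hCsa : IsSelfAdjoint C)
    (e : HilbertBasis ℕ ℝ X) (l : ℕ → ℝ) (hl : ∀ i, 0 < l i)
    (hCe : ∀ i, C (e i) = l i • e i)
    (NC : Measure X) [IsProbabilityMeasure NC]
    (hNC : ∀ y : X, Measure.map (fun x => ⟪y, x⟫) NC
      = gaussianReal 0 (Real.toNNReal ⟪C y, y⟫))
    (M : Measure X)
    (hM : ∀ i, ∀ f : X → ENNReal, Measurable f → ∫⁻ x, f x ∂M =
      ∫⁻ x, ∫⁻ s, f (x + (s - ⟪x, e i⟫) • e i) ∂(gaussianReal 0 (Real.toNNReal (l i))) ∂M)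
    (n : ℕ) : ∀ f : X → ENNReal, Measurable f → ∫⁻ x, f x ∂M =
      ∫⁻ x, ∫⁻ x', f (x + ∑ i ∈ Finset.range n, ⟪x' - x, e i⟫ • e i) ∂NC ∂M := by
  induction n with
  | zero => intro f hf; simp
  | succ n ih =>
    intro f hf
    have hg : Measurable fun x : X => ∫⁻ s, f (x + (s - ⟪x, e n⟫) • e n)
        ∂(gaussianReal 0 (Real.toNNReal (l n))) :=
      Measurable.lintegral_prod_right' (f := fun q : X × ℝ => f (q.1 + (q.2 - ⟪q.1, e n⟫) • e n))
        (by fun_prop)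
    rw [hM n f hf, ih _ hg]
    refine lintegral_congr fun x => ?_
    set w : X → X := fun x' => x + ∑ i ∈ Finset.range (n + 1), ⟪x' - x, e i⟫ • e i with hw
    have hwm : Measurable w := by fun_prop
    have h1 : ∫⁻ x', f (w x') ∂NC = ∫⁻ q : X × ℝ, f (w (q.1 + (q.2 - ⟪q.1, e n⟫) • e n))
        ∂(NC.prod (gaussianReal 0 (Real.toNNReal (l n)))) := by
      conv_lhs => rw [← ksd_NC_resample C hCsa e l hl hCe NC hNC n]
      rw [lintegral_map (by fun_prop) (by fun_prop)]
    have hort : ∀ i ∈ Finset.range n, ⟪e n, e i⟫ = (0 : ℝ) := fun i hi =>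
      e.orthonormal.2 (Finset.mem_range.1 hi).ne'
    change _ = ∫⁻ x', f (w x') ∂NC
    rw [h1, lintegral_prod _ (by fun_prop)]
    refine lintegral_congr fun x' => lintegral_congr fun s => ?_
    congr 1
    simp only [hw]
    rw [Finset.sum_range_succ]
    have h2 : ⟪x + ∑ i ∈ Finset.range n, ⟪x' - x, e i⟫ • e i, e n⟫ = ⟪x, e n⟫ := by
      rw [inner_add_left, sum_inner, Finset.sum_eq_zero, add_zero]
      intro i hi
      rw [real_inner_smul_left, real_inner_comm (e n) (e i), hort i hi, mul_zero]
    have h3 : ⟪x' + (s - ⟪x', e n⟫) • e n - x, e n⟫ = s - ⟪x, e n⟫ := by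
      rw [inner_sub_left, inner_add_left, real_inner_smul_left, ksd_e_self]; ring
    rw [h2, h3, add_assoc]
    congr 2
    refine Finset.sum_congr rfl fun i hi => ?_
    rw [inner_sub_left, inner_sub_left, inner_add_left, real_inner_smul_left, hort i hi]
    simp

lemma ksd_M_finite (e : HilbertBasis ℕ ℝ X) (NC : Measure X) [IsProbabilityMeasure NC]
    (M : Measure X) 
    (hM : ∀ n : ℕ, ∀ f : X → ENNReal, Measurable f → ∫⁻ x, f x ∂M =
      ∫⁻ x, ∫⁻ x', f (x + ∑ i ∈ Finset.range n, ⟪x' - x, e i⟫ • e i) ∂NC ∂M)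
    (hloc : ∀ x0, ∃ r > 0, M (Metric.ball x0 r) < ⊤) : IsFiniteMeasure M := by
  have hne : (Measure.support NC).Nonempty := Measure.nonempty_support (NeZero.ne NC)
  obtain ⟨x0, hx0⟩ := hne
  obtain ⟨r, hr, hMr⟩ := hloc x0
  have hpos : 0 < NC (Metric.ball x0 (r / 2)) :=
    Measure.mem_support_iff_forall x0 |>.1 hx0 _ (Metric.ball_mem_nhds x0 (by positivity))
  set S : ℕ → Set X := fun n =>
    {x | ‖(x - x0) - ∑ i ∈ Finset.range n, ⟪x - x0, e i⟫ • e i‖ < r / 2} with hS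
  have hSm : ∀ n, MeasurableSet (S n) := fun n =>
    measurableSet_lt (by fun_prop) (by fun_prop)
  have hb : ∀ n, M (S n) * NC (Metric.ball x0 (r / 2)) ≤ M (Metric.ball x0 r) := by
    intro n
    have h1 := hM n ((Metric.ball x0 r).indicator 1) (measurable_one.indicator measurableSet_ball)
    rw [lintegral_indicator_one measurableSet_ball] at h1
    rw [h1]
    have h2 : M (S n) * NC (Metric.ball x0 (r / 2)) =
        ∫⁻ x, (S n).indicator (fun _ => NC (Metric.ball x0 (r / 2))) x ∂M := by
      rw [lintegral_indicator (hSm n), setLIntegral_const, mul_comm]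
    rw [h2]
    refine lintegral_mono fun x => ?_
    by_cases hx : x ∈ S n
    · rw [Set.indicator_of_mem hx, ← lintegral_indicator_one measurableSet_ball]
      refine lintegral_mono fun x' => ?_
      by_cases hx' : x' ∈ Metric.ball x0 (r / 2)
      · rw [Set.indicator_of_mem hx', Set.indicator_of_mem]
        · rfl
        rw [mem_ball_iff_norm]
        have h3 : x + ∑ i ∈ Finset.range n, ⟪x' - x, e i⟫ • e i - x0
            = ((x - x0) - ∑ i ∈ Finset.range n, ⟪x - x0, e i⟫ • e i)
              + ∑ i ∈ Finset.range n, ⟪x' - x0, e i⟫ • e i := by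
          have : ∑ i ∈ Finset.range n, ⟪x' - x, e i⟫ • e i
            = ∑ i ∈ Finset.range n, ⟪x' - x0, e i⟫ • e i
              - ∑ i ∈ Finset.range n, ⟪x - x0, e i⟫ • e i := by
            rw [← Finset.sum_sub_distrib]
            refine Finset.sum_congr rfl fun i _ => ?_
            rw [← sub_smul, ← inner_sub_left]
            congr 2; abel
          rw [this]; abel
        rw [h3]
        have h4 : ‖(x - x0) - ∑ i ∈ Finset.range n, ⟪x - x0, e i⟫ • e i‖ < r / 2 := hx
        have h5 := ksd_Pn_le e n (x' - x0)
        rw [mem_ball_iff_norm] at hx'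
        calc _ ≤ _ := norm_add_le _ _
          _ < r := by linarith
      · rw [Set.indicator_of_notMem hx']; exact zero_le
    · rw [Set.indicator_of_notMem hx]; exact zero_le
  have hfat : M Set.univ ≤ liminf (fun n => M (S n)) atTop := by
    have h1 := lintegral_liminf_le (μ := M) (u := atTop) (f := fun n => (S n).indicator 1)
      (fun n => measurable_one.indicator (hSm n))
    simp only [lintegral_indicator_one (hSm _)] at h1
    refine le_trans ?_ h1
    rw [← lintegral_one]
    refine lintegral_mono fun x => ?_
    refine le_of_eq ?_
    symm
    refine Tendsto.liminf_eq (tendsto_const_nhds.congr' ?_)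
    have h2 := (tendsto_const_nhds (x := x - x0)).sub (ksd_Pn_tendsto e (x - x0))
    rw [sub_self] at h2
    have h3 := h2.norm
    rw [norm_zero] at h3
    filter_upwards [h3.eventually (gt_mem_nhds (by positivity : (0 : ℝ) < r / 2))] with n hn
    rw [Set.indicator_of_mem (by exact hn)]
    rfl
  refine ⟨lt_of_le_of_lt hfat ?_⟩
  have h6 : liminf (fun n => M (S n)) atTop
      ≤ M (Metric.ball x0 r) / NC (Metric.ball x0 (r / 2)) := by
    refine liminf_le_of_le (by isBoundedDefault) fun b hb' => ?_
    obtain ⟨n, hn⟩ := hb'.exists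
    refine hn.trans ?_
    rw [ENNReal.le_div_iff_mul_le (Or.inl hpos.ne') (Or.inl (measure_ne_top _ _))]
    exact hb n
  exact lt_of_le_of_lt h6 (ENNReal.div_lt_top hMr.ne hpos.ne')

lemma ksd_M_eq (e : HilbertBasis ℕ ℝ X) (NC : Measure X) [IsProbabilityMeasure NC]
    (M : Measure X) [IsFiniteMeasure M]
    (hM : ∀ n : ℕ, ∀ f : X → ENNReal, Measurable f → ∫⁻ x, f x ∂M =
      ∫⁻ x, ∫⁻ x', f (x + ∑ i ∈ Finset.range n, ⟪x' - x, e i⟫ • e i) ∂NC ∂M) :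
    M = M Set.univ • NC := by
  have : IsFiniteMeasure (M Set.univ • NC) :=
    Measure.smul_finite NC (measure_ne_top M Set.univ)
  refine ext_of_forall_lintegral_eq_of_IsFiniteMeasure fun f => ?_
  have h1 : ∀ n : ℕ, ∫⁻ q : X × X, (f (q.1 + ∑ i ∈ Finset.range n, ⟪q.2 - q.1, e i⟫ • e i) : ENNReal)
      ∂(M.prod NC) = ∫⁻ x, (f x : ENNReal) ∂M := by
    intro n
    rw [hM n _ (by fun_prop), lintegral_prod _ (by fun_prop)]
  have h2 := tendsto_lintegral_of_dominated_convergence (μ := M.prod NC)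
    (F := fun n q => (f (q.1 + ∑ i ∈ Finset.range n, ⟪q.2 - q.1, e i⟫ • e i) : ENNReal))
    (f := fun q => (f q.2 : ENNReal)) (fun _ => (nndist f 0 : ENNReal)) (fun n => by fun_prop)
    (fun n => Eventually.of_forall fun q => by
      exact ENNReal.coe_le_coe.2 (BoundedContinuousFunction.NNReal.upper_bound f _))
    (by rw [lintegral_const]; exact ENNReal.mul_ne_top ENNReal.coe_ne_top (measure_ne_top _ _))
    (Eventually.of_forall fun q => by
      have h3 := (tendsto_const_nhds (x := q.1)).add (ksd_Pn_tendsto e (q.2 - q.1))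
      rw [add_sub_cancel] at h3
      exact (ENNReal.continuous_coe.tendsto _).comp ((f.continuous.tendsto _).comp h3))
  simp_rw [h1] at h2
  rw [tendsto_nhds_unique tendsto_const_nhds h2, lintegral_prod _ (by fun_prop)]
  simp only []
  rw [lintegral_const, lintegral_smul_measure, smul_eq_mul, mul_comm]
end

/-- polynomial kernel with derivative features -/
noncomputable def ksdK (n : ℕ) (S A A' B f g f' g' : ℝ) : ℝ :=
  f * f' * S ^ n + n * S ^ (n - 1) * (g * f' * A' + f * g' * A + g * g' * B)
    + n * (n - 1 : ℕ) * S ^ (n - 2) * (g * g' * A * A')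

lemma ksdK_succ (n N : ℕ) (u u' q : ℕ → ℝ) (f g f' g' : ℝ) :
    ksdK (n + 1) (∑ j ∈ Finset.range N, u j * u' j) (∑ j ∈ Finset.range N, u j * q j)
      (∑ j ∈ Finset.range N, u' j * q j) (∑ j ∈ Finset.range N, q j * q j) f g f' g'
    = ∑ j ∈ Finset.range N, ksdK n (∑ j ∈ Finset.range N, u j * u' j)
      (∑ j ∈ Finset.range N, u j * q j)
      (∑ j ∈ Finset.range N, u' j * q j) (∑ j ∈ Finset.range N, q j * q j)
      (f * u j + g * q j) (g * u j) (f' * u' j + g' * q j) (g' * u' j) := by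
  set S := ∑ j ∈ Finset.range N, u j * u' j with hS
  set A := ∑ j ∈ Finset.range N, u j * q j with hA
  set A' := ∑ j ∈ Finset.range N, u' j * q j with hA'
  set B := ∑ j ∈ Finset.range N, q j * q j with hB
  have h : ∀ j, ksdK n S A A' B (f * u j + g * q j) (g * u j) (f' * u' j + g' * q j) (g' * u' j)
      = (S ^ n * f * f' + n * S ^ (n - 1) * (g * f' * A' + f * g' * A + g * g' * B)
          + n * (n - 1 : ℕ) * S ^ (n - 2) * (g * g' * A * A')) * (u j * u' j)
        + (S ^ n * f * g' + n * S ^ (n - 1) * g * g' * A') * (u j * q j)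
        + (S ^ n * g * f' + n * S ^ (n - 1) * g * g' * A) * (u' j * q j)
        + S ^ n * g * g' * (q j * q j) := by
    intro j; unfold ksdK; ring
  simp_rw [h]
  rw [Finset.sum_add_distrib, Finset.sum_add_distrib, Finset.sum_add_distrib,
    ← Finset.mul_sum, ← Finset.mul_sum, ← Finset.mul_sum, ← Finset.mul_sum,
    ← hS, ← hA, ← hA', ← hB]
  unfold ksdK
  rcases n with _ | _ | n
  · simp; ring
  · simp; ring
  · simp only [Nat.add_sub_cancel, show n + 1 + 1 + 1 - 2 = n + 1 by omega,
      show n + 1 + 1 - 1 = n + 1 by omega, show n + 1 + 1 - 2 = n by omega]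
    push_cast; ring

lemma ksdK_psd {Ω : Type*} [MeasurableSpace Ω] (ν : Measure Ω) [IsFiniteMeasure ν]
    (u : ℕ → Ω → ℝ) (hu : ∀ j, Measurable (u j)) (q : ℕ → ℝ) (R : Ω → ℝ) (hR : Measurable R)
    (hR0 : ∀ ω, 0 ≤ R ω) (huR : ∀ j ω, |u j ω| ≤ R ω) (N : ℕ) (n : ℕ) :
    ∀ f g : Ω → ℝ, (∀ k : ℕ, Integrable (fun ω => f ω * R ω ^ k) ν) →
      (∀ k : ℕ, Integrable (fun ω => g ω * R ω ^ k) ν) →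
      Integrable (fun p : Ω × Ω => ksdK n (∑ j ∈ Finset.range N, u j p.1 * u j p.2)
        (∑ j ∈ Finset.range N, u j p.1 * q j)
        (∑ j ∈ Finset.range N, u j p.2 * q j) (∑ j ∈ Finset.range N, q j * q j)
        (f p.1) (g p.1) (f p.2) (g p.2)) (ν.prod ν) ∧
      0 ≤ ∫ p : Ω × Ω, ksdK n (∑ j ∈ Finset.range N, u j p.1 * u j p.2)
        (∑ j ∈ Finset.range N, u j p.1 * q j)
        (∑ j ∈ Finset.range N, u j p.2 * q j) (∑ j ∈ Finset.range N, q j * q j)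
        (f p.1) (g p.1) (f p.2) (g p.2) ∂(ν.prod ν) := by
  induction n with
  | zero =>
    intro f g hf hg
    have hf0 : Integrable f ν := by simpa using hf 0
    have h : ∀ p : Ω × Ω, ksdK 0 (∑ j ∈ Finset.range N, u j p.1 * u j p.2)
        (∑ j ∈ Finset.range N, u j p.1 * q j)
        (∑ j ∈ Finset.range N, u j p.2 * q j) (∑ j ∈ Finset.range N, q j * q j)
        (f p.1) (g p.1) (f p.2) (g p.2) = f p.1 * f p.2 := by
      intro p; simp [ksdK]
    simp_rw [h]
    refine ⟨hf0.mul_prod hf0, ?_⟩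
    rw [integral_prod_mul]
    exact mul_self_nonneg _
  | succ n ih =>
    intro f g hf hg
    have hmul : ∀ (φ : Ω → ℝ) (j : ℕ), (∀ k : ℕ, Integrable (fun ω => φ ω * R ω ^ k) ν) →
        ∀ k : ℕ, Integrable (fun ω => φ ω * u j ω * R ω ^ k) ν := by
      intro φ j hφ k
      have hm : AEStronglyMeasurable φ ν := by simpa using (hφ 0).1
      refine (hφ (k + 1)).mono ((hm.mul (hu j).aestronglyMeasurable).mul
        (hR.pow_const k).aestronglyMeasurable) (Eventually.of_forall fun ω => ?_)
      rw [norm_mul, norm_mul, norm_mul, norm_pow, norm_pow, pow_succ, Real.norm_eq_abs (u j ω),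
        Real.norm_of_nonneg (hR0 ω), mul_assoc, mul_comm (|u j ω|)]
      have h3 := hR0 ω
      have h4 := huR j ω
      gcongr
    have key : ∀ j, _ := fun j => ih (fun ω => f ω * u j ω + g ω * q j) (fun ω => g ω * u j ω)
      (fun k => by
        have h1 := (hmul f j hf k).add ((hg k).mul_const (q j))
        refine h1.congr (Eventually.of_forall fun ω => ?_)
        simp only [Pi.add_apply]; ring) (hmul g j hg)
    simp_rw [ksdK_succ n N (fun j => u j _) (fun j => u j _) q]
    refine ⟨integrable_finsetSum _ fun j _ => (key j).1, ?_⟩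
    rw [integral_finsetSum _ fun j _ => (key j).1]
    exact Finset.sum_nonneg fun j _ => (key j).2

lemma ksdK_hasSum (S A A' B f g f' g' : ℝ) :
    HasSum (fun n : ℕ => ksdK n S A A' B f g f' g' / n.factorial)
      (Real.exp S * (f * f' + (g * f' * A' + f * g' * A + g * g' * B) + g * g' * A * A')) := by
  have h0 : HasSum (fun n : ℕ => S ^ n / n.factorial) (Real.exp S) := by
    rw [Real.exp_eq_exp_ℝ]; exact NormedSpace.expSeries_div_hasSum_exp S
  have h1 : HasSum (fun n : ℕ => (n : ℝ) * S ^ (n - 1) / n.factorial) (Real.exp S) := by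
    rw [← hasSum_nat_add_iff' 1]
    simp only [Finset.range_one, Finset.sum_singleton, Nat.cast_zero, zero_mul, zero_div, sub_zero]
    refine h0.congr_fun fun n => ?_
    rw [Nat.add_sub_cancel, Nat.factorial_succ]
    push_cast
    have : (n.factorial : ℝ) ≠ 0 := by positivity
    have : (n : ℝ) + 1 ≠ 0 := by positivity
    field_simp
  have h2 : HasSum (fun n : ℕ => (n : ℝ) * (n - 1 : ℕ) * S ^ (n - 2) / n.factorial)
      (Real.exp S) := by
    rw [← hasSum_nat_add_iff' 2]
    simp only [Finset.sum_range_succ, Finset.range_zero, Finset.sum_empty, Nat.cast_zero, zero_mul,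
      zero_div, Nat.sub_self, mul_zero, add_zero, sub_zero]
    refine h0.congr_fun fun n => ?_
    rw [Nat.add_sub_cancel, show n + 2 - 1 = n + 1 by omega, Nat.factorial_succ, Nat.factorial_succ]
    push_cast
    have : (n.factorial : ℝ) ≠ 0 := by positivity
    have : (n : ℝ) + 1 ≠ 0 := by positivity
    have : (n : ℝ) + 1 + 1 ≠ 0 := by positivity
    field_simp
    ring
  have h := ((h0.mul_left (f * f')).add (h1.mul_left (g * f' * A' + f * g' * A + g * g' * B))).add
    (h2.mul_left (g * g' * A * A'))
  have e1 : Real.exp S * (f * f' + (g * f' * A' + f * g' * A + g * g' * B) + g * g' * A * A')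
    = f * f' * Real.exp S + (g * f' * A' + f * g' * A + g * g' * B) * Real.exp S
      + g * g' * A * A' * Real.exp S := by ring
  rw [e1]
  refine h.congr_fun fun n => ?_
  unfold ksdK; ring

lemma ksdK_abs_le (n : ℕ) (S A A' B f g f' g' r r' b : ℝ) (hr : 0 ≤ r) (hr' : 0 ≤ r')
    (hb : 0 ≤ b)
    (hS : |S| ≤ r * r') (hA : |A| ≤ r * b) (hA' : |A'| ≤ r' * b) (hB : |B| ≤ b * b) :
    |ksdK n S A A' B f g f' g'| ≤ ksdK n (r * r') (r * b) (r' * b) (b * b) |f| |g| |f'| |g'| := by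
  unfold ksdK
  have hSn : ∀ m : ℕ, |S| ^ m ≤ (r * r') ^ m := fun m => pow_le_pow_left₀ (abs_nonneg _) hS m
  refine (abs_add_le _ _).trans (add_le_add ((abs_add_le _ _).trans (add_le_add ?_ ?_)) ?_)
  · rw [abs_mul, abs_mul, abs_pow]
    exact mul_le_mul_of_nonneg_left (hSn n) (by positivity)
  · rw [abs_mul, abs_mul, abs_pow, Nat.abs_cast]
    have h3 := hSn (n - 1)
    refine mul_le_mul (by gcongr) ?_ (abs_nonneg _) (by positivity)
    refine (abs_add_le _ _).trans (add_le_add ((abs_add_le _ _).trans (add_le_add ?_ ?_)) ?_) <;>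
    · rw [abs_mul, abs_mul]; gcongr
  · rw [abs_mul, abs_mul, abs_mul, abs_pow, Nat.abs_cast, Nat.abs_cast]
    have h3 := hSn (n - 2)
    refine mul_le_mul (by gcongr) ?_ (abs_nonneg _) (by positivity)
    rw [abs_mul, abs_mul, abs_mul]; gcongr

lemma ksd_psd_trunc_bound (S A A' B f g f' g' r r' b : ℝ) (hr : 0 ≤ r) (hr' : 0 ≤ r')
    (hb : 0 ≤ b)
    (hS : S ≤ r * r') (hA : |A| ≤ r * b) (hA' : |A'| ≤ r' * b) (hB : |B| ≤ b * b) :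
    Real.exp (-(r ^ 2 + r' ^ 2) / 2) *
      |Real.exp S * (f * f' + (g * f' * A' + f * g' * A + g * g' * B) + g * g' * A * A')|
    ≤ (|f| + |g| * b) * (1 + r) * ((|f'| + |g'| * b) * (1 + r')) := by
  rw [abs_mul, abs_of_pos (Real.exp_pos _), ← mul_assoc, ← Real.exp_add]
  have h1 : Real.exp (-(r ^ 2 + r' ^ 2) / 2 + S) ≤ 1 := by
    rw [Real.exp_le_one_iff]; nlinarith [sq_nonneg (r - r')]
  refine (mul_le_of_le_one_left (abs_nonneg _) h1).trans ?_
  have h2 : |f * f' + (g * f' * A' + f * g' * A + g * g' * B) + g * g' * A * A'|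
      ≤ |f| * |f'| + (|g| * |f'| * (r' * b) + |f| * |g'| * (r * b) + |g| * |g'| * (b * b))
        + |g| * |g'| * (r * b) * (r' * b) := by
    refine (abs_add_le _ _).trans (add_le_add ((abs_add_le _ _).trans (add_le_add ?_
      ((abs_add_le _ _).trans (add_le_add ((abs_add_le _ _).trans (add_le_add ?_ ?_)) ?_)))) ?_)
    · rw [abs_mul]
    · rw [abs_mul, abs_mul]; gcongr
    · rw [abs_mul, abs_mul]; gcongr
    · rw [abs_mul, abs_mul]; gcongr
    · rw [abs_mul, abs_mul, abs_mul]; gcongr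
  refine h2.trans ?_
  have e0 : 0 ≤ |f| * |f'| := by positivity
  have e1 : 0 ≤ |g| * |f'| * b := by positivity
  have e2 : 0 ≤ |f| * |g'| * b := by positivity
  have e3 : 0 ≤ |g| * |g'| * (b * b) := by positivity
  have er : 0 ≤ r * r' := by positivity
  have x1 := mul_nonneg e0 hr
  have x2 := mul_nonneg e0 hr'
  have x3 := mul_nonneg e0 er
  have y1 := mul_nonneg e1 hr
  have y3 := mul_nonneg e1 er
  have z2 := mul_nonneg e2 hr'
  have z3 := mul_nonneg e2 er
  have w1 := mul_nonneg e3 hr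
  have w2 := mul_nonneg e3 hr'
  nlinarith

lemma ksd_cs_range (u v : ℕ → ℝ) (r r' : ℝ) (hr : 0 ≤ r) (hr' : 0 ≤ r') (N : ℕ)
    (hu : ∑ j ∈ Finset.range N, u j ^ 2 ≤ r ^ 2) (hv : ∑ j ∈ Finset.range N, v j ^ 2 ≤ r' ^ 2) :
    |∑ j ∈ Finset.range N, u j * v j| ≤ r * r' := by
  refine abs_le_of_sq_le_sq ?_ (by positivity)
  refine (Finset.sum_mul_sq_le_sq_mul_sq _ u v).trans ?_
  rw [mul_pow]
  exact mul_le_mul hu hv (Finset.sum_nonneg fun _ _ => sq_nonneg _) (by positivity)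

/-- Positivity in the exponential limit. -/
lemma ksd_psd {Ω : Type*} [MeasurableSpace Ω] (ν : Measure Ω) [IsFiniteMeasure ν]
    (u : ℕ → Ω → ℝ) (hu : ∀ j, Measurable (u j)) (q : ℕ → ℝ) (R : Ω → ℝ) (hR : Measurable R)
    (hR0 : ∀ ω, 0 ≤ R ω) (huR : ∀ N ω, ∑ j ∈ Finset.range N, u j ω ^ 2 ≤ R ω ^ 2)
    (b : ℝ) (hb : 0 ≤ b) (hqb : ∀ N, ∑ j ∈ Finset.range N, q j ^ 2 ≤ b ^ 2)
    (S : Ω → Ω → ℝ) (A : Ω → ℝ) (B : ℝ)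
    (hS : ∀ ω ω', Tendsto (fun N => ∑ j ∈ Finset.range N, u j ω * u j ω') atTop (nhds (S ω ω')))
    (hA : ∀ ω, Tendsto (fun N => ∑ j ∈ Finset.range N, u j ω * q j) atTop (nhds (A ω)))
    (hB : Tendsto (fun N => ∑ j ∈ Finset.range N, q j * q j) atTop (nhds B))
    (f g : Ω → ℝ) (hfm : Measurable f) (hgm : Measurable g)
    (hf : Integrable (fun ω => f ω * (1 + R ω)) ν)
    (hg : Integrable (fun ω => g ω * (1 + R ω)) ν) :
    0 ≤ ∫ p : Ω × Ω, Real.exp (-(R p.1 ^ 2 + R p.2 ^ 2) / 2 + S p.1 p.2) *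
      (f p.1 * f p.2 + (g p.1 * f p.2 * A p.2 + f p.1 * g p.2 * A p.1 + g p.1 * g p.2 * B)
        + g p.1 * g p.2 * A p.1 * A p.2) ∂(ν.prod ν) := by
  set bd : Ω × Ω → ℝ := fun p => (|f p.1| + |g p.1| * b) * (1 + R p.1)
    * ((|f p.2| + |g p.2| * b) * (1 + R p.2)) with hbd
  have hbdi : Integrable bd (ν.prod ν) := by
    have h1 : Integrable (fun ω => (|f ω| + |g ω| * b) * (1 + R ω)) ν := by
      have h2 := hf.abs.add (hg.abs.mul_const b)
      refine h2.congr (Eventually.of_forall fun ω => ?_)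
      have h3 : 0 ≤ 1 + R ω := by have := hR0 ω; linarith
      simp only [Pi.add_apply, abs_mul, abs_of_nonneg h3]; ring
    exact h1.mul_prod h1
  have hSN : ∀ N (p : Ω × Ω), |∑ j ∈ Finset.range N, u j p.1 * u j p.2| ≤ R p.1 * R p.2 :=
    fun N p => ksd_cs_range (fun j => u j p.1) (fun j => u j p.2) _ _ (hR0 _) (hR0 _) N
      (huR _ _) (huR _ _)
  have hAN : ∀ N ω, |∑ j ∈ Finset.range N, u j ω * q j| ≤ R ω * b :=
    fun N ω => ksd_cs_range (fun j => u j ω) q _ _ (hR0 _) hb N (huR _ _) (hqb _)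
  have hBN : ∀ N, |∑ j ∈ Finset.range N, q j * q j| ≤ b * b :=
    fun N => ksd_cs_range q q _ _ hb hb N (hqb _) (hqb _)
  have hu1 : ∀ j ω, |u j ω| ≤ R ω := by
    intro j ω
    refine abs_le_of_sq_le_sq ?_ (hR0 ω)
    refine le_trans ?_ (huR (j + 1) ω)
    exact Finset.single_le_sum (f := fun j => u j ω ^ 2) (fun _ _ => sq_nonneg _)
      (Finset.mem_range.2 (Nat.lt_succ_self j))
  -- weighted functions
  set w : Ω → ℝ := fun ω => Real.exp (-(R ω ^ 2) / 2) with hw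
  have hwm : Measurable w := by fun_prop
  have hmom : ∀ φ : Ω → ℝ, Measurable φ → Integrable (fun ω => φ ω * (1 + R ω)) ν →
      ∀ k : ℕ, Integrable (fun ω => φ ω * w ω * R ω ^ k) ν := by
    intro φ hφm hφ k
    have hbk : ∃ c : ℝ, ∀ r : ℝ, 0 ≤ r → Real.exp (-(r ^ 2) / 2) * r ^ k ≤ c := by
      refine ⟨(k.factorial : ℝ) * Real.exp (1 / 2), fun r hr => ?_⟩
      have h1 := Real.pow_div_factorial_le_exp r hr k
      rw [div_le_iff₀ (by positivity)] at h1
      calc Real.exp (-(r ^ 2) / 2) * r ^ k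
          ≤ Real.exp (-(r ^ 2) / 2) * (Real.exp r * k.factorial) := by gcongr
        _ = k.factorial * Real.exp (-(r ^ 2) / 2 + r) := by rw [Real.exp_add]; ring
        _ ≤ _ := by
          gcongr
          nlinarith [sq_nonneg (r - 1)]
    obtain ⟨c, hc⟩ := hbk
    refine (hφ.mul_const c).mono (by fun_prop) (Eventually.of_forall fun ω => ?_)
    have h0 := hc (R ω) (hR0 ω)
    have h1 : 0 ≤ w ω * R ω ^ k := by have := hR0 ω; positivity
    have hc0 : 0 ≤ c := h1.trans h0
    rw [mul_assoc, norm_mul, Real.norm_of_nonneg h1, norm_mul, norm_mul, Real.norm_of_nonneg hc0]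
    have h3 : 1 ≤ ‖1 + R ω‖ := by
      have := hR0 ω
      rw [Real.norm_of_nonneg (by linarith)]; linarith
    rw [mul_assoc]
    refine mul_le_mul_of_nonneg_left ?_ (norm_nonneg _)
    calc w ω * R ω ^ k ≤ c := h0
      _ ≤ ‖1 + R ω‖ * c := le_mul_of_one_le_left hc0 h3
  -- finite truncation
  have hN : ∀ N : ℕ, 0 ≤ ∫ p : Ω × Ω, Real.exp (-(R p.1 ^ 2 + R p.2 ^ 2) / 2) *
      (Real.exp (∑ j ∈ Finset.range N, u j p.1 * u j p.2) *
      (f p.1 * f p.2 + (g p.1 * f p.2 * (∑ j ∈ Finset.range N, u j p.2 * q j)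
        + f p.1 * g p.2 * (∑ j ∈ Finset.range N, u j p.1 * q j)
        + g p.1 * g p.2 * (∑ j ∈ Finset.range N, q j * q j))
        + g p.1 * g p.2 * (∑ j ∈ Finset.range N, u j p.1 * q j)
          * (∑ j ∈ Finset.range N, u j p.2 * q j))) ∂(ν.prod ν) := by
    intro N
    set KN : ℕ → Ω × Ω → ℝ := fun n p => ksdK n (∑ j ∈ Finset.range N, u j p.1 * u j p.2)
        (∑ j ∈ Finset.range N, u j p.1 * q j)
        (∑ j ∈ Finset.range N, u j p.2 * q j) (∑ j ∈ Finset.range N, q j * q j)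
        (f p.1 * w p.1) (g p.1 * w p.1) (f p.2 * w p.2) (g p.2 * w p.2) / n.factorial with hKN
    have hK := fun n => ksdK_psd ν u hu q R hR hR0 hu1 N n (fun ω => f ω * w ω)
      (fun ω => g ω * w ω) (hmom f hfm hf) (hmom g hgm hg)
    have hKint : ∀ n, Integrable (KN n) (ν.prod ν) := fun n => (hK n).1.div_const _
    have hww : ∀ p : Ω × Ω, Real.exp (-(R p.1 ^ 2 + R p.2 ^ 2) / 2) = w p.1 * w p.2 := by
      intro p; simp only [hw]; rw [← Real.exp_add]; congr 1; ring
    have hlim := tendsto_integral_of_dominated_convergence (μ := ν.prod ν)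
      (F := fun M p => ∑ n ∈ Finset.range M, KN n p) bd
      (fun M => (integrable_finsetSum _ fun n _ => hKint n).1) hbdi
      (fun M => Eventually.of_forall fun p => by
        have hs := ksdK_hasSum (R p.1 * R p.2) (R p.1 * b) (R p.2 * b) (b * b)
          |f p.1 * w p.1| |g p.1 * w p.1| |f p.2 * w p.2| |g p.2 * w p.2|
        have hr1 := hR0 p.1
        have hr2 := hR0 p.2
        have hnn : ∀ n : ℕ, 0 ≤ ksdK n (R p.1 * R p.2) (R p.1 * b) (R p.2 * b) (b * b)
          |f p.1 * w p.1| |g p.1 * w p.1| |f p.2 * w p.2| |g p.2 * w p.2| / n.factorial := by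
          intro n; unfold ksdK; positivity
        have h1 : ‖∑ n ∈ Finset.range M, KN n p‖ ≤ ∑ n ∈ Finset.range M,
          ksdK n (R p.1 * R p.2) (R p.1 * b) (R p.2 * b) (b * b)
          |f p.1 * w p.1| |g p.1 * w p.1| |f p.2 * w p.2| |g p.2 * w p.2| / n.factorial := by
          refine (norm_sum_le _ _).trans (Finset.sum_le_sum fun n _ => ?_)
          simp only [hKN]
          rw [Real.norm_eq_abs, abs_div, Nat.abs_cast]
          gcongr
          exact ksdK_abs_le n _ _ _ _ _ _ _ _ _ _ _ hr1 hr2 hb (hSN N p) (hAN N _) (hAN N _)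
            (hBN N)
        refine h1.trans ((sum_le_hasSum _ (fun n _ => hnn n) hs).trans ?_)
        have h2 := ksd_psd_trunc_bound (R p.1 * R p.2) (R p.1 * b) (R p.2 * b) (b * b)
          |f p.1| |g p.1| |f p.2| |g p.2| (R p.1) (R p.2) b hr1 hr2 hb le_rfl
          (abs_of_nonneg (by positivity)).le (abs_of_nonneg (by positivity)).le
          (abs_of_nonneg (by positivity)).le
        simp only [abs_abs] at h2
        refine le_trans (le_trans (le_of_eq ?_) (mul_le_mul_of_nonneg_left (le_abs_self _)
          (Real.exp_pos _).le)) h2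
        have hw1 : 0 < w p.1 := Real.exp_pos _
        have hw2 : 0 < w p.2 := Real.exp_pos _
        rw [hww]
        simp only [abs_mul, abs_of_pos hw1, abs_of_pos hw2]
        ring)
      (Eventually.of_forall fun p => (ksdK_hasSum _ _ _ _ _ _ _ _).tendsto_sum_nat)
    have hge := ge_of_tendsto' hlim (b := 0) (fun M => by
      rw [integral_finsetSum _ fun n _ => hKint n]
      refine Finset.sum_nonneg fun n _ => ?_
      simp only [hKN]
      rw [integral_div]
      exact div_nonneg (hK n).2 (by positivity))
    refine hge.trans (le_of_eq (integral_congr_ae (Eventually.of_forall fun p => ?_)))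
    simp only [hww]; ring
  have hlim := tendsto_integral_of_dominated_convergence (μ := ν.prod ν)
    (F := fun N p => Real.exp (-(R p.1 ^ 2 + R p.2 ^ 2) / 2) *
      (Real.exp (∑ j ∈ Finset.range N, u j p.1 * u j p.2) *
      (f p.1 * f p.2 + (g p.1 * f p.2 * (∑ j ∈ Finset.range N, u j p.2 * q j)
        + f p.1 * g p.2 * (∑ j ∈ Finset.range N, u j p.1 * q j)
        + g p.1 * g p.2 * (∑ j ∈ Finset.range N, q j * q j))
        + g p.1 * g p.2 * (∑ j ∈ Finset.range N, u j p.1 * q j)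
          * (∑ j ∈ Finset.range N, u j p.2 * q j))))
    (f := fun p => Real.exp (-(R p.1 ^ 2 + R p.2 ^ 2) / 2 + S p.1 p.2) *
      (f p.1 * f p.2 + (g p.1 * f p.2 * A p.2 + f p.1 * g p.2 * A p.1 + g p.1 * g p.2 * B)
        + g p.1 * g p.2 * A p.1 * A p.2)) bd
    (fun N => Measurable.aestronglyMeasurable (by fun_prop)) hbdi
    (fun N => Eventually.of_forall fun p => by
      rw [norm_mul, Real.norm_of_nonneg (Real.exp_pos _).le, Real.norm_eq_abs]
      exact ksd_psd_trunc_bound _ _ _ _ _ _ _ _ _ _ b (hR0 _) (hR0 _) hb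
        ((le_abs_self _).trans (hSN N p)) (hAN N _) (hAN N _) (hBN N))
    (Eventually.of_forall fun p => by
      have h1 := hA p.1
      have h2 := hA p.2
      have h3 := (Real.continuous_exp.tendsto _).comp (hS p.1 p.2)
      simp only [Function.comp_def] at h3
      rw [Real.exp_add, mul_assoc]
      exact (h3.mul (((tendsto_const_nhds).add (((h2.const_mul _).add (h1.const_mul _)).add
        (hB.const_mul _))).add ((h1.const_mul _).mul h2))).const_mul _)
  exact ge_of_tendsto' hlim hN

section
variable {X : Type*} [NormedAddCommGroup X] [InnerProductSpace ℝ X] [CompleteSpace X]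
    [MeasurableSpace X] [BorelSpace X] [SecondCountableTopology X]

/-- One-coordinate Stein kernel of the SE kernel. -/
noncomputable def ksdH (T : X →L[ℝ] X) (v : X) (c : ℝ) (m : X → ℝ) (x x' : X) : ℝ :=
  Real.exp (-(1 / 2) * ‖T x - T x'‖ ^ 2) * (c ^ 2 * ⟪T v, T v⟫ +
    (m x + c * ⟪T x - T x', T v⟫) * (m x' - c * ⟪T x - T x', T v⟫))

lemma ksd_sum_sq_le (e : HilbertBasis ℕ ℝ X) (N : ℕ) (y : X) :
    ∑ j ∈ Finset.range N, ⟪y, e j⟫ ^ 2 ≤ ‖y‖ ^ 2 := by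
  have h := e.orthonormal.sum_inner_products_le (x := y) (s := Finset.range N)
  refine le_trans (le_of_eq (Finset.sum_congr rfl fun j _ => ?_)) h
  rw [Real.norm_eq_abs, sq_abs, real_inner_comm]

lemma ksd_sum_inner (e : HilbertBasis ℕ ℝ X) (y z : X) :
    Tendsto (fun N => ∑ j ∈ Finset.range N, ⟪y, e j⟫ * ⟪z, e j⟫) atTop (nhds ⟪y, z⟫) := by
  have h := (e.hasSum_inner_mul_inner y z).tendsto_sum_nat
  refine h.congr fun N => Finset.sum_congr rfl fun j _ => ?_
  rw [real_inner_comm (e j) z]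

lemma ksd_int_mul {Q : Measure X} (f g : X → ℝ) (hf : Measurable f) (hg : Measurable g)
    (hf2 : Integrable (fun x => f x ^ 2) Q) (hg2 : Integrable (fun x => g x ^ 2) Q) :
    Integrable (fun x => f x * g x) Q := by
  refine (hf2.add hg2).mono (by fun_prop) (Eventually.of_forall fun x => ?_)
  simp only [Pi.add_apply]
  rw [Real.norm_eq_abs, Real.norm_of_nonneg (by positivity), abs_le]
  constructor <;> nlinarith [sq_nonneg (f x - g x), sq_nonneg (f x + g x)]

lemma ksd_int_of_sq {Q : Measure X} [IsFiniteMeasure Q] (f : X → ℝ) (hf : Measurable f)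
    (hf2 : Integrable (fun x => f x ^ 2) Q) : Integrable f Q := by
  have := ksd_int_mul f (fun _ => 1) hf (by fun_prop) hf2 (by fun_prop)
  simpa using this

lemma ksd_se_quad (e : HilbertBasis ℕ ℝ X) (Q : Measure X) [IsProbabilityMeasure Q]
    (hQ2 : Integrable (fun x => ‖x‖ ^ 2) Q) (T : X →L[ℝ] X) (v : X) (c : ℝ)
    (m : X → ℝ) (hm : Measurable m) (hm2 : Integrable (fun x => m x ^ 2) Q) (y : X) (t : ℝ) :
    Integrable (fun p : X × X => ksdH T v c m p.1 p.2) (Q.prod Q) ∧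
    0 ≤ (∫ p : X × X, ksdH T v c m p.1 p.2 ∂(Q.prod Q))
      + 2 * t * (∫ x, Real.exp (-(1 / 2) * ‖T x - T y‖ ^ 2)
          * (c * ⟪T y - T x, T v⟫ - m x) ∂Q) + t ^ 2 := by
  set ν : Measure (X ⊕ Unit) := Q.map Sum.inl + Measure.dirac (Sum.inr ()) with hν
  have hfin1 : IsFiniteMeasure (Q.map (Sum.inl : X → X ⊕ Unit)) := by infer_instance
  have hinl : Measurable (Sum.inl : X → X ⊕ Unit) := measurable_inl
  have : IsFiniteMeasure ν := by rw [hν]; infer_instance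
  set w : X ⊕ Unit → X := Sum.elim (fun x => T x) (fun _ => T y) with hw
  have hwm : Measurable w := Measurable.sumElim (by fun_prop) (by fun_prop)
  set f : X ⊕ Unit → ℝ := Sum.elim (fun x => -(m x + c * ⟪T x, T v⟫)) (fun _ => t) with hf
  have hfm : Measurable f := Measurable.sumElim (by fun_prop) (by fun_prop)
  set g : X ⊕ Unit → ℝ := Sum.elim (fun x => 1) (fun _ => 0) with hg
  have hgm : Measurable g := Measurable.sumElim (by fun_prop) (by fun_prop)
  set q : X := c • T v with hq
  have hTx2 : Integrable (fun x => ‖T x‖ ^ 2) Q := by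
    refine (hQ2.mul_const (‖T‖ ^ 2)).mono (by fun_prop) (Eventually.of_forall fun x => ?_)
    rw [Real.norm_of_nonneg (by positivity), Real.norm_of_nonneg (by positivity), ← mul_pow,
      mul_comm]
    exact pow_le_pow_left₀ (norm_nonneg _) (T.le_opNorm x) 2
  have hcx2 : Integrable (fun x => (c * ⟪T x, T v⟫) ^ 2) Q := by
    refine (hTx2.mul_const ((c * ‖T v‖) ^ 2)).mono (by fun_prop) (Eventually.of_forall fun x => ?_)
    rw [Real.norm_of_nonneg (by positivity), Real.norm_of_nonneg (by positivity), mul_pow, mul_pow]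
    have h1 := abs_real_inner_le_norm (T x) (T v)
    have h2 : ⟪T x, T v⟫ ^ 2 ≤ ‖T x‖ ^ 2 * ‖T v‖ ^ 2 := by
      rw [← mul_pow, ← sq_abs ⟪T x, T v⟫]
      exact pow_le_pow_left₀ (abs_nonneg _) h1 2
    nlinarith [sq_nonneg c]
  have hIntg : ∀ φ : X ⊕ Unit → ℝ, Measurable φ → Integrable (fun x => φ (Sum.inl x)) Q →
      Integrable φ ν := by
    intro φ hφ h
    rw [hν]
    refine Integrable.add_measure ?_ (integrable_dirac' hφ.stronglyMeasurable (by simp [enorm_lt_top]))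
    rw [integrable_map_measure hφ.aestronglyMeasurable hinl.aemeasurable]
    exact h
  have hR1 : Integrable (fun x => ‖T x‖) Q :=
    ksd_int_of_sq (fun x => ‖T x‖) (by fun_prop) hTx2
  have hfi : Integrable (fun ω => f ω * (1 + ‖w ω‖)) ν := by
    refine hIntg _ (by fun_prop) ?_
    simp only [hf, hw, Sum.elim_inl]
    have h1 := ksd_int_of_sq m hm hm2
    have h2 := ksd_int_of_sq (fun x => c * ⟪T x, T v⟫) (by fun_prop) hcx2
    have h3 := ksd_int_mul m (fun x => ‖T x‖) hm (by fun_prop) hm2 hTx2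
    have h4 := ksd_int_mul (fun x => c * ⟪T x, T v⟫) (fun x => ‖T x‖) (by fun_prop)
      (by fun_prop) hcx2 hTx2
    refine (((h1.add h2).add h3).add h4).neg.congr (Eventually.of_forall fun x => ?_)
    simp only [Pi.neg_apply, Pi.add_apply]; ring
  have hgi : Integrable (fun ω => g ω * (1 + ‖w ω‖)) ν := by
    refine hIntg _ (by fun_prop) ?_
    simp only [hg, hw, Sum.elim_inl, one_mul]
    exact (integrable_const 1).add hR1
  set Φ : (X ⊕ Unit) × (X ⊕ Unit) → ℝ := fun p =>
    Real.exp (-(‖w p.1‖ ^ 2 + ‖w p.2‖ ^ 2) / 2 + ⟪w p.1, w p.2⟫) *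
      (f p.1 * f p.2 + (g p.1 * f p.2 * ⟪w p.2, q⟫ + f p.1 * g p.2 * ⟪w p.1, q⟫
        + g p.1 * g p.2 * ⟪q, q⟫)
        + g p.1 * g p.2 * ⟪w p.1, q⟫ * ⟪w p.2, q⟫) with hΦ
  have hpsd : 0 ≤ ∫ p, Φ p ∂(ν.prod ν) :=
    ksd_psd ν (fun j ω => ⟪w ω, e j⟫) (fun j => by fun_prop) (fun j => ⟪q, e j⟫)
    (fun ω => ‖w ω‖) (by fun_prop) (fun _ => norm_nonneg _) (fun N ω => ksd_sum_sq_le e N _)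
    ‖q‖ (norm_nonneg _) (fun N => ksd_sum_sq_le e N q)
    (fun ω ω' => ⟪w ω, w ω'⟫) (fun ω => ⟪w ω, q⟫) ⟪q, q⟫ (fun ω ω' => ksd_sum_inner e _ _)
    (fun ω => ksd_sum_inner e _ _) (ksd_sum_inner e _ _) f g hfm hgm hfi hgi
  have hΦm : Measurable Φ := by fun_prop
  have hΦi : Integrable Φ (ν.prod ν) := by
    have h1 : Integrable (fun ω => (|f ω| + |g ω| * ‖q‖) * (1 + ‖w ω‖)) ν := by
      have h2 := hfi.abs.add (hgi.abs.mul_const ‖q‖)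
      refine h2.congr (Eventually.of_forall fun ω => ?_)
      have h3 : 0 ≤ 1 + ‖w ω‖ := by positivity
      simp only [Pi.add_apply, abs_mul, abs_of_nonneg h3]; ring
    refine (h1.mul_prod h1).mono hΦm.aestronglyMeasurable (Eventually.of_forall fun p => ?_)
    refine le_trans ?_ (le_abs_self _)
    simp only [hΦ]
    rw [Real.exp_add, mul_assoc, norm_mul, Real.norm_of_nonneg (Real.exp_pos _).le,
      Real.norm_eq_abs]
    exact ksd_psd_trunc_bound _ _ _ _ _ _ _ _ _ _ ‖q‖ (norm_nonneg _) (norm_nonneg _)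
      (norm_nonneg _) (real_inner_le_norm _ _) (abs_real_inner_le_norm _ _)
      (abs_real_inner_le_norm _ _) (abs_real_inner_le_norm _ _)
  have hk : ∀ a b : X, Real.exp (-(‖a‖ ^ 2 + ‖b‖ ^ 2) / 2 + ⟪a, b⟫)
      = Real.exp (-(1 / 2) * ‖a - b‖ ^ 2) := by
    intro a b; congr 1; rw [norm_sub_sq_real]; ring
  have hΦ11 : ∀ x x', Φ (Sum.inl x, Sum.inl x') = ksdH T v c m x x' := by
    intro x x'
    simp only [hΦ, hw, hf, hg, Sum.elim_inl, hk, ksdH, hq, real_inner_smul_left,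
      real_inner_smul_right, inner_sub_left]
    ring
  have hΦ12 : ∀ x, Φ (Sum.inl x, Sum.inr ()) = t * (Real.exp (-(1 / 2) * ‖T x - T y‖ ^ 2)
          * (c * ⟪T y - T x, T v⟫ - m x)) := by
    intro x
    simp only [hΦ, hw, hf, hg, Sum.elim_inl, Sum.elim_inr, hk, hq,
      real_inner_smul_right, inner_sub_left]
    ring
  have hΦ21 : ∀ x, Φ (Sum.inr (), Sum.inl x) = t * (Real.exp (-(1 / 2) * ‖T x - T y‖ ^ 2)
          * (c * ⟪T y - T x, T v⟫ - m x)) := by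
    intro x
    simp only [hΦ, hw, hf, hg, Sum.elim_inl, Sum.elim_inr, hk, hq,
      real_inner_smul_right, inner_sub_left]
    rw [norm_sub_rev]
    ring
  have hΦ22 : Φ (Sum.inr (), Sum.inr ()) = t ^ 2 := by
    simp only [hΦ, hw, hf, hg, Sum.elim_inr, hk, sub_self, norm_zero]
    simp; ring
  have hprod : ν.prod ν = ((Q.prod Q).map (Prod.map Sum.inl Sum.inl)
      + Q.map (fun x => (Sum.inl x, Sum.inr ())))
      + (Q.map (fun x => (Sum.inr (), Sum.inl x)) + Measure.dirac (Sum.inr (), Sum.inr ())) := by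
    rw [hν, Measure.add_prod, Measure.prod_add, Measure.prod_add, Measure.map_prod_map _ _ hinl hinl,
      Measure.prod_dirac, Measure.dirac_prod, Measure.map_map (by fun_prop) hinl,
      Measure.map_map (by fun_prop) hinl, Measure.dirac_prod_dirac]
    rfl
  rw [hprod] at hpsd hΦi
  rw [integrable_add_measure, integrable_add_measure, integrable_add_measure] at hΦi
  obtain ⟨⟨i1, i2⟩, i3, i4⟩ := hΦi
  rw [integral_add_measure (i1.add_measure i2) (i3.add_measure i4), integral_add_measure i1 i2,
    integral_add_measure i3 i4, integral_dirac' _ _ hΦm.stronglyMeasurable,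
    integral_map (by fun_prop) hΦm.aestronglyMeasurable,
    integral_map (by fun_prop) hΦm.aestronglyMeasurable,
    integral_map (by fun_prop) hΦm.aestronglyMeasurable] at hpsd
  simp only [Prod.map, hΦ11, hΦ12, hΦ21, hΦ22, integral_const_mul] at hpsd
  rw [integrable_map_measure hΦm.aestronglyMeasurable (by fun_prop)] at i1
  refine ⟨i1.congr (Eventually.of_forall fun p => hΦ11 _ _), ?_⟩
  linarith
end

section
variable {X : Type*} [NormedAddCommGroup X] [InnerProductSpace ℝ X] [CompleteSpace X]
    [MeasurableSpace X] [BorelSpace X] [SecondCountableTopology X]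

lemma ksd_TT_surj (T : X →L[ℝ] X) (hT : Function.Surjective (ContinuousLinearMap.adjoint T))
    (z : X) : ∃ y, ContinuousLinearMap.adjoint T (T y) = z := by
  obtain ⟨c, hc0, hc⟩ := (ContinuousLinearMap.adjoint T).exists_preimage_norm_le hT
  have hbd : ∀ x, ‖x‖ ≤ c * ‖T x‖ := by
    intro x
    obtain ⟨w, hw, hwn⟩ := hc x
    have h1 : ‖x‖ * ‖x‖ ≤ ‖x‖ * (c * ‖T x‖) := by
      calc ‖x‖ * ‖x‖ = ⟪ContinuousLinearMap.adjoint T w, x⟫ := by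
            rw [hw, real_inner_self_eq_norm_mul_norm]
        _ = ⟪w, T x⟫ := ContinuousLinearMap.adjoint_inner_left T x w
        _ ≤ ‖w‖ * ‖T x‖ := real_inner_le_norm _ _
        _ ≤ c * ‖x‖ * ‖T x‖ := by gcongr
        _ = _ := by ring
    by_cases h : ‖x‖ = 0
    · rw [h]; positivity
    · exact le_of_mul_le_mul_left h1 (lt_of_le_of_ne (norm_nonneg _) (Ne.symm h))
  have hal : AntilipschitzWith ⟨c, hc0.le⟩ T :=
    AddMonoidHomClass.antilipschitz_of_bound T hbd
  have hcl : IsClosed (Set.range T) := hal.isClosed_range T.uniformContinuous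
  obtain ⟨w, hw⟩ := hT z
  have hcomp : CompleteSpace (LinearMap.range (T : X →ₗ[ℝ] X)) := by
    have : IsClosed ((LinearMap.range (T : X →ₗ[ℝ] X)) : Set X) := by
      rw [LinearMap.coe_range]; exact hcl
    exact this.completeSpace_coe
  obtain ⟨a, ha, b, hb, hab⟩ :=
    (LinearMap.range (T : X →ₗ[ℝ] X)).exists_add_mem_mem_orthogonal w
  obtain ⟨y, hy⟩ := ha
  refine ⟨y, ?_⟩
  have hb0 : ContinuousLinearMap.adjoint T b = 0 := by
    refine ext_inner_right ℝ fun x => ?_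
    rw [ContinuousLinearMap.adjoint_inner_left, inner_zero_left, real_inner_comm]
    exact hb (T x) ⟨x, rfl⟩
  rw [← hw, hab, map_add, hb0, add_zero]
  congr 1

lemma ksd_zero_resample (e : HilbertBasis ℕ ℝ X) (Q : Measure X) [IsProbabilityMeasure Q]
    (hQ2 : Integrable (fun x => ‖x‖ ^ 2) Q)
    (U : X → ℝ) (DU : X → X)
    (hU : ∀ x, HasFDerivAt U ((InnerProductSpace.toDual ℝ X) (DU x) : X →L[ℝ] ℝ) x)
    (T : X →L[ℝ] X) (hT : Function.Surjective (ContinuousLinearMap.adjoint T)) (i : ℕ)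
    (c : ℝ) (hc : 0 < c)
    (hm : Measurable fun x => ⟪x, e i⟫ + c * ⟪DU x, e i⟫)
    (hm2 : Integrable (fun x => (⟪x, e i⟫ + c * ⟪DU x, e i⟫) ^ 2) Q)
    (h0 : ∫ p : X × X, ksdH T (e i) c (fun x => ⟪x, e i⟫ + c * ⟪DU x, e i⟫) p.1 p.2
      ∂(Q.prod Q) = 0)
    (f : X → ENNReal) (hf : Measurable f) :
    ∫⁻ x, f x ∂(Q.withDensity fun x => ENNReal.ofReal (Real.exp (U x))) =
      ∫⁻ x, ∫⁻ s, f (x + (s - ⟪x, e i⟫) • e i) ∂(gaussianReal 0 (Real.toNNReal c))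
        ∂(Q.withDensity fun x => ENNReal.ofReal (Real.exp (U x))) := by
  set m : X → ℝ := fun x => ⟪x, e i⟫ + c * ⟪DU x, e i⟫ with hmdef
  have hUm : Measurable U :=
    (continuous_iff_continuousAt.2 fun x => (hU x).continuousAt).measurable
  have hG : ∀ y, ∫ x, Real.exp (-(1 / 2) * ‖T x - T y‖ ^ 2)
          * (c * ⟪T y - T x, T (e i)⟫ - m x) ∂Q = 0 := by
    intro y
    set G := ∫ x, Real.exp (-(1 / 2) * ‖T x - T y‖ ^ 2) * (c * ⟪T y - T x, T (e i)⟫ - m x) ∂Q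
    have h := (ksd_se_quad e Q hQ2 T (e i) c m hm hm2 y (-G)).2
    rw [h0] at h
    nlinarith [sq_nonneg G]
  set F : X → ℝ := fun x => Real.exp (-(1 / 2) * ‖T x‖ ^ 2) with hF
  have hFm : Measurable F := by fun_prop
  have hFi : Integrable F Q := by
    refine (integrable_const (1 : ℝ)).mono hFm.aestronglyMeasurable
      (Eventually.of_forall fun x => ?_)
    rw [Real.norm_of_nonneg (Real.exp_pos _).le, norm_one, Real.exp_le_one_iff]
    nlinarith [sq_nonneg ‖T x‖]
  set ρ := Q.withDensity (fun x => ENNReal.ofReal (F x)) with hρ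
  have : IsFiniteMeasure ρ := isFiniteMeasure_withDensity_ofReal hFi.2
  have hρint : ∀ φ : X → ℝ, ∫ x, φ x ∂ρ = ∫ x, F x * φ x ∂Q := by
    intro φ
    rw [hρ, integral_withDensity_eq_integral_toReal_smul (by fun_prop) (by simp)]
    refine integral_congr_ae (Eventually.of_forall fun x => ?_)
    simp only [smul_eq_mul]
    rw [ENNReal.toReal_ofReal (Real.exp_pos _).le]
  have hρi : ∀ φ : X → ℝ, Integrable (fun x => F x * φ x) Q → Integrable φ ρ := by
    intro φ h
    rw [hρ, integrable_withDensity_iff_integrable_smul' (by fun_prop) (by simp)]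
    refine h.congr (Eventually.of_forall fun x => ?_)
    simp only [smul_eq_mul]
    rw [ENNReal.toReal_ofReal (Real.exp_pos _).le]
  have hk : ∀ x y : X, F x * Real.exp ⟪x, ContinuousLinearMap.adjoint T (T y)⟫
      = Real.exp (1 / 2 * ‖T y‖ ^ 2) * Real.exp (-(1 / 2) * ‖T x - T y‖ ^ 2) := by
    intro x y
    rw [ContinuousLinearMap.adjoint_inner_right]
    simp only [hF]
    rw [← Real.exp_add, ← Real.exp_add, norm_sub_sq_real]
    congr 1; ring
  set b : X → ℝ := fun x => (m x + c * ⟪T x, T (e i)⟫) / c with hb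
  have hbm : Measurable b := by fun_prop
  have hTx1 : Integrable (fun x => ‖T x‖) Q := by
    have h1 : Integrable (fun x : X => ‖x‖) Q := ksd_int_of_sq _ (by fun_prop) hQ2
    refine (h1.const_mul ‖T‖).mono (by fun_prop) (Eventually.of_forall fun x => ?_)
    rw [norm_norm, Real.norm_of_nonneg (by positivity)]
    exact T.le_opNorm x
  have hbi : Integrable b Q := by
    refine ((ksd_int_of_sq m hm hm2).add ?_).div_const c
    refine (hTx1.mul_const (c * ‖T (e i)‖)).mono (by fun_prop) (Eventually.of_forall fun x => ?_)
    have h2 : 0 ≤ ‖T x‖ * (c * ‖T (e i)‖) := by positivity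
    rw [norm_mul, Real.norm_of_nonneg hc.le, Real.norm_of_nonneg h2, Real.norm_eq_abs]
    calc c * |⟪T x, T (e i)⟫| ≤ c * (‖T x‖ * ‖T (e i)‖) := by
          gcongr; exact abs_real_inner_le_norm (T x) (T (e i))
      _ = _ := by ring
  have hexp1 : ∀ x y : X, Real.exp (-(1 / 2) * ‖T x - T y‖ ^ 2) ≤ 1 := by
    intro x y; rw [Real.exp_le_one_iff]; nlinarith [sq_nonneg ‖T x - T y‖]
  have hker : ∀ (φ : X → ℝ) (y : X), Integrable φ Q →
      Integrable (fun x => Real.exp (-(1 / 2) * ‖T x - T y‖ ^ 2) * φ x) Q := by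
    intro φ y hφ
    refine hφ.bdd_mul (c := 1) (by fun_prop) (Eventually.of_forall fun x => ?_)
    rw [Real.norm_of_nonneg (Real.exp_pos _).le]
    exact hexp1 x y
  have hW : ∀ (z : X) (s : ℝ), HasDerivAt (fun s : ℝ => U (z + s • e i)
      + 1 / 2 * ‖T (z + s • e i)‖ ^ 2)
      (b (z + s • e i) - ⟪z + s • e i, e i⟫ / (Real.toNNReal c : NNReal)) s := by
    intro z s
    rw [Real.coe_toNNReal _ hc.le]
    have hl : HasDerivAt (fun s : ℝ => z + s • e i) (e i) s := by
      have := ((hasDerivAt_id s).smul_const (e i)).const_add z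
      simpa using this
    have h1 := (hU (z + s • e i)).comp_hasDerivAt s hl
    have h2 : HasDerivAt (fun s : ℝ => T (z + s • e i)) (T (e i)) s :=
      T.hasFDerivAt.comp_hasDerivAt s hl
    have h3 := (h2.norm_sq).const_mul (1 / 2 : ℝ)
    refine (h1.add h3).congr_deriv ?_
    rw [InnerProductSpace.toDual_apply_apply]
    simp only [hb, hmdef]
    field_simp
    ring
  have hres := ksd_resample ρ (e i) (ksd_e_self e i) (Real.toNNReal c)
    (by simpa using hc) b hbm
    (fun z => by
      obtain ⟨y, rfl⟩ := ksd_TT_surj T hT z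
      refine hρi _ ?_
      simp_rw [hk]
      have := hker (fun _ => 1) y (integrable_const _)
      simp only [mul_one] at this
      exact this.const_mul _)
    (fun z => by
      obtain ⟨y, rfl⟩ := ksd_TT_surj T hT z
      refine hρi _ ?_
      have := (hker b y hbi).const_mul (Real.exp (1 / 2 * ‖T y‖ ^ 2))
      refine this.congr (Eventually.of_forall fun x => ?_)
      simp only []
      rw [← mul_assoc, ← hk]; ring)
    (fun z => by
      obtain ⟨y, rfl⟩ := ksd_TT_surj T hT z
      rw [hρint, hρint, ← sub_eq_zero, ← integral_const_mul]
      have e1 : ∀ x, F x * (b x * Real.exp ⟪x, ContinuousLinearMap.adjoint T (T y)⟫)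
          = Real.exp (1 / 2 * ‖T y‖ ^ 2) *
            (Real.exp (-(1 / 2) * ‖T x - T y‖ ^ 2) * b x) := by
        intro x
        rw [← mul_assoc (Real.exp (1 / 2 * ‖T y‖ ^ 2)), ← hk]; ring
      simp_rw [hk, e1]
      rw [← integral_sub]
      · rw [← mul_zero (Real.exp (1 / 2 * ‖T y‖ ^ 2) / c), ← hG y, ← integral_const_mul]
        refine integral_congr_ae (Eventually.of_forall fun x => ?_)
        simp only [hb]
        rw [ContinuousLinearMap.adjoint_inner_left, inner_sub_left]
        field_simp
        ring
      · have := hker (fun _ => 1) y (integrable_const _)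
        simp only [mul_one] at this
        exact (this.const_mul _).const_mul _
      · exact (hker b y hbi).const_mul _)
    (fun x => U x + 1 / 2 * ‖T x‖ ^ 2) (by fun_prop) hW f hf
  have hconv : ∀ φ : X → ENNReal, Measurable φ →
      ∫⁻ x, φ x * ENNReal.ofReal (Real.exp (U x + 1 / 2 * ‖T x‖ ^ 2)) ∂ρ
      = ∫⁻ x, φ x ∂(Q.withDensity fun x => ENNReal.ofReal (Real.exp (U x))) := by
    intro φ hφ
    rw [hρ, lintegral_withDensity_eq_lintegral_mul _ (by fun_prop) (by fun_prop),
      lintegral_withDensity_eq_lintegral_mul _ (by fun_prop) hφ]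
    refine lintegral_congr fun x => ?_
    simp only [Pi.mul_apply]
    rw [mul_comm (φ x), ← mul_assoc, ← ENNReal.ofReal_mul (Real.exp_pos _).le]
    congr 2
    rw [← Real.exp_add]; congr 1; ring
  have hgm : Measurable fun x : X => ∫⁻ s, f (x + (s - ⟪x, e i⟫) • e i)
      ∂(gaussianReal 0 (Real.toNNReal c)) :=
    Measurable.lintegral_prod_right' (f := fun q : X × ℝ => f (q.1 + (q.2 - ⟪q.1, e i⟫) • e i))
      (by fun_prop)
  rw [hconv f hf, hconv _ hgm] at hres
  exact hres

lemma ksd_identify (C : X →L[ℝ] X) (hCsa : IsSelfAdjoint C)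
    (e : HilbertBasis ℕ ℝ X) (l : ℕ → ℝ) (hl : ∀ i, 0 < l i)
    (hCe : ∀ i, C (e i) = l i • e i)
    (U : X → ℝ) (hUc : Continuous U)
    (NC : Measure X) [IsProbabilityMeasure NC]
    (hNC : ∀ y : X, Measure.map (fun x => ⟪y, x⟫) NC
      = gaussianReal 0 (Real.toNNReal ⟪C y, y⟫))
    (hexpU : Integrable (fun x => Real.exp (-U x)) NC)
    (P : Measure X)
    (hP : P = (ENNReal.ofReal (∫ x, Real.exp (-U x) ∂NC))⁻¹ •
        NC.withDensity (fun x => ENNReal.ofReal (Real.exp (-U x))))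
    (Q : Measure X) [IsProbabilityMeasure Q]
    (hM : ∀ i, ∀ f : X → ENNReal, Measurable f →
      ∫⁻ x, f x ∂(Q.withDensity fun x => ENNReal.ofReal (Real.exp (U x))) =
      ∫⁻ x, ∫⁻ s, f (x + (s - ⟪x, e i⟫) • e i) ∂(gaussianReal 0 (Real.toNNReal (l i)))
        ∂(Q.withDensity fun x => ENNReal.ofReal (Real.exp (U x)))) : Q = P := by
  have hUm : Measurable U := hUc.measurable
  set M := Q.withDensity fun x => ENNReal.ofReal (Real.exp (U x)) with hMdef
  have hMn := ksd_M_n C hCsa e l hl hCe NC hNC M hM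
  have hfin : IsFiniteMeasure M := by
    refine ksd_M_finite e NC M hMn fun x0 => ?_
    obtain ⟨r, hr, hr'⟩ := Metric.continuousAt_iff.1 (hUc.continuousAt (x := x0)) 1 one_pos
    refine ⟨r, hr, ?_⟩
    rw [hMdef, withDensity_apply _ measurableSet_ball]
    calc ∫⁻ x in Metric.ball x0 r, ENNReal.ofReal (Real.exp (U x)) ∂Q
        ≤ ∫⁻ x in Metric.ball x0 r, ENNReal.ofReal (Real.exp (U x0 + 1)) ∂Q := by
          refine setLIntegral_mono (by fun_prop) fun x hx => ?_
          refine ENNReal.ofReal_le_ofReal (Real.exp_le_exp.2 ?_)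
          have := hr' hx
          rw [Real.dist_eq, abs_lt] at this
          linarith [this.2]
      _ < ⊤ := by
          rw [setLIntegral_const]
          exact ENNReal.mul_lt_top ENNReal.ofReal_lt_top (measure_lt_top _ _)
  have hMeq := ksd_M_eq e NC M hMn
  have hQ : Q = M.withDensity fun x => ENNReal.ofReal (Real.exp (-U x)) := by
    rw [hMdef, ← withDensity_mul _ (by fun_prop) (by fun_prop)]
    have : (fun x => ENNReal.ofReal (Real.exp (U x))) * (fun x => ENNReal.ofReal (Real.exp (-U x)))
        = 1 := by
      ext x
      rw [Pi.mul_apply, ← ENNReal.ofReal_mul (Real.exp_pos _).le, ← Real.exp_add]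
      simp
    rw [this, withDensity_one]
  have hQ' : Q = M Set.univ • NC.withDensity (fun x => ENNReal.ofReal (Real.exp (-U x))) := by
    rw [hMeq, withDensity_smul_measure] at hQ
    exact hQ
  have h1 := congrArg (fun μ : Measure X => μ Set.univ) hQ'
  simp only [measure_univ, Measure.smul_apply, withDensity_apply _ MeasurableSet.univ,
    Measure.restrict_univ, smul_eq_mul] at h1
  rw [← ofReal_integral_eq_lintegral_ofReal hexpU
    (Eventually.of_forall fun x => (Real.exp_pos _).le)] at h1
  rw [hQ', hP, ENNReal.eq_inv_of_mul_eq_one_left h1.symm]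
end

section
variable {X : Type*} [NormedAddCommGroup X] [InnerProductSpace ℝ X] [CompleteSpace X]
    [MeasurableSpace X] [BorelSpace X] [SecondCountableTopology X]

lemma ksd_ibp (C : X →L[ℝ] X) (hCsa : IsSelfAdjoint C)
    (e : HilbertBasis ℕ ℝ X) (l : ℕ → ℝ) (hl : ∀ i, 0 < l i)
    (hCe : ∀ i, C (e i) = l i • e i)
    (U : X → ℝ) (DU : X → X)
    (hU : ∀ x, HasFDerivAt U ((InnerProductSpace.toDual ℝ X) (DU x) : X →L[ℝ] ℝ) x)
    (NC : Measure X) [IsProbabilityMeasure NC]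
    (hNC : ∀ y : X, Measure.map (fun x => ⟪y, x⟫) NC
      = gaussianReal 0 (Real.toNNReal ⟪C y, y⟫)) (i : ℕ)
    (f f' : X → ℝ)
    (hd : ∀ (z : X) (s : ℝ), HasDerivAt (fun s : ℝ => f (z + s • e i)) (f' (z + s • e i)) s)
    (hfi : Integrable (fun x => f x * Real.exp (-U x)) NC)
    (hgi : Integrable (fun x => (l i * f' x - f x * (⟪x, e i⟫ + l i * ⟪DU x, e i⟫))
      * Real.exp (-U x)) NC) :
    ∫ x, (l i * f' x - f x * (⟪x, e i⟫ + l i * ⟪DU x, e i⟫)) * Real.exp (-U x) ∂NC = 0 := by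
  set G : X → ℝ := fun x => (l i * f' x - f x * (⟪x, e i⟫ + l i * ⟪DU x, e i⟫))
      * Real.exp (-U x) with hG
  have hres := ksd_NC_resample C hCsa e l hl hCe NC hNC i
  set γ := gaussianReal 0 (Real.toNNReal (l i)) with hγ
  set τ : X × ℝ → X := fun q => q.1 + (q.2 - ⟪q.1, e i⟫) • e i with hτ
  have hτm : Measurable τ := by fun_prop
  have key : ∀ φ : X → ℝ, Integrable φ NC → Integrable (fun q => φ (τ q)) (NC.prod γ) ∧
      ∫ x, φ x ∂NC = ∫ x, ∫ s, φ (τ (x, s)) ∂γ ∂NC := by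
    intro φ hφ
    rw [← hres] at hφ
    have h1 : Integrable (fun q => φ (τ q)) (NC.prod γ) :=
      (integrable_map_measure hφ.1 hτm.aemeasurable).1 hφ
    refine ⟨h1, ?_⟩
    rw [← integral_prod _ h1, ← integral_map hτm.aemeasurable hφ.1, hres]
  obtain ⟨k1, k2⟩ := key G hgi
  obtain ⟨k3, -⟩ := key _ hfi
  rw [k2]
  refine integral_eq_zero_of_ae ?_
  filter_upwards [k1.prod_right_ae, k3.prod_right_ae] with x h1 h2
  have hc := hl i
  have hne : Real.toNNReal (l i) ≠ 0 := by simpa using hc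
  set z := x - ⟪x, e i⟫ • e i with hz
  have hτz : ∀ s : ℝ, τ (x, s) = z + s • e i := by
    intro s; simp only [hτ, hz, sub_smul]; abel
  have hin : ∀ s : ℝ, ⟪z + s • e i, e i⟫ = s := by
    intro s
    simp only [hz, inner_add_left, inner_sub_left, real_inner_smul_left, ksd_e_self]; ring
  simp only [hτz] at h1 h2 ⊢
  have hdens : ∀ φ : ℝ → ℝ, Integrable φ γ →
      Integrable (fun s => φ s * Real.exp (-(s ^ 2) / (2 * l i))) := by
    intro φ hφ
    rw [hγ, gaussianReal_of_var_ne_zero _ hne, integrable_withDensity_iff_integrable_smul'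
      (measurable_gaussianPDF _ _) (by simp [gaussianPDF_lt_top])] at hφ
    refine (hφ.const_mul (Real.sqrt (2 * Real.pi * l i))).congr (Eventually.of_forall fun s => ?_)
    simp only [smul_eq_mul, toReal_gaussianPDF, gaussianPDFReal, Real.coe_toNNReal _ hc.le]
    have : Real.sqrt (2 * Real.pi * l i) ≠ 0 := by positivity
    rw [sub_zero]
    field_simp
  have hline : ∀ s : ℝ, HasDerivAt (fun s : ℝ => z + s • e i) (e i) s := by
    intro s
    have := ((hasDerivAt_id s).smul_const (e i)).const_add z
    simpa using this
  have h3 := integral_eq_zero_of_hasDerivAt_of_integrable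
    (f := fun s => l i * (f (z + s • e i) * Real.exp (-U (z + s • e i))
      * Real.exp (-(s ^ 2) / (2 * l i))))
    (f' := fun s => G (z + s • e i) * Real.exp (-(s ^ 2) / (2 * l i)))
    (fun s => by
      have d1 := hd z s
      have d2 := ((hU (z + s • e i)).comp_hasDerivAt s (hline s)).neg.exp
      have d3 := (((hasDerivAt_id s).pow 2).neg.div_const (2 * l i)).exp
      refine (((d1.mul d2).mul d3).const_mul (l i)).congr_deriv ?_
      simp only [InnerProductSpace.toDual_apply_apply, hG, hin, Function.comp, Pi.neg_apply, Pi.mul_apply,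
        Pi.pow_apply, id]
      field_simp
      ring) (hdens _ h1) ((hdens _ h2).const_mul _)
  rw [hγ, integral_gaussianReal_eq_integral_smul hne]
  simp only [Pi.zero_apply]
  have h4 : (0:ℝ) = ∫ s, (Real.sqrt (2 * Real.pi * l i))⁻¹ *
      (G (z + s • e i) * Real.exp (-(s ^ 2) / (2 * l i))) := by
    rw [integral_const_mul, h3, mul_zero]
  refine Eq.trans ?_ h4.symm
  refine integral_congr_ae (Eventually.of_forall fun s => ?_)
  simp only [gaussianPDFReal, Real.coe_toNNReal _ hc.le, smul_eq_mul, sub_zero]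
  ring

lemma ksd_converse_se (C : X →L[ℝ] X) (hCsa : IsSelfAdjoint C)
    (e : HilbertBasis ℕ ℝ X) (l : ℕ → ℝ) (hl : ∀ i, 0 < l i)
    (hCe : ∀ i, C (e i) = l i • e i)
    (U : X → ℝ) (DU : X → X)
    (hU : ∀ x, HasFDerivAt U ((InnerProductSpace.toDual ℝ X) (DU x) : X →L[ℝ] ℝ) x)
    (NC : Measure X) [IsProbabilityMeasure NC]
    (hNC : ∀ y : X, Measure.map (fun x => ⟪y, x⟫) NC
      = gaussianReal 0 (Real.toNNReal ⟪C y, y⟫))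
    (hexpU : Integrable (fun x => Real.exp (-U x)) NC)
    (hZpos : 0 < ∫ x, Real.exp (-U x) ∂NC)
    (P : Measure X) [IsProbabilityMeasure P]
    (hP : P = (ENNReal.ofReal (∫ x, Real.exp (-U x) ∂NC))⁻¹ •
        NC.withDensity (fun x => ENNReal.ofReal (Real.exp (-U x))))
    (hQ2 : Integrable (fun x => ‖x‖ ^ 2) P)
    (T : X →L[ℝ] X) (i : ℕ)
    (hm : Measurable fun x => ⟪x, e i⟫ + l i * ⟪DU x, e i⟫)
    (hm2 : Integrable (fun x => (⟪x, e i⟫ + l i * ⟪DU x, e i⟫) ^ 2) P) :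
    ∫ p : X × X, ksdH T (e i) (l i) (fun x => ⟪x, e i⟫ + l i * ⟪DU x, e i⟫) p.1 p.2
      ∂(P.prod P) = 0 := by
  have hUm : Measurable U :=
    (continuous_iff_continuousAt.2 fun x => (hU x).continuousAt).measurable
  set m : X → ℝ := fun x => ⟪x, e i⟫ + l i * ⟪DU x, e i⟫ with hmdef
  have hIntg := (ksd_se_quad e P hQ2 T (e i) (l i) m hm hm2 0 0).1
  rw [integral_prod _ hIntg]
  refine integral_eq_zero_of_ae (Eventually.of_forall fun x => ?_)
  simp only [Pi.zero_apply]
  set Z := ∫ x, Real.exp (-U x) ∂NC with hZ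
  have hZ' : (ENNReal.ofReal Z)⁻¹ ≠ 0 := by simp
  have hZ'' : (ENNReal.ofReal Z)⁻¹ ≠ ⊤ := by simp [hZpos]
  have hPi : ∀ φ : X → ℝ, Integrable φ P ↔ Integrable (fun x => φ x * Real.exp (-U x)) NC := by
    intro φ
    rw [hP, integrable_smul_measure hZ' hZ'', integrable_withDensity_iff_integrable_smul'
      (by fun_prop) (by simp)]
    refine integrable_congr (Eventually.of_forall fun x => ?_)
    simp only [smul_eq_mul]
    rw [ENNReal.toReal_ofReal (Real.exp_pos _).le, mul_comm]
  have hPint : ∀ φ : X → ℝ, ∫ x, φ x * Real.exp (-U x) ∂NC = 0 → ∫ x, φ x ∂P = 0 := by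
    intro φ h
    rw [hP, integral_smul_measure, integral_withDensity_eq_integral_toReal_smul
      (by fun_prop) (by simp)]
    have : ∫ x, (ENNReal.ofReal (Real.exp (-U x))).toReal • φ x ∂NC
        = ∫ x, φ x * Real.exp (-U x) ∂NC := by
      refine integral_congr_ae (Eventually.of_forall fun x => ?_)
      simp only [smul_eq_mul]
      rw [ENNReal.toReal_ofReal (Real.exp_pos _).le, mul_comm]
    rw [this, h, smul_zero]
  set k : X → ℝ := fun y => Real.exp (-(1 / 2) * ‖T x - T y‖ ^ 2) with hk
  set d : X → ℝ := fun y => l i * ⟪T x - T y, T (e i)⟫ with hdd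
  have hk1 : ∀ y, |k y| ≤ 1 := by
    intro y
    rw [abs_of_pos (Real.exp_pos _), Real.exp_le_one_iff]
    nlinarith [sq_nonneg ‖T x - T y‖]
  have hTi : Integrable (fun y => ‖T x - T y‖ ^ 2) P := by
    refine ((integrable_const (2 * ‖T x‖ ^ 2)).add (hQ2.const_mul (2 * ‖T‖ ^ 2))).mono
      (by fun_prop) (Eventually.of_forall fun y => ?_)
    simp only [Pi.add_apply]
    rw [Real.norm_of_nonneg (by positivity), Real.norm_of_nonneg (by positivity)]
    have h1 := norm_sub_le (T x) (T y)
    have h2 := T.le_opNorm y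
    have h3 : ‖T x - T y‖ ^ 2 ≤ (‖T x‖ + ‖T‖ * ‖y‖) ^ 2 :=
      pow_le_pow_left₀ (norm_nonneg _) (by linarith) 2
    nlinarith [sq_nonneg (‖T x‖ - ‖T‖ * ‖y‖)]
  have hd2 : Integrable (fun y => d y ^ 2) P := by
    refine (hTi.mul_const ((l i * ‖T (e i)‖) ^ 2)).mono (by fun_prop)
      (Eventually.of_forall fun y => ?_)
    rw [Real.norm_of_nonneg (by positivity), Real.norm_of_nonneg (by positivity), ← mul_pow]
    refine sq_le_sq' ?_ ?_ <;>
    · have h1 := abs_le.1 (abs_real_inner_le_norm (T x - T y) (T (e i)))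
      have h2 := hl i
      simp only [hdd]
      nlinarith [h1.1, h1.2]
  have hkm : Measurable k := by fun_prop
  have hdm : Measurable d := by fun_prop
  have hd1 : Integrable d P := ksd_int_of_sq d hdm hd2
  have hkφ : ∀ φ : X → ℝ, Integrable φ P → Integrable (fun y => k y * φ y) P := by
    intro φ hφ
    exact hφ.bdd_mul (c := 1) hkm.aestronglyMeasurable (Eventually.of_forall hk1)
  have hfP : Integrable (fun y => -(k y * (m x + d y))) P :=
    (hkφ _ ((integrable_const (m x)).add hd1)).neg
  have hline : ∀ (z : X) (s : ℝ), HasDerivAt (fun s : ℝ => z + s • e i) (e i) s := by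
    intro z s
    have := ((hasDerivAt_id s).smul_const (e i)).const_add z
    simpa using this
  have hker : ∀ y, ksdH T (e i) (l i) m x y =
      l i * ((l i)⁻¹ * (k y * (l i ^ 2 * ⟪T (e i), T (e i)⟫ - d y * (m x + d y))))
        - (-(k y * (m x + d y))) * (⟪y, e i⟫ + l i * ⟪DU y, e i⟫) := by
    intro y
    have := (hl i).ne'
    rw [mul_inv_cancel_left₀ this]
    simp only [ksdH, hk, hdd, hmdef]
    ring
  have hGP : Integrable (fun y => ksdH T (e i) (l i) m x y) P := by
    have h1 : Integrable (fun y => l i ^ 2 * ⟪T (e i), T (e i)⟫ + (m x + d y) * (m y - d y)) P := by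
      have e1 := ksd_int_mul d m hdm hm hd2 hm2
      have e2 := ksd_int_of_sq m hm hm2
      refine ((integrable_const (l i ^ 2 * ⟪T (e i), T (e i)⟫)).add
        (((e2.sub hd1).const_mul (m x)).add (e1.sub hd2))).congr (Eventually.of_forall fun y => ?_)
      simp only [Pi.add_apply, Pi.sub_apply]; ring
    exact hkφ _ h1
  refine hPint _ ?_
  have hGN := (hPi _).1 hGP
  have hFN := (hPi _).1 hfP
  simp_rw [hker] at hGN ⊢
  refine ksd_ibp C hCsa e l hl hCe U DU hU NC hNC i (fun y => -(k y * (m x + d y)))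
    (fun y => (l i)⁻¹ * (k y * (l i ^ 2 * ⟪T (e i), T (e i)⟫ - d y * (m x + d y)))) ?_ hFN hGN
  intro z s
  have h1 : HasDerivAt (fun s : ℝ => T x - T (z + s • e i)) (-T (e i)) s := by
    have := (T.hasFDerivAt.comp_hasDerivAt s (hline z s)).const_sub (T x)
    exact this
  have h2 := ((h1.norm_sq).const_mul (-(1 / 2) : ℝ)).exp
  have h3 := ((h1.inner ℝ (hasDerivAt_const s (T (e i)))).const_mul (l i)).const_add (m x)
  refine (h2.mul h3).neg.congr_deriv ?_
  simp only [hk, hdd, inner_neg_right, inner_neg_left, inner_zero_right]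
  have := (hl i).ne'
  field_simp
  ring
end

section
variable {X : Type*} [NormedAddCommGroup X] [InnerProductSpace ℝ X] [CompleteSpace X]
    [MeasurableSpace X] [BorelSpace X] [SecondCountableTopology X]

/-- Coordinate Stein kernel for a radial kernel with profile `p0`, where
`p1 = -2 p0'` and `p2 = -2 p1'`. -/
noncomputable def ksdG (p0 p1 p2 : ℝ → ℝ) (T : X →L[ℝ] X) (v : X) (c : ℝ) (m : X → ℝ)
    (x x' : X) : ℝ :=
  p0 (‖T x - T x'‖ ^ 2) * (m x * m x')
  + p1 (‖T x - T x'‖ ^ 2) * (c ^ 2 * ⟪T v, T v⟫ + c * ⟪T x - T x', T v⟫ * (m x' - m x))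
  - p2 (‖T x - T x'‖ ^ 2) * (c * ⟪T x - T x', T v⟫) ^ 2

lemma ksd_fderiv1 (p0 p1 : ℝ → ℝ)
    (hp0 : ∀ r, 0 ≤ r → HasDerivAt p0 (-(1/2) * p1 r) r)
    (T : X →L[ℝ] X) (x y : X) :
    HasFDerivAt (fun x1 => p0 (‖T x1 - T y‖ ^ 2))
      ((-p1 (‖T x - T y‖ ^ 2)) • (innerSL ℝ (T x - T y)).comp T) x := by
  have h1 : HasFDerivAt (fun x1 => T x1 - T y) T x := T.hasFDerivAt.sub_const _
  have h2 := (hp0 (‖T x - T y‖ ^ 2) (by positivity)).comp_hasFDerivAt x h1.norm_sq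
  refine h2.congr_fderiv ?_
  ext h
  simp
  ring

lemma ksd_fderiv2 (p0 p1 : ℝ → ℝ)
    (hp0 : ∀ r, 0 ≤ r → HasDerivAt p0 (-(1/2) * p1 r) r)
    (T : X →L[ℝ] X) (x y : X) :
    HasFDerivAt (fun y1 => p0 (‖T x - T y1‖ ^ 2))
      ((p1 (‖T x - T y‖ ^ 2)) • (innerSL ℝ (T x - T y)).comp T) y := by
  have h1 : HasFDerivAt (fun y1 => T x - T y1) (-T) y := T.hasFDerivAt.const_sub _
  have h2 := (hp0 (‖T x - T y‖ ^ 2) (by positivity)).comp_hasFDerivAt y h1.norm_sq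
  refine h2.congr_fderiv ?_
  ext h
  simp
  ring

lemma ksd_L1 (C : X →L[ℝ] X) (hCsa : IsSelfAdjoint C)
    (e : HilbertBasis ℕ ℝ X) (l : ℕ → ℝ)
    (hCe : ∀ i, C (e i) = l i • e i) (hl2 : Summable fun i => l i ^ 2)
    (DU : X → X) (p0 p1 p2 : ℝ → ℝ)
    (hp0 : ∀ r, 0 ≤ r → HasDerivAt p0 (-(1/2) * p1 r) r)
    (hp1 : ∀ r, 0 ≤ r → HasDerivAt p1 (-(1/2) * p2 r) r)
    (T : X →L[ℝ] X) (k : X → X → ℝ) (hk : ∀ x y, k x y = p0 (‖T x - T y‖ ^ 2)) (x x' : X) :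
    HasSum (fun i => ksdG p0 p1 p2 T (e i) (l i) (fun x => ⟪x + C (DU x), e i⟫) x x')
      (steinKernelHv k C DU (fun i => e i) l x x') := by
  have hk' : k = fun x y => p0 (‖T x - T y‖ ^ 2) := by ext x y; exact hk x y
  subst hk'
  unfold steinKernelHv
  set r := ‖T x - T x'‖ ^ 2 with hr
  have hr0 : 0 ≤ r := by positivity
  have hmix : ∀ h : X, fderiv ℝ (fun y1 => fderiv ℝ (fun x1 => p0 (‖T x1 - T y1‖ ^ 2)) x h) x' h
      = p1 r * ⟪T h, T h⟫ - p2 r * ⟪T x - T x', T h⟫ ^ 2 := by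
    intro h
    have h0 : (fun y1 => fderiv ℝ (fun x1 => p0 (‖T x1 - T y1‖ ^ 2)) x h)
        = fun y1 => -(p1 (‖T x - T y1‖ ^ 2) * ⟪T x - T y1, T h⟫) := by
      ext y1
      rw [(ksd_fderiv1 p0 p1 hp0 T x y1).fderiv]
      simp [inner_sub_left]
    rw [h0]
    have h1 : HasFDerivAt (fun y1 => T x - T y1) (-T) x' := T.hasFDerivAt.const_sub _
    have h2 : HasFDerivAt (fun y1 => ⟪T x - T y1, T h⟫)
        ((innerSL ℝ (T h)).comp (-T)) x' := by
      have := (innerSL ℝ (T h)).hasFDerivAt.comp x' h1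
      refine this.congr_of_eventuallyEq (Eventually.of_forall fun y => ?_)
      simp only [Function.comp, innerSL_apply_apply]
      rw [real_inner_comm]
    have h3 := ((ksd_fderiv2 p1 p2 hp1 T x x').mul h2).neg
    have h4 : (fun y1 => -(p1 (‖T x - T y1‖ ^ 2) * ⟪T x - T y1, T h⟫)) =
      (-((fun y1 => p1 (‖T x - T y1‖ ^ 2)) * fun y1 => ⟪T x - T y1, T h⟫)) := rfl
    rw [h4, h3.fderiv]
    simp only [← hr, neg_apply, add_apply, smul_apply,
      ContinuousLinearMap.comp_apply, innerSL_apply_apply, smul_eq_mul, inner_neg_right]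
    ring
  have hCT : ∀ y : X, HasSum (fun i => l i * ⟪T x - T x', T (e i)⟫ * ⟪y, e i⟫)
      ⟪T x - T x', T (C y)⟫ := by
    intro y
    have := e.hasSum_inner_mul_inner ((ContinuousLinearMap.adjoint T) (T x - T x')) (C y)
    rw [ContinuousLinearMap.adjoint_inner_left] at this
    refine this.congr_fun ?_
    intro i
    rw [ContinuousLinearMap.adjoint_inner_left, real_inner_comm (C y) (e i), ksd_Ce_inner C hCsa e l hCe]
    ring
  have hTe : ∀ i, ‖T (e i)‖ ≤ ‖T‖ := fun i => by
    have := T.le_opNorm (e i)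
    rwa [e.orthonormal.1 i, mul_one] at this
  have s1 : Summable fun i => l i ^ 2 *
      fderiv ℝ (fun y1 => fderiv ℝ (fun x1 => p0 (‖T x1 - T y1‖ ^ 2)) x (e i)) x' (e i) := by
    simp only [hmix]
    refine Summable.of_norm_bounded
      (hl2.mul_right (|p1 r| * ‖T‖ ^ 2 + |p2 r| * (‖T x - T x'‖ * ‖T‖) ^ 2)) ?_
    intro i
    rw [norm_mul, Real.norm_eq_abs, Real.norm_eq_abs, abs_of_nonneg (sq_nonneg (l i))]
    refine mul_le_mul_of_nonneg_left ((abs_sub _ _).trans ?_) (sq_nonneg _)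
    rw [abs_mul, abs_mul, abs_of_nonneg (sq_nonneg (⟪T x - T x', T (e i)⟫)),
      real_inner_self_eq_norm_sq, abs_of_nonneg (sq_nonneg ‖T (e i)‖)]
    have hb : |⟪T x - T x', T (e i)⟫| ≤ ‖T x - T x'‖ * ‖T‖ :=
      (abs_real_inner_le_norm _ _).trans (mul_le_mul_of_nonneg_left (hTe i) (norm_nonneg _))
    have hb2 : ⟪T x - T x', T (e i)⟫ ^ 2 ≤ (‖T x - T x'‖ * ‖T‖) ^ 2 := by
      rw [← sq_abs]; exact pow_le_pow_left₀ (abs_nonneg _) hb 2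
    have := hTe i
    gcongr
  have a1 := s1.hasSum
  have hC1 : ∀ y, C y + C (C (DU y)) = C (y + C (DU y)) := fun y => by rw [map_add]
  rw [(ksd_fderiv1 p0 p1 hp0 T x x').fderiv, (ksd_fderiv2 p0 p1 hp0 T x x').fderiv, hC1, hC1]
  have a2 := (hCT (x' + C (DU x'))).mul_left (-p1 r)
  have a3 := (hCT (x + C (DU x))).mul_left (p1 r)
  have a4 := (e.hasSum_inner_mul_inner (x + C (DU x)) (x' + C (DU x'))).mul_left (p0 r)
  have := ((a1.sub a2).sub a3).add a4
  simp only [smul_apply, ContinuousLinearMap.comp_apply,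
    innerSL_apply_apply, smul_eq_mul, ← hr]
  refine this.congr_fun ?_
  intro i
  rw [hmix]
  simp only [ksdG, ← hr]
  rw [real_inner_comm (x' + C (DU x')) (e i)]
  ring

lemma ksd_G_bound (e : HilbertBasis ℕ ℝ X) (p0 p1 p2 : ℝ → ℝ) (K : ℝ)
    (b0 : ∀ r, 0 ≤ r → |p0 r| ≤ K) (b1 : ∀ r, 0 ≤ r → |p1 r| ≤ K)
    (b1' : ∀ r, 0 ≤ r → |p1 (r ^ 2)| * r ≤ K) (b2 : ∀ r, 0 ≤ r → |p2 r| * r ≤ K)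
    (T : X →L[ℝ] X) (i : ℕ) (c : ℝ) (m : X → ℝ) (x x' : X) :
    |ksdG p0 p1 p2 T (e i) c m x x'| ≤ K * (3 * ‖T‖ ^ 2 * c ^ 2 + m x ^ 2 + m x' ^ 2) := by
  have hK : 0 ≤ K := (abs_nonneg _).trans (b0 0 le_rfl)
  set ρ := ‖T x - T x'‖ with hρ
  have hρ0 : 0 ≤ ρ := norm_nonneg _
  have hTe : ‖T (e i)‖ ≤ ‖T‖ := by
    have := T.le_opNorm (e i)
    rwa [e.orthonormal.1 i, mul_one] at this
  set d := ⟪T x - T x', T (e i)⟫ with hd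
  have hb : |d| ≤ ρ * ‖T‖ :=
    (abs_real_inner_le_norm _ _).trans (mul_le_mul_of_nonneg_left hTe (norm_nonneg _))
  have hb2 : d ^ 2 ≤ (ρ * ‖T‖) ^ 2 := by
    rw [← sq_abs]; exact pow_le_pow_left₀ (abs_nonneg _) hb 2
  unfold ksdG
  rw [← hρ, ← hd, real_inner_self_eq_norm_sq]
  have hr := sq_nonneg ρ
  have t0 : |p0 (ρ ^ 2) * (m x * m x')| ≤ K * ((m x ^ 2 + m x' ^ 2) / 2) := by
    rw [abs_mul]
    refine mul_le_mul (b0 _ hr) ?_ (abs_nonneg _) hK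
    rw [abs_le]; constructor <;> nlinarith [sq_nonneg (m x + m x'), sq_nonneg (m x - m x')]
  have t1 : |p1 (ρ ^ 2) * (c ^ 2 * ‖T (e i)‖ ^ 2)| ≤ K * (c ^ 2 * ‖T‖ ^ 2) := by
    rw [abs_mul, abs_of_nonneg (by positivity : 0 ≤ c ^ 2 * ‖T (e i)‖ ^ 2)]
    refine mul_le_mul (b1 _ hr) ?_ (by positivity) hK
    gcongr
  have t2 : |p1 (ρ ^ 2) * (c * d * (m x' - m x))| ≤
      K * (c ^ 2 * ‖T‖ ^ 2 + (m x ^ 2 + m x' ^ 2) / 2) := by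
    calc |p1 (ρ ^ 2) * (c * d * (m x' - m x))|
        = |p1 (ρ ^ 2)| * |d| * |c * (m x' - m x)| := by
          rw [← abs_mul, ← abs_mul]; congr 1; ring
      _ ≤ |p1 (ρ ^ 2)| * (ρ * ‖T‖) * |c * (m x' - m x)| := by gcongr
      _ = (|p1 (ρ ^ 2)| * ρ) * (‖T‖ * |c * (m x' - m x)|) := by ring
      _ ≤ K * (‖T‖ * |c * (m x' - m x)|) := by
          exact mul_le_mul_of_nonneg_right (b1' _ hρ0) (by positivity)
      _ ≤ _ := by
          refine mul_le_mul_of_nonneg_left ?_ hK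
          rw [← abs_of_nonneg (norm_nonneg T), ← abs_mul, abs_of_nonneg (norm_nonneg T), abs_le]
          constructor <;> nlinarith [sq_nonneg (‖T‖ * c - m x), sq_nonneg (‖T‖ * c + m x),
            sq_nonneg (‖T‖ * c - m x'), sq_nonneg (‖T‖ * c + m x')]
  have t3 : |p2 (ρ ^ 2) * (c * d) ^ 2| ≤ K * (c ^ 2 * ‖T‖ ^ 2) := by
    rw [abs_mul, abs_of_nonneg (sq_nonneg (c * d))]
    calc |p2 (ρ ^ 2)| * (c * d) ^ 2 = |p2 (ρ ^ 2)| * c ^ 2 * d ^ 2 := by ring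
      _ ≤ |p2 (ρ ^ 2)| * c ^ 2 * (ρ * ‖T‖) ^ 2 := by gcongr
      _ = (|p2 (ρ ^ 2)| * ρ ^ 2) * (c ^ 2 * ‖T‖ ^ 2) := by ring
      _ ≤ _ := mul_le_mul_of_nonneg_right (b2 _ hr) (by positivity)
  rw [mul_add (p1 (ρ ^ 2))]
  rw [abs_le] at *
  constructor <;> nlinarith

lemma ksd_L2 (e : HilbertBasis ℕ ℝ X) (l : ℕ → ℝ) (hl2 : Summable fun i => l i ^ 2)
    (p0 p1 p2 : ℝ → ℝ) (K : ℝ)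
    (m0 : Measurable p0) (m1 : Measurable p1) (m2 : Measurable p2)
    (b0 : ∀ r, 0 ≤ r → |p0 r| ≤ K) (b1 : ∀ r, 0 ≤ r → |p1 r| ≤ K)
    (b1' : ∀ r, 0 ≤ r → |p1 (r ^ 2)| * r ≤ K) (b2 : ∀ r, 0 ≤ r → |p2 r| * r ≤ K)
    (T : X →L[ℝ] X) (μ : X → X) (hμ : Measurable μ)
    (Q : Measure X) [IsProbabilityMeasure Q] (hμ2 : Integrable (fun x => ‖μ x‖ ^ 2) Q)
    (hv : X → X → ℝ)
    (hs : ∀ x x', HasSum (fun i => ksdG p0 p1 p2 T (e i) (l i) (fun x => ⟪μ x, e i⟫) x x')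
      (hv x x')) :
    HasSum (fun i => ∫ p : X × X, ksdG p0 p1 p2 T (e i) (l i) (fun x => ⟪μ x, e i⟫) p.1 p.2
      ∂(Q.prod Q)) (∫ x, ∫ x', hv x x' ∂Q ∂Q) := by
  have hK : 0 ≤ K := (abs_nonneg _).trans (b0 0 le_rfl)
  have hmeas : ∀ i, Measurable fun p : X × X =>
      ksdG p0 p1 p2 T (e i) (l i) (fun x => ⟪μ x, e i⟫) p.1 p.2 := by
    intro i
    unfold ksdG
    have hr : Measurable fun p : X × X => ‖T p.1 - T p.2‖ ^ 2 := by fun_prop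
    have h0 := m0.comp hr
    have h1 := m1.comp hr
    have h2 := m2.comp hr
    simp only [Function.comp_def] at h0 h1 h2
    fun_prop
  have hpars : ∀ y : X, HasSum (fun i => ⟪y, e i⟫ ^ 2) (‖y‖ ^ 2) := by
    intro y
    have := e.hasSum_inner_mul_inner y y
    rw [real_inner_self_eq_norm_sq] at this
    refine this.congr_fun ?_
    intro i
    rw [real_inner_comm y (e i)]; ring
  have hbs : ∀ p : X × X, HasSum
      (fun i => K * (3 * ‖T‖ ^ 2 * l i ^ 2 + ⟪μ p.1, e i⟫ ^ 2 + ⟪μ p.2, e i⟫ ^ 2))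
      (K * (3 * ‖T‖ ^ 2 * (∑' i, l i ^ 2) + ‖μ p.1‖ ^ 2 + ‖μ p.2‖ ^ 2)) := fun p =>
    (((hl2.hasSum.mul_left _).add (hpars _)).add (hpars _)).mul_left K
  have hbi : Integrable (fun p : X × X =>
      K * (3 * ‖T‖ ^ 2 * (∑' i, l i ^ 2) + ‖μ p.1‖ ^ 2 + ‖μ p.2‖ ^ 2)) (Q.prod Q) := by
    refine (((integrable_const _).add ?_).add ?_).const_mul K
    · exact hμ2.comp_fst Q
    · exact hμ2.comp_snd Q
  have hbd := fun i (p : X × X) => ksd_G_bound e p0 p1 p2 K b0 b1 b1' b2 T i (l i)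
    (fun x => ⟪μ x, e i⟫) p.1 p.2
  have hmv : Measurable fun p : X × X => hv p.1 p.2 := by
    refine measurable_of_tendsto_metrizable (f := fun n p => ∑ i ∈ Finset.range n,
      ksdG p0 p1 p2 T (e i) (l i) (fun x => ⟪μ x, e i⟫) p.1 p.2) ?_ ?_
    · intro n; exact Finset.measurable_fun_sum _ fun i _ => hmeas i
    · rw [tendsto_pi_nhds]; intro p; exact (hs p.1 p.2).tendsto_sum_nat
  have hiv : Integrable (fun p : X × X => hv p.1 p.2) (Q.prod Q) := by
    refine hbi.mono' hmv.aestronglyMeasurable (Eventually.of_forall fun p => ?_)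
    exact (hs p.1 p.2).norm_le_of_bounded (hbs p) fun i => hbd i p
  rw [← integral_prod _ hiv]
  refine hasSum_integral_of_dominated_convergence
    (fun i (p : X × X) => K * (3 * ‖T‖ ^ 2 * l i ^ 2 + ⟪μ p.1, e i⟫ ^ 2 + ⟪μ p.2, e i⟫ ^ 2))
    (fun i => (hmeas i).aestronglyMeasurable) ?_ ?_ ?_ ?_
  · intro i; exact Eventually.of_forall fun p => hbd i p
  · exact Eventually.of_forall fun p => (hbs p).summable
  · simp only [fun p => (hbs p).tsum_eq]; exact hbi
  · exact Eventually.of_forall fun p => hs p.1 p.2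

end

/-- The profile of the squared exponential kernel. -/
noncomputable def ksdS (r : ℝ) : ℝ := Real.exp (-(1 / 2) * r)

lemma ksdS_deriv (r : ℝ) : HasDerivAt ksdS (-(1/2) * ksdS r) r := by
  have := ((hasDerivAt_id r).const_mul (-(1/2) : ℝ)).exp
  refine this.congr_deriv ?_
  simp [ksdS]; ring

lemma ksdS_meas : Measurable ksdS := by unfold ksdS; fun_prop

lemma ksdS_b0 (r : ℝ) (hr : 0 ≤ r) : |ksdS r| ≤ 2 := by
  rw [ksdS, abs_of_pos (Real.exp_pos _)]
  have : Real.exp (-(1/2) * r) ≤ 1 := Real.exp_le_one_iff.2 (by linarith)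
  linarith

lemma ksdS_b2 (r : ℝ) (hr : 0 ≤ r) : |ksdS r| * r ≤ 2 := by
  rw [ksdS, abs_of_pos (Real.exp_pos _)]
  have h1 : Real.exp (-(1/2) * r) * Real.exp ((1/2) * r) = 1 := by
    rw [← Real.exp_add]; simp
  have h2 := Real.add_one_le_exp ((1/2) * r)
  have h3 := Real.exp_pos (-(1/2) * r)
  nlinarith

lemma ksdS_b1 (r : ℝ) (hr : 0 ≤ r) : |ksdS (r ^ 2)| * r ≤ 2 := by
  have h1 := ksdS_b2 (r ^ 2) (by positivity)
  have h2 := ksdS_b0 (r ^ 2) (by positivity)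
  have h3 := abs_nonneg (ksdS (r ^ 2))
  nlinarith [mul_nonneg h3 (sq_nonneg (r - 1))]

lemma ksdI_pow (r : ℝ) (hr : 0 ≤ r) (a : ℝ) :
    HasDerivAt (fun r : ℝ => (r + 1) ^ a) (a * (r + 1) ^ (a - 1)) r := by
  have := ((hasDerivAt_id r).add_const 1).rpow_const (p := a) (Or.inl (by simp; linarith))
  refine this.congr_deriv ?_
  simp

lemma ksdI_b (r : ℝ) (hr : 0 ≤ r) (a b : ℝ) (hab : a + b ≤ 0) :
    |(r + 1) ^ a| * (r + 1) ^ b ≤ 1 := by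
  rw [abs_of_pos (by positivity), ← Real.rpow_add (by linarith)]
  exact Real.rpow_le_one_of_one_le_of_nonpos (by linarith) hab

section
variable {X : Type*} [NormedAddCommGroup X] [InnerProductSpace ℝ X] [CompleteSpace X]
    [MeasurableSpace X] [BorelSpace X] [SecondCountableTopology X]

lemma ksdH_eq_G (T : X →L[ℝ] X) (v : X) (c : ℝ) (m : X → ℝ) (x x' : X) :
    ksdH T v c m x x' = ksdG ksdS ksdS ksdS T v c m x x' := by
  unfold ksdH ksdG ksdS
  ring

/-- IMQ coordinate Stein kernel. -/
noncomputable def ksdI (T : X →L[ℝ] X) (v : X) (c : ℝ) (m : X → ℝ) (x x' : X) : ℝ :=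
  ksdG (fun r => (r + 1) ^ (-(1/2) : ℝ)) (fun r => (r + 1) ^ (-(3/2) : ℝ))
    (fun r => 3 * (r + 1) ^ (-(5/2) : ℝ)) T v c m x x'

lemma ksdH_smul (T : X →L[ℝ] X) (v : X) (c : ℝ) (m : X → ℝ) (x x' : X) (τ : ℝ) (hτ : 0 < τ) :
    ksdH (Real.sqrt τ • T) v c m x x' = Real.exp (-(1/2) * (τ * ‖T x - T x'‖ ^ 2)) *
      (m x * m x' + τ * (c ^ 2 * ⟪T v, T v⟫ + c * ⟪T x - T x', T v⟫ * (m x' - m x))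
        - τ ^ 2 * (c * ⟪T x - T x', T v⟫) ^ 2) := by
  have hs : Real.sqrt τ * Real.sqrt τ = τ := Real.mul_self_sqrt hτ.le
  have hs2 : Real.sqrt τ ^ 2 = τ := Real.sq_sqrt hτ.le
  unfold ksdH
  have h1 : (Real.sqrt τ • T) x - (Real.sqrt τ • T) x' = Real.sqrt τ • (T x - T x') := by
    simp [smul_sub]
  have h2 : (Real.sqrt τ • T) v = Real.sqrt τ • T v := rfl
  rw [h1, h2, norm_smul, mul_pow, Real.norm_eq_abs, sq_abs, hs2]
  simp only [real_inner_smul_left, real_inner_smul_right]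
  simp only [← mul_assoc (Real.sqrt τ), hs]
  ring

lemma ksd_gamma_int (s a : ℝ) (hs : 0 < s) (ha : 0 < a) :
    IntegrableOn (fun τ : ℝ => τ ^ (a - 1) * Real.exp (-(s * τ))) (Set.Ioi 0) := by
  have := integrableOn_rpow_mul_exp_neg_mul_rpow (p := 1) (s := a - 1) (b := s)
    (by linarith) one_pos hs
  simpa using this

lemma ksd_gamma_shift (s a : ℝ) (n : ℕ) (τ : ℝ) (hτ : 0 < τ) :
    τ ^ a * Real.exp (-(s * τ)) * τ ^ n = τ ^ (a + n) * Real.exp (-(s * τ)) := by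
  rw [Real.rpow_add hτ, Real.rpow_natCast]; ring

lemma ksd_pointwise (T : X →L[ℝ] X) (v : X) (c : ℝ) (m : X → ℝ) (x x' : X) :
    ∫ τ in Set.Ioi (0:ℝ), τ ^ (-(1/2) : ℝ) * Real.exp (-(1/2 * τ)) *
      ksdH (Real.sqrt τ • T) v c m x x' =
    (Real.Gamma (1/2) * 2 ^ (1/2 : ℝ)) * ksdI T v c m x x' := by
  set r := ‖T x - T x'‖ ^ 2 with hr
  have hr0 : 0 ≤ r := by positivity
  set s := (r + 1) / 2 with hs
  have hs0 : 0 < s := by positivity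
  set A := m x * m x'
  set B := c ^ 2 * ⟪T v, T v⟫ + c * ⟪T x - T x', T v⟫ * (m x' - m x) with hB
  set D := (c * ⟪T x - T x', T v⟫) ^ 2 with hD
  have i1 := ksd_gamma_int s (1/2) hs0 (by norm_num)
  have i2 := ksd_gamma_int s (3/2) hs0 (by norm_num)
  have i3 := ksd_gamma_int s (5/2) hs0 (by norm_num)
  have e1 : ∫ τ in Set.Ioi (0:ℝ), τ ^ (-(1/2) : ℝ) * Real.exp (-(1/2 * τ)) *
      ksdH (Real.sqrt τ • T) v c m x x' = ∫ τ in Set.Ioi (0:ℝ),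
      (τ ^ ((1/2:ℝ) - 1) * Real.exp (-(s * τ)) * A + τ ^ ((3/2:ℝ) - 1) * Real.exp (-(s * τ)) * B
        - τ ^ ((5/2:ℝ) - 1) * Real.exp (-(s * τ)) * D) := by
    refine setIntegral_congr_fun measurableSet_Ioi fun τ hτ => ?_
    have hτ' : 0 < τ := hτ
    beta_reduce
    rw [ksdH_smul T v c m x x' τ hτ']
    have e2 : Real.exp (-(1/2 * τ)) * Real.exp (-(1/2) * (τ * ‖T x - T x'‖ ^ 2))
        = Real.exp (-(s * τ)) := by
      rw [← Real.exp_add, hs, hr]; congr 1; ring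
    have f1 := ksd_gamma_shift s (-(1/2)) 1 τ hτ'
    have f2 := ksd_gamma_shift s (-(1/2)) 2 τ hτ'
    have g0 : ((1/2:ℝ) - 1) = -(1/2) := by norm_num
    have g1 : ((3/2:ℝ) - 1) = -(1/2) + (1:ℕ) := by norm_num
    have g2 : ((5/2:ℝ) - 1) = -(1/2) + (2:ℕ) := by norm_num
    rw [g0, g1, g2, ← f1, ← f2, ← e2]
    ring
  have i12 : IntegrableOn (fun τ : ℝ => τ ^ ((1/2:ℝ) - 1) * Real.exp (-(s * τ)) * A +
      τ ^ ((3/2:ℝ) - 1) * Real.exp (-(s * τ)) * B) (Set.Ioi 0) :=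
    (i1.mul_const A).add (i2.mul_const B)
  rw [e1, integral_sub i12 (i3.mul_const D),
    integral_add (i1.mul_const A) (i2.mul_const B), integral_mul_const, integral_mul_const,
    integral_mul_const, Real.integral_rpow_mul_exp_neg_mul_Ioi (by norm_num) hs0,
    Real.integral_rpow_mul_exp_neg_mul_Ioi (by norm_num) hs0,
    Real.integral_rpow_mul_exp_neg_mul_Ioi (by norm_num) hs0]
  have G1 : Real.Gamma (3/2) = 1/2 * Real.Gamma (1/2) := by
    rw [← Real.Gamma_add_one (by norm_num)]; norm_num
  have G2 : Real.Gamma (5/2) = 3/2 * Real.Gamma (3/2) := by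
    rw [← Real.Gamma_add_one (by norm_num)]; norm_num
  have P : ∀ a : ℝ, (1 / s) ^ a = 2 ^ a * (r + 1) ^ (-a) := by
    intro a
    have : 1 / s = 2 * (r + 1)⁻¹ := by rw [hs]; field_simp
    rw [this, Real.mul_rpow (by norm_num) (by positivity), Real.inv_rpow (by positivity),
      Real.rpow_neg (by positivity)]
  have two1 : (2:ℝ) ^ (3/2:ℝ) = 2 * 2 ^ (1/2:ℝ) := by
    rw [show (3/2:ℝ) = 1/2 + 1 by norm_num, Real.rpow_add_one (by norm_num)]; ring
  have two2 : (2:ℝ) ^ (5/2:ℝ) = 4 * 2 ^ (1/2:ℝ) := by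
    rw [show (5/2:ℝ) = 3/2 + 1 by norm_num, Real.rpow_add_one (by norm_num), two1]; ring
  rw [P, P, P, G2, G1, two1, two2]
  simp only [ksdI, ksdG, ← hr, ← hB, ← hD]
  ring

lemma ksd_mix (e : HilbertBasis ℕ ℝ X) (Q : Measure X) [IsProbabilityMeasure Q]
    (T : X →L[ℝ] X) (i : ℕ) (c : ℝ) (m : X → ℝ) (hm : Measurable m)
    (hm2 : Integrable (fun x => m x ^ 2) Q) :
    IntegrableOn (fun τ : ℝ => τ ^ (-(1/2) : ℝ) * Real.exp (-(1/2 * τ)) *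
      ∫ p : X × X, ksdH (Real.sqrt τ • T) (e i) c m p.1 p.2 ∂(Q.prod Q)) (Set.Ioi 0) ∧
    ∫ τ in Set.Ioi (0:ℝ), τ ^ (-(1/2) : ℝ) * Real.exp (-(1/2 * τ)) *
      ∫ p : X × X, ksdH (Real.sqrt τ • T) (e i) c m p.1 p.2 ∂(Q.prod Q) =
    (Real.Gamma (1/2) * 2 ^ (1/2 : ℝ)) * ∫ p : X × X, ksdI T (e i) c m p.1 p.2 ∂(Q.prod Q) := by
  set w : ℝ → ℝ := fun τ => τ ^ (-(1/2) : ℝ) * Real.exp (-(1/2 * τ)) with hw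
  have hwm : Measurable w := by rw [hw]; fun_prop
  have w0 : IntegrableOn w (Set.Ioi 0) := by
    have := ksd_gamma_int (1/2) (1/2) (by norm_num) (by norm_num)
    rw [show ((1/2:ℝ) - 1) = -(1/2) by norm_num] at this
    exact this
  have w1 : IntegrableOn (fun τ => w τ * τ) (Set.Ioi 0) := by
    have := ksd_gamma_int (1/2) (3/2) (by norm_num) (by norm_num)
    refine this.congr_fun (fun τ hτ => ?_) measurableSet_Ioi
    have f1 := ksd_gamma_shift (1/2) (-(1/2)) 1 τ hτ
    rw [show ((3/2:ℝ) - 1) = -(1/2) + (1:ℕ) by norm_num]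
    simp only [hw]
    rw [← f1, pow_one]
  have hJ : Integrable (fun z : ℝ × (X × X) => w z.1 *
      ksdH (Real.sqrt z.1 • T) (e i) c m z.2.1 z.2.2)
      ((volume.restrict (Set.Ioi 0)).prod (Q.prod Q)) := by
    have hmm : Integrable (fun p : X × X => 2 * (m p.1 ^ 2 + m p.2 ^ 2)) (Q.prod Q) :=
      ((hm2.comp_fst Q).add (hm2.comp_snd Q)).const_mul 2
    have hb := (Integrable.mul_prod w1
      (integrable_const (μ := Q.prod Q) (2 * (3 * ‖T‖ ^ 2 * c ^ 2)))).add (w0.mul_prod hmm)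
    refine hb.mono' ?_ ?_
    · refine Measurable.aestronglyMeasurable ?_
      unfold ksdH
      simp only [smul_apply]
      fun_prop
    · have hpos : ∀ᵐ z : ℝ × (X × X) ∂((volume.restrict (Set.Ioi 0)).prod (Q.prod Q)),
          0 < z.1 := by
        have : ∀ᵐ τ : ℝ ∂(volume.restrict (Set.Ioi 0)), 0 < τ :=
          ae_restrict_mem measurableSet_Ioi
        exact Measure.quasiMeasurePreserving_fst.ae this
      filter_upwards [hpos] with z hz
      have hwz : 0 ≤ w z.1 := by simp only [hw]; positivity
      rw [ksdH_eq_G, norm_mul, Real.norm_eq_abs, Real.norm_eq_abs, abs_of_nonneg hwz]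
      have := ksd_G_bound e ksdS ksdS ksdS 2 ksdS_b0 ksdS_b0 ksdS_b1 ksdS_b2
        (Real.sqrt z.1 • T) i c m z.2.1 z.2.2
      rw [norm_smul, mul_pow, Real.norm_eq_abs, sq_abs, Real.sq_sqrt hz.le] at this
      refine (mul_le_mul_of_nonneg_left this hwz).trans (le_of_eq ?_)
      simp only [Pi.add_apply]
      ring
  constructor
  · have := hJ.integral_prod_left
    simp only [integral_const_mul] at this
    exact this
  · have := integral_integral_swap (f := fun (τ : ℝ) (p : X × X) => w τ *
      ksdH (Real.sqrt τ • T) (e i) c m p.1 p.2) hJ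
    simp only [integral_const_mul] at this
    rw [this, ← integral_const_mul]
    refine integral_congr_ae (Eventually.of_forall fun p => ?_)
    exact ksd_pointwise T (e i) c m p.1 p.2

lemma ksd_imq_facts (e : HilbertBasis ℕ ℝ X) (Q : Measure X) [IsProbabilityMeasure Q]
    (hQ2 : Integrable (fun x => ‖x‖ ^ 2) Q)
    (T : X →L[ℝ] X) (i : ℕ) (c : ℝ) (m : X → ℝ) (hm : Measurable m)
    (hm2 : Integrable (fun x => m x ^ 2) Q) :
    0 ≤ ∫ p : X × X, ksdI T (e i) c m p.1 p.2 ∂(Q.prod Q) ∧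
    (∫ p : X × X, ksdI T (e i) c m p.1 p.2 ∂(Q.prod Q) = 0 → ∃ τ : ℝ, 0 < τ ∧
      ∫ p : X × X, ksdH (Real.sqrt τ • T) (e i) c m p.1 p.2 ∂(Q.prod Q) = 0) ∧
    ((∀ τ : ℝ, 0 < τ →
      ∫ p : X × X, ksdH (Real.sqrt τ • T) (e i) c m p.1 p.2 ∂(Q.prod Q) = 0) →
      ∫ p : X × X, ksdI T (e i) c m p.1 p.2 ∂(Q.prod Q) = 0) := by
  obtain ⟨h1, h2⟩ := ksd_mix e Q T i c m hm hm2
  have hκ : 0 < Real.Gamma (1/2) * 2 ^ (1/2 : ℝ) :=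
    mul_pos (Real.Gamma_pos_of_pos (by norm_num)) (by positivity)
  have hJ : ∀ τ : ℝ, 0 ≤ ∫ p : X × X, ksdH (Real.sqrt τ • T) (e i) c m p.1 p.2 ∂(Q.prod Q) := by
    intro τ
    have := (ksd_se_quad e Q hQ2 (Real.sqrt τ • T) (e i) c m hm hm2 0 0).2
    simpa using this
  have hnn : ∀ τ ∈ Set.Ioi (0:ℝ), 0 ≤ τ ^ (-(1/2) : ℝ) * Real.exp (-(1/2 * τ)) *
      ∫ p : X × X, ksdH (Real.sqrt τ • T) (e i) c m p.1 p.2 ∂(Q.prod Q) := by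
    intro τ hτ
    have hτ' : 0 < τ := hτ
    exact mul_nonneg (by positivity) (hJ τ)
  refine ⟨?_, ?_, ?_⟩
  · have := setIntegral_nonneg (μ := volume) measurableSet_Ioi hnn
    rw [h2] at this
    exact nonneg_of_mul_nonneg_right this hκ
  · intro h0
    rw [h0, mul_zero, setIntegral_eq_zero_iff_of_nonneg_ae
      ((ae_restrict_iff' measurableSet_Ioi).2 (Eventually.of_forall hnn)) h1] at h2
    have : NeZero (volume.restrict (Set.Ioi (0:ℝ))) := ⟨by simp⟩
    obtain ⟨τ, ha, hb⟩ := (h2.and (ae_restrict_mem measurableSet_Ioi)).exists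
    have hb' : 0 < τ := hb
    refine ⟨τ, hb, ?_⟩
    have hp : 0 < τ ^ (-(1/2) : ℝ) * Real.exp (-(1/2 * τ)) := by positivity
    exact (mul_eq_zero.1 ha).resolve_left hp.ne'
  · intro h0
    rw [setIntegral_congr_fun (g := fun _ => (0:ℝ)) measurableSet_Ioi
      (fun τ hτ => by simp only; rw [h0 τ hτ, mul_zero])] at h2
    simp only [integral_zero] at h2
    exact (mul_eq_zero.1 h2.symm).resolve_left (ne_of_gt hκ)

end

/-- **Separation of the kernel Stein discrepancy for SE-`T` and IMQ-`T` kernels**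
(Corollary 2): if `T : X → X` is a bounded linear operator whose adjoint is surjective and
`k` is either the squared-exponential kernel `exp(-½‖Tx - Ty‖²)` or the inverse
multiquadric kernel `(‖Tx - Ty‖² + 1)^{-1/2}`, then the (vectorised) KSD of `Q` against
the Gibbs measure `P ∝ e^{-U} N_C` vanishes iff `Q = P`. -/
theorem ksd_se_imq_separates
    {X : Type*} [NormedAddCommGroup X] [InnerProductSpace ℝ X] [CompleteSpace X]
    [MeasurableSpace X] [BorelSpace X] [SecondCountableTopology X]
    -- the covariance operator and its eigendecomposition
    (C : X →L[ℝ] X) (hCsa : IsSelfAdjoint C)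
    (e : HilbertBasis ℕ ℝ X) (l : ℕ → ℝ) (hl : ∀ i, 0 < l i)
    (hCe : ∀ i, C (e i) = l i • e i) (hltr : Summable l)
    -- the potential `U` and its gradient `DU`
    (U : X → ℝ) (DU : X → X)
    (hU : ∀ x, HasFDerivAt U ((InnerProductSpace.toDual ℝ X) (DU x) : X →L[ℝ] ℝ) x)
    -- the Gaussian reference measure `N_C`
    (NC : Measure X) [IsProbabilityMeasure NC]
    (hNC : ∀ y : X, Measure.map (fun x => ⟪y, x⟫) NC
      = gaussianReal 0 (Real.toNNReal ⟪C y, y⟫))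
    -- the Gibbs target measure `P ∝ e^{-U} N_C`
    (hexpU : Integrable (fun x => Real.exp (-U x)) NC)
    (hZpos : 0 < ∫ x, Real.exp (-U x) ∂NC)
    (P : Measure X) [IsProbabilityMeasure P]
    (hP : P = (ENNReal.ofReal (∫ x, Real.exp (-U x) ∂NC))⁻¹ •
        NC.withDensity (fun x => ENNReal.ofReal (Real.exp (-U x))))
    -- the square root `C^{1/2}` of `C` and the Malliavin-type integrability conditions
    (Csqrt : X →L[ℝ] X) (hCsqrt : ∀ i, Csqrt (e i) = Real.sqrt (l i) • e i)
    (hDU1 : Integrable (fun x => ‖Csqrt (DU x)‖ ^ 2) NC)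
    (hDU2 : Integrable (fun x => Real.exp (-U x) * ‖Csqrt (DU x)‖ ^ 2) NC)
    -- the candidate measure `Q` and its moment conditions
    (Q : Measure X) [IsProbabilityMeasure Q]
    (hQ2 : Integrable (fun x => ‖x‖ ^ 2) Q)
    (hQU : Integrable (fun x => ‖C (DU x)‖ ^ 2) Q)
    -- the operator `T` with surjective adjoint
    (T : X →L[ℝ] X) (hT : Function.Surjective (ContinuousLinearMap.adjoint T))
    -- the kernel `k`, either SE-`T` or IMQ-`T`
    (k : X → X → ℝ)
    (hk : (∀ x y : X, k x y = Real.exp (-(1 / 2) * ‖T x - T y‖ ^ 2)) ∨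
          (∀ x y : X, k x y = (‖T x - T y‖ ^ 2 + 1) ^ (-(1 / 2) : ℝ))) :
    ∫ x, ∫ x', steinKernelHv k C DU (fun i => e i) l x x' ∂Q ∂Q = 0 ↔ Q = P := by
  have hl2 : Summable fun i => l i ^ 2 := by
    have := hltr.mul_of_nonneg hltr (fun i => (hl i).le) (fun i => (hl i).le)
    have h2 := this.comp_injective (i := fun n : ℕ => (n, n)) (fun a b h => (Prod.mk.inj h).1)
    refine h2.congr fun i => ?_
    simp only [Function.comp]; ring
  have hUc : Continuous U := continuous_iff_continuousAt.2 fun x => (hU x).continuousAt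
  have hDUm : Measurable DU := by
    have h1 : DU = fun x => (InnerProductSpace.toDual ℝ X).symm (fderiv ℝ U x) := by
      ext x
      rw [(hU x).fderiv, LinearIsometryEquiv.symm_apply_apply]
    rw [h1]
    exact (InnerProductSpace.toDual ℝ X).symm.continuous.measurable.comp (measurable_fderiv ℝ U)
  have hμm : Measurable fun x => x + C (DU x) := by fun_prop
  have hμ2 : Integrable (fun x => ‖x + C (DU x)‖ ^ 2) Q := by
    refine ((hQ2.const_mul 2).add (hQU.const_mul 2)).mono'
      (hμm.norm.pow_const 2).aestronglyMeasurable (Eventually.of_forall fun x => ?_)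
    rw [Real.norm_eq_abs, abs_of_nonneg (sq_nonneg _)]
    have h1 := norm_add_le x (C (DU x))
    have h2 := pow_le_pow_left₀ (norm_nonneg _) h1 2
    simp only [Pi.add_apply]
    nlinarith [sq_nonneg (‖x‖ - ‖C (DU x)‖)]
  have hmeq : ∀ i x, ⟪x + C (DU x), e i⟫ = ⟪x, e i⟫ + l i * ⟪DU x, e i⟫ := by
    intro i x
    rw [inner_add_left, ksd_Ce_inner C hCsa e l hCe]
  have hm : ∀ i, Measurable fun x => ⟪x, e i⟫ + l i * ⟪DU x, e i⟫ := by
    intro i; fun_prop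
  have hm2 : ∀ i, Integrable (fun x => (⟪x, e i⟫ + l i * ⟪DU x, e i⟫) ^ 2) Q := by
    intro i
    refine hμ2.mono' ((hm i).pow_const 2).aestronglyMeasurable (Eventually.of_forall fun x => ?_)
    rw [Real.norm_eq_abs, abs_of_nonneg (sq_nonneg _), ← hmeq]
    have h1 := abs_real_inner_le_norm (x + C (DU x)) (e i)
    rw [e.orthonormal.1 i, mul_one] at h1
    rw [← sq_abs]
    exact pow_le_pow_left₀ (abs_nonneg _) h1 2
  rcases hk with hk | hk
  · have hs := ksd_L2 e l hl2 ksdS ksdS ksdS 2 ksdS_meas ksdS_meas ksdS_meas ksdS_b0 ksdS_b0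
      ksdS_b1 ksdS_b2 T (fun x => x + C (DU x)) hμm Q hμ2 _
      (ksd_L1 C hCsa e l hCe hl2 DU ksdS ksdS ksdS (fun r _ => ksdS_deriv r)
        (fun r _ => ksdS_deriv r) T k hk)
    simp only [hmeq, ← ksdH_eq_G] at hs
    constructor
    · intro h0
      rw [h0] at hs
      have hz := (hasSum_zero_iff_of_nonneg (fun i => by
        have := (ksd_se_quad e Q hQ2 T (e i) (l i) _ (hm i) (hm2 i) 0 0).2
        simpa using this)).1 hs
      exact ksd_identify C hCsa e l hl hCe U hUc NC hNC hexpU P hP Q fun i f hf =>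
        ksd_zero_resample e Q hQ2 U DU hU T hT i (l i) (hl i) (hm i) (hm2 i) (congrFun hz i) f hf
    · intro hQP
      subst hQP
      refine hs.unique ?_
      have hz : ∀ i, ∫ p : X × X, ksdH T (e i) (l i) (fun x => ⟪x, e i⟫ + l i * ⟪DU x, e i⟫)
          p.1 p.2 ∂(Q.prod Q) = 0 := fun i =>
        ksd_converse_se C hCsa e l hl hCe U DU hU NC hNC hexpU hZpos Q hP hQ2 T i (hm i) (hm2 i)
      simp only [hz]
      exact hasSum_zero
  · have hs := ksd_L2 e l hl2 (fun r => (r + 1) ^ (-(1/2) : ℝ)) (fun r => (r + 1) ^ (-(3/2) : ℝ))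
      (fun r => 3 * (r + 1) ^ (-(5/2) : ℝ)) 3 (by fun_prop) (by fun_prop) (by fun_prop)
      (fun r hr => by
        have := ksdI_b r hr (-(1/2)) 0 (by norm_num)
        rw [Real.rpow_zero] at this; linarith)
      (fun r hr => by
        have := ksdI_b r hr (-(3/2)) 0 (by norm_num)
        rw [Real.rpow_zero] at this; linarith)
      (fun r hr => by
        have := ksdI_b (r ^ 2) (by positivity) (-(3/2)) 1 (by norm_num)
        rw [Real.rpow_one] at this
        have h2 := abs_nonneg ((r ^ 2 + 1) ^ (-(3/2) : ℝ))
        nlinarith [mul_nonneg h2 (sq_nonneg (r - 1))])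
      (fun r hr => by
        have := ksdI_b r hr (-(5/2)) 1 (by norm_num)
        rw [Real.rpow_one] at this
        have h2 := abs_nonneg ((r + 1) ^ (-(5/2) : ℝ))
        rw [abs_mul, abs_of_pos (by norm_num : (0:ℝ) < 3)]
        nlinarith)
      T (fun x => x + C (DU x)) hμm Q hμ2 _
      (ksd_L1 C hCsa e l hCe hl2 DU _ _ _
        (fun r hr => (ksdI_pow r hr (-(1/2))).congr_deriv (by norm_num))
        (fun r hr => (ksdI_pow r hr (-(3/2))).congr_deriv (by norm_num; ring)) T k hk)
    have hs' : HasSum (fun i => ∫ p : X × X, ksdI T (e i) (l i)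
        (fun x => ⟪x, e i⟫ + l i * ⟪DU x, e i⟫) p.1 p.2 ∂(Q.prod Q))
        (∫ x, ∫ x', steinKernelHv k C DU (fun i => e i) l x x' ∂Q ∂Q) := by
      simp only [hmeq] at hs
      exact hs
    have hf := fun i => ksd_imq_facts e Q hQ2 T i (l i) _ (hm i) (hm2 i)
    constructor
    · intro h0
      rw [h0] at hs'
      have hz := (hasSum_zero_iff_of_nonneg (fun i => (hf i).1)).1 hs'
      refine ksd_identify C hCsa e l hl hCe U hUc NC hNC hexpU P hP Q fun i f hfm => ?_
      obtain ⟨τ, hτ, h1⟩ := (hf i).2.1 (congrFun hz i)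
      have hT' : Function.Surjective (ContinuousLinearMap.adjoint (Real.sqrt τ • T)) := by
        intro y
        obtain ⟨z, hz⟩ := hT y
        refine ⟨(Real.sqrt τ)⁻¹ • z, ?_⟩
        have hne : Real.sqrt τ ≠ 0 := (Real.sqrt_pos.2 hτ).ne'
        refine ext_inner_right ℝ fun u => ?_
        rw [ContinuousLinearMap.adjoint_inner_left, smul_apply, real_inner_smul_left,
          real_inner_smul_right, ← mul_assoc, inv_mul_cancel₀ hne, one_mul,
          ← ContinuousLinearMap.adjoint_inner_left, hz]
      exact ksd_zero_resample e Q hQ2 U DU hU _ hT' i (l i) (hl i) (hm i) (hm2 i) h1 f hfm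
    · intro hQP
      subst hQP
      refine hs'.unique ?_
      have hz : ∀ i, ∫ p : X × X, ksdI T (e i) (l i) (fun x => ⟪x, e i⟫ + l i * ⟪DU x, e i⟫)
          p.1 p.2 ∂(Q.prod Q) = 0 := fun i =>
        (hf i).2.2 fun τ _ => ksd_converse_se C hCsa e l hl hCe U DU hU NC hNC hexpU hZpos Q hP
          hQ2 (Real.sqrt τ • T) i (hm i) (hm2 i)
      simp only [hz]
      exact hasSum_zero
end

section
/- Continuity of the spectral integrand with respect to a trace-class-induced norm (Proposition V_continuity): suppose ∫ ‖x‖² dQ(x) < ∞ and ∫ ‖G(x)‖² dQ(x) < ∞, and define F(s) = ‖ Cs · Q̂(s) + DQ̂(s) + i ∫ G(x) e^{i⟨s,x⟩} dQ(x) ‖²_{X_ℂ}. Then there exists a self-adjoint, injective, positive, trace-class continuous linear operator V : X → X such that F is continuous with respect to the norm x ↦ ⟨Vx, x⟩^{1/2}: for every s ∈ X and ε > 0 there is δ > 0 such that ⟨V(s−t), s−t⟩ < δ implies |F(s) − F(t)| < ε. -/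
open MeasureTheory ProbabilityTheory Complex Filter
open scoped RealInnerProductSpace

theorem vc_countable {X ι : Type*} [NormedAddCommGroup X] [InnerProductSpace ℝ X]
    [SecondCountableTopology X] {v : ι → X} (hv : Orthonormal ℝ v) : Countable ι := by
  apply Pairwise.countable_of_isOpen_disjoint (s := fun i => Metric.ball (v i) (1/2))
  · intro i j hij
    apply Metric.ball_disjoint_ball
    have h : ‖v i - v j‖ ^ 2 = 2 := by
      rw [@norm_sub_sq_real, hv.1 i, hv.1 j, hv.2 hij]; norm_num
    rw [dist_eq_norm]
    nlinarith [norm_nonneg (v i - v j)]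
  · intro i; exact Metric.isOpen_ball
  · intro i; exact ⟨v i, by simp⟩

theorem vc_eigenbasis {X : Type*} [NormedAddCommGroup X] [InnerProductSpace ℝ X] [CompleteSpace X]
    [SecondCountableTopology X] (V : X →L[ℝ] X) (hc : IsCompactOperator V) (hs : IsSelfAdjoint V)
    (e : HilbertBasis ℕ ℝ X) :
    ∃ (b : HilbertBasis ℕ ℝ X) (lv : ℕ → ℝ), ∀ i, V (b i) = lv i • b i := by
  have hsym := ContinuousLinearMap.isSelfAdjoint_iff_isSymmetric.mp hs
  have horth := ContinuousLinearMap.orthogonalComplement_iSup_eigenspaces_eq_bot hc hsym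
  have hfam := hsym.orthogonalFamily_eigenspaces
  have hcpl : ∀ μ : ℝ, CompleteSpace (Module.End.eigenspace (V : Module.End ℝ X) μ) := by
    intro μ
    have : IsClosed ((Module.End.eigenspace (V : Module.End ℝ X) μ : Submodule ℝ X) : Set X) := by
      have : ((Module.End.eigenspace (V : Module.End ℝ X) μ : Submodule ℝ X) : Set X)
          = {x | V x = μ • x} := by
        ext x; simp
      rw [this]
      exact isClosed_eq (by fun_prop) (by fun_prop)
    exact this.completeSpace_coe
  choose w bw hbw using fun μ : ℝ =>
    exists_hilbertBasis ℝ (Module.End.eigenspace (V : Module.End ℝ X) μ)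
  have hon := hfam.orthonormal_sigma_orthonormal (v_family := fun μ => bw μ)
    (fun μ => (bw μ).orthonormal)
  set v : (Σ μ : ℝ, w μ) → X := fun a => ((bw a.1 a.2 : _) : X) with hv
  have hon' : Orthonormal ℝ v := hon
  have hspan : (Submodule.span ℝ (Set.range v))ᗮ = ⊥ := by
    rw [eq_bot_iff, ← horth]
    intro x hx
    rw [Submodule.mem_orthogonal'] at hx
    rw [← Submodule.iInf_orthogonal, Submodule.mem_iInf]
    intro μ
    rw [Submodule.mem_orthogonal']
    intro u hu
    have h1 := (bw μ).hasSum_repr ⟨u, hu⟩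
    have h2 := h1.mapL ((innerSL ℝ x).comp (Submodule.subtypeL _))
    have h3 : ∀ i : w μ, ⟪x, (bw μ i : X)⟫ = 0 := fun i =>
      hx _ (Submodule.subset_span ⟨⟨μ, i⟩, rfl⟩)
    simp [h3] at h2
    exact h2.unique hasSum_zero
  have : Countable (Σ μ : ℝ, w μ) := vc_countable hon'
  have : Infinite (Σ μ : ℝ, w μ) := by
    by_contra hfin
    rw [not_infinite_iff_finite] at hfin
    have := Fintype.ofFinite (Σ μ : ℝ, w μ)
    let B := (HilbertBasis.mkOfOrthogonalEqBot hon' hspan).toOrthonormalBasis.toBasis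
    have : Module.Finite ℝ X := Module.Finite.of_basis B
    have := e.orthonormal.linearIndependent.finite
    exact not_finite ℕ
  obtain ⟨f⟩ := nonempty_equiv_of_countable (α := ℕ) (β := Σ μ : ℝ, w μ)
  have hon2 : Orthonormal ℝ (v ∘ f) := hon'.comp f f.injective
  refine ⟨HilbertBasis.mkOfOrthogonalEqBot hon2 (by rw [f.surjective.range_comp]; exact hspan),
    fun i => (f i).1, fun i => ?_⟩
  rw [HilbertBasis.coe_mkOfOrthogonalEqBot]
  exact Module.End.mem_eigenspace_iff.mp (bw (f i).1 (f i).2).2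

theorem vc_rankOne_compact {X : Type*} [NormedAddCommGroup X] [InnerProductSpace ℝ X] (x : X) :
    IsCompactOperator (InnerProductSpace.rankOne ℝ x x) := by
  rw [InnerProductSpace.rankOne_def']
  have : IsCompactOperator (innerSL ℝ x) :=
    isCompactOperator_of_locallyCompactSpace_dom (innerSL ℝ x)
  exact this.clm_comp (ContinuousLinearMap.toSpanSingleton ℝ x)

theorem vc_S {X : Type*} [NormedAddCommGroup X] [InnerProductSpace ℝ X] [CompleteSpace X]
    [MeasurableSpace X] [BorelSpace X] [SecondCountableTopology X]
    (Q : Measure X) [IsProbabilityMeasure Q] (hQ2 : Integrable (fun x => ‖x‖ ^ 2) Q) :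
    ∃ S : X →L[ℝ] X, IsCompactOperator S ∧ IsSelfAdjoint S ∧
      (∀ h, ⟪S h, h⟫ = ∫ x, ⟪h, x⟫ ^ 2 ∂Q) ∧
      (∀ v : ℕ → X, Orthonormal ℝ v → ∀ F : Finset ℕ,
        ∑ i ∈ F, ⟪S (v i), v i⟫ ≤ ∫ x, ‖x‖ ^ 2 ∂Q) := by
  have hcont : Continuous (fun x : X => InnerProductSpace.rankOne ℝ x x) :=
    (InnerProductSpace.rankOne ℝ (E := X) (F := X)).continuous.clm_apply continuous_id
  have hint : Integrable (fun x : X => InnerProductSpace.rankOne ℝ x x) Q := by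
    refine hQ2.mono' hcont.aestronglyMeasurable (Eventually.of_forall fun x => ?_)
    rw [InnerProductSpace.norm_rankOne, sq]
  have hform : ∀ h k : X, ⟪(∫ x, InnerProductSpace.rankOne ℝ x x ∂Q) h, k⟫
      = ∫ x, ⟪x, h⟫ * ⟪x, k⟫ ∂Q := by
    intro h k
    rw [ContinuousLinearMap.integral_apply hint, real_inner_comm, ← integral_inner]
    · congr 1; ext x
      simp [real_inner_smul_right, real_inner_comm]
    · exact hint.apply_continuousLinearMap h
  have hsq : ∀ h : X, Integrable (fun x => ⟪h, x⟫ ^ 2) Q := by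
    intro h
    refine (hQ2.const_mul (‖h‖ ^ 2)).mono' (by fun_prop) (Eventually.of_forall fun x => ?_)
    rw [Real.norm_of_nonneg (by positivity), ← mul_pow, ← sq_abs]
    gcongr
    exact abs_real_inner_le_norm h x
  have hdiag : ∀ h : X, ⟪(∫ x, InnerProductSpace.rankOne ℝ x x ∂Q) h, h⟫
      = ∫ x, ⟪h, x⟫ ^ 2 ∂Q := by
    intro h
    rw [hform]; congr 1; ext x; rw [sq, real_inner_comm]
  refine ⟨∫ x, InnerProductSpace.rankOne ℝ x x ∂Q, ?_, ?_, hdiag, ?_⟩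
  · have hcv : Convex ℝ { f : X →L[ℝ] X | IsCompactOperator f } :=
      (compactOperator (RingHom.id ℝ) X X).convex
    exact hcv.integral_mem isClosed_setOfPred_isCompactOperator
      (Eventually.of_forall fun x => vc_rankOne_compact x) hint
  · rw [ContinuousLinearMap.isSelfAdjoint_iff_isSymmetric]
    intro h k
    rw [ContinuousLinearMap.coe_coe, hform, real_inner_comm, hform]
    congr 1; ext x; ring
  · intro v hv F
    simp_rw [hdiag]
    rw [← integral_finsetSum _ (fun i _ => hsq (v i))]
    refine integral_mono (integrable_finsetSum _ (fun i _ => hsq (v i))) hQ2 fun x => ?_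
    simpa using hv.sum_inner_products_le x (s := F)

theorem vc_hasSum_congr {f g : ℕ → ℝ} {a : ℝ} (hf : HasSum f a) (h : ∀ i, g i = f i) :
    HasSum g a := by
  rw [funext h]; exact hf

theorem vc_C {X : Type*} [NormedAddCommGroup X] [InnerProductSpace ℝ X] [CompleteSpace X]
    (C : X →L[ℝ] X) (hCsa : IsSelfAdjoint C)
    (e : HilbertBasis ℕ ℝ X) (l : ℕ → ℝ) (hl : ∀ i, 0 < l i)
    (hCe : ∀ i, C (e i) = l i • e i) (hltr : Summable l) :
    IsCompactOperator C ∧ (∀ h, 0 ≤ ⟪C h, h⟫) ∧ (∀ h, h ≠ 0 → 0 < ⟪C h, h⟫) ∧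
      (∀ h, ‖C h‖ ^ 2 ≤ (∑' i, l i) * ⟪C h, h⟫) ∧
      (∀ v : ℕ → X, Orthonormal ℝ v → ∀ F : Finset ℕ,
        ∑ i ∈ F, ⟪C (v i), v i⟫ ≤ ∑' i, l i) := by
  have hsym := ContinuousLinearMap.isSelfAdjoint_iff_isSymmetric.mp hCsa
  have hCi : ∀ h i, ⟪C h, e i⟫ = l i * ⟪e i, h⟫ := by
    intro h i
    have := hsym h (e i)
    simp only [ContinuousLinearMap.coe_coe] at this
    rw [this, hCe, real_inner_smul_right, real_inner_comm]
  have hS1 : ∀ h, HasSum (fun i => l i * ⟪e i, h⟫ ^ 2) ⟪C h, h⟫ := by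
    intro h
    have := e.hasSum_inner_mul_inner (C h) h
    simp_rw [hCi] at this
    exact vc_hasSum_congr this (fun i => by ring)
  have hS2 : ∀ h, HasSum (fun i => l i ^ 2 * ⟪e i, h⟫ ^ 2) (‖C h‖ ^ 2) := by
    intro h
    have := e.hasSum_inner_mul_inner (C h) (C h)
    rw [real_inner_self_eq_norm_sq] at this
    refine vc_hasSum_congr this (fun i => ?_)
    rw [real_inner_comm (C h) (e i), hCi]
    ring
  have hnn : ∀ h, 0 ≤ ⟪C h, h⟫ := fun h =>
    (hS1 h).nonneg fun i => mul_nonneg (hl i).le (sq_nonneg _)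
  refine ⟨?_, hnn, ?_, ?_, ?_⟩
  · have hsm : Summable (fun i => l i • InnerProductSpace.rankOne ℝ (e i) (e i)) := by
      apply Summable.of_norm
      convert hltr using 2 with i
      rw [norm_smul, InnerProductSpace.norm_rankOne, e.orthonormal.1 i, Real.norm_of_nonneg (hl i).le]
      ring
    have heq : ∑' i, l i • InnerProductSpace.rankOne ℝ (e i) (e i) = C := by
      ext h
      have h1 := hsm.hasSum.mapL (ContinuousLinearMap.apply ℝ X h)
      have h2 := (e.hasSum_repr h).mapL C
      refine h1.unique ?_
      convert h2 using 2 with i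
      simp [hCe, e.repr_apply_apply, smul_smul, mul_comm]
    have hs := hsm.hasSum
    rw [heq] at hs
    refine isCompactOperator_of_tendsto hs (Eventually.of_forall fun F => ?_)
    exact (compactOperator (RingHom.id ℝ) X X).sum_mem fun i _ =>
      (compactOperator (RingHom.id ℝ) X X).smul_mem (l i) (vc_rankOne_compact (e i))
  · intro h hh
    refine lt_of_le_of_ne (hnn h) fun h0 => hh ?_
    have h1 := hS1 h
    rw [← h0, hasSum_zero_iff_of_nonneg (fun i => mul_nonneg (hl i).le (sq_nonneg _))] at h1
    have h2 := e.hasSum_repr h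
    refine h2.unique ?_
    convert hasSum_zero with i
    have := congrFun h1 i
    simp [(hl i).ne'] at this
    simp [e.repr_apply_apply, this]
  · intro h
    refine hasSum_le (fun i => ?_) (hS2 h) ((hS1 h).mul_left _)
    have : l i ≤ ∑' i, l i := hltr.le_tsum i fun j _ => (hl j).le
    have h3 := hl i
    rw [← mul_assoc, sq (l i)]
    gcongr
  · intro v hv F
    refine hasSum_le (fun j => ?_) (hasSum_sum fun i (_ : i ∈ F) => hS1 (v i)) hltr.hasSum
    rw [← Finset.mul_sum]
    have := hv.sum_inner_products_le (e j) (s := F)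
    rw [e.orthonormal.1 j] at this
    have h2 : ∑ i ∈ F, ⟪e j, v i⟫ ^ 2 ≤ 1 := by
      simpa [real_inner_comm] using this
    nlinarith [hl j]

theorem vc_diff {X E : Type*} [NormedAddCommGroup X] [InnerProductSpace ℝ X]
    [NormedAddCommGroup E] [NormedSpace ℝ E]
    [MeasurableSpace X] [BorelSpace X] [SecondCountableTopology X]
    (Q : Measure X) [IsProbabilityMeasure Q] (hQ2 : Integrable (fun x => ‖x‖ ^ 2) Q)
    (f : X → E) (hf : AEStronglyMeasurable f Q) (hf2 : Integrable (fun x => ‖f x‖ ^ 2) Q)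
    (φ : ℝ → ℝ) (hφ : Continuous φ) (hφ1 : ∀ a, |φ a| ≤ 1) (hφl : ∀ a b, |φ a - φ b| ≤ |a - b|)
    (s t : X) :
    ‖(∫ x, φ ⟪t, x⟫ • f x ∂Q) - ∫ x, φ ⟪s, x⟫ • f x ∂Q‖ ≤
      √(∫ x, ⟪s - t, x⟫ ^ 2 ∂Q) * √(∫ x, ‖f x‖ ^ 2 ∂Q) := by
  have hfm : MemLp f 2 Q := (memLp_two_iff_integrable_sq_norm hf).2 hf2
  have hfi : Integrable f Q := hfm.integrable (by norm_num)
  have hidm : MemLp (fun x : X => x) 2 Q :=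
    (memLp_two_iff_integrable_sq_norm (by fun_prop)).2 hQ2
  have hI : ∀ u : X, Integrable (fun x => φ ⟪u, x⟫ • f x) Q := by
    intro u
    refine hfi.norm.mono' ?_ (Eventually.of_forall fun x => ?_)
    · exact (Continuous.aestronglyMeasurable (by fun_prop)).smul hf
    · rw [norm_smul]
      exact mul_le_of_le_one_left (norm_nonneg _) (hφ1 _)
  have hum : MemLp (fun x : X => ⟪s - t, x⟫) 2 Q := hidm.const_inner _
  rw [← integral_sub (hI t) (hI s)]
  have hH := integral_mul_norm_le_Lp_mul_Lq (μ := Q) Real.HolderConjugate.two_two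
    (f := fun x => ⟪s - t, x⟫) (g := fun x => ‖f x‖) (by simpa using hum) (by simpa using hfm.norm)
  simp only [abs_norm, Real.norm_eq_abs, Real.rpow_two, sq_abs, ← Real.sqrt_eq_rpow] at hH
  refine le_trans (norm_integral_le_of_norm_le ?_ (Eventually.of_forall fun x => ?_)) hH
  · simpa using! hum.norm.integrable_mul hfm.norm
  · rw [← sub_smul, norm_smul, inner_sub_left]
    gcongr
    simp only [Real.norm_eq_abs]
    rw [abs_sub_comm (inner ℝ s x)]
    exact hφl _ _

/-- **Continuity of the spectral integrand with respect to a trace-class-induced norm**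
(Proposition `V_continuity`): with `F(s) = ‖Cs Q̂(s) + DQ̂(s) + i∫ G(x)e^{i⟪s,x⟫}dQ(x)‖²`,
written below through the real part
`(∫cos⟪s,x⟫dQ) • Cs + ∫(-sin⟪s,x⟫) • x dQ + ∫(-sin⟪s,x⟫) • G(x) dQ`
and the imaginary part
`(∫sin⟪s,x⟫dQ) • Cs + ∫cos⟪s,x⟫ • x dQ + ∫cos⟪s,x⟫ • G(x) dQ`,
there is a self-adjoint, injective, positive, trace-class operator `V` (positivity and
trace-class being expressed through an orthonormal eigenbasis with positive summable
eigenvalues) such that `F` is continuous with respect to the norm `s ↦ ⟪Vs,s⟫^{1/2}`. -/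
theorem spectral_integrand_V_continuity
    {X : Type*} [NormedAddCommGroup X] [InnerProductSpace ℝ X] [CompleteSpace X]
    [MeasurableSpace X] [BorelSpace X] [SecondCountableTopology X]
    -- the covariance operator and its eigendecomposition
    (C : X →L[ℝ] X) (hCsa : IsSelfAdjoint C)
    (e : HilbertBasis ℕ ℝ X) (l : ℕ → ℝ) (hl : ∀ i, 0 < l i)
    (hCe : ∀ i, C (e i) = l i • e i) (hltr : Summable l)
    -- the measure `Q`, the map `G` and the moment conditions
    (Q : Measure X) [IsProbabilityMeasure Q]
    (G : X → X) (hGmeas : Measurable G)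
    (hQ2 : Integrable (fun x => ‖x‖ ^ 2) Q)
    (hG2 : Integrable (fun x => ‖G x‖ ^ 2) Q) :
    ∃ (V : X →L[ℝ] X) (b : HilbertBasis ℕ ℝ X) (lv : ℕ → ℝ),
      IsSelfAdjoint V ∧ Function.Injective V ∧
      (∀ i, V (b i) = lv i • b i) ∧ (∀ i, 0 < lv i) ∧ Summable lv ∧
      (∀ s : X, ∀ ε : ℝ, 0 < ε → ∃ δ : ℝ, 0 < δ ∧
        ∀ t : X, ⟪V (s - t), s - t⟫ < δ →
          |(‖(∫ x, Real.cos ⟪s, x⟫ ∂Q) • C s + (∫ x, (-Real.sin ⟪s, x⟫) • x ∂Q)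
                + ∫ x, (-Real.sin ⟪s, x⟫) • G x ∂Q‖ ^ 2
            + ‖(∫ x, Real.sin ⟪s, x⟫ ∂Q) • C s + (∫ x, Real.cos ⟪s, x⟫ • x ∂Q)
                + ∫ x, Real.cos ⟪s, x⟫ • G x ∂Q‖ ^ 2)
          - (‖(∫ x, Real.cos ⟪t, x⟫ ∂Q) • C t + (∫ x, (-Real.sin ⟪t, x⟫) • x ∂Q)
                + ∫ x, (-Real.sin ⟪t, x⟫) • G x ∂Q‖ ^ 2
            + ‖(∫ x, Real.sin ⟪t, x⟫ ∂Q) • C t + (∫ x, Real.cos ⟪t, x⟫ • x ∂Q)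
                + ∫ x, Real.cos ⟪t, x⟫ • G x ∂Q‖ ^ 2)| < ε) := by
  obtain ⟨S, hSc, hSs, hSq, hStr⟩ := vc_S Q hQ2
  obtain ⟨hCc, hCnn, hCpos, hCb, hCtr⟩ := vc_C C hCsa e l hl hCe hltr
  obtain ⟨b, lv, hb⟩ := vc_eigenbasis (C + S) (hCc.add hSc) (hCsa.add hSs) e
  have hSnn : ∀ h, 0 ≤ ⟪S h, h⟫ := fun h => by
    rw [hSq]; exact integral_nonneg fun x => sq_nonneg _
  have hVeq : ∀ h, ⟪(C + S) h, h⟫ = ⟪C h, h⟫ + ⟪S h, h⟫ := fun h => by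
    rw [add_apply, inner_add_left]
  have hVpos : ∀ h, h ≠ 0 → 0 < ⟪(C + S) h, h⟫ := fun h hh => by
    rw [hVeq]; linarith [hCpos h hh, hSnn h]
  have hlv : ∀ i, lv i = ⟪(C + S) (b i), b i⟫ := fun i => by
    rw [hb, real_inner_smul_left, real_inner_self_eq_norm_sq, b.orthonormal.1 i]; norm_num
  have hlvpos : ∀ i, 0 < lv i := fun i => by
    rw [hlv]; exact hVpos _ (b.orthonormal.ne_zero i)
  refine ⟨C + S, b, lv, hCsa.add hSs, ?_, hb, hlvpos, ?_, ?_⟩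
  · rw [injective_iff_map_eq_zero]
    intro h hh
    by_contra h0
    have := hVpos h h0
    rw [hh, inner_zero_left] at this
    exact lt_irrefl _ this
  · refine summable_of_sum_le (c := (∑' i, l i) + ∫ x, ‖x‖ ^ 2 ∂Q) (fun i => (hlvpos i).le) fun F => ?_
    simp_rw [hlv, hVeq]
    rw [Finset.sum_add_distrib]
    exact add_le_add (hCtr b b.orthonormal F) (hStr b b.orthonormal F)
  intro s
  set q : X → ℝ := fun t => ⟪(C + S) (s - t), s - t⟫ with hq
  have hq0 : ∀ t, 0 ≤ q t := fun t => by
    simp only [hq]; rw [hVeq]; exact add_nonneg (hCnn _) (hSnn _)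
  have hqt : Tendsto q (comap q (nhds 0)) (nhds 0) := tendsto_comap
  have hsqrt : Tendsto (fun t => √(q t)) (comap q (nhds 0)) (nhds 0) := by
    simpa using! (Real.continuous_sqrt.tendsto 0).comp hqt
  have key : ∀ {E : Type _} [NormedAddCommGroup E] (u : X → E) (K : ℝ),
      (∀ t, ‖u t - u s‖ ≤ √(q t) * K) → Tendsto u (comap q (nhds 0)) (nhds (u s)) := by
    intro E _ u K hu
    rw [tendsto_iff_norm_sub_tendsto_zero]
    refine squeeze_zero (fun t => norm_nonneg _) hu ?_
    simpa using hsqrt.mul_const K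
  have hC : Tendsto (fun t => C t) (comap q (nhds 0)) (nhds (C s)) := by
    refine key (fun t => C t) (√(∑' i, l i)) fun t => ?_
    rw [← Real.sqrt_mul (hq0 t)]
    apply Real.le_sqrt_of_sq_le
    rw [← map_sub, ← neg_sub s t, map_neg, norm_neg, mul_comm]
    refine (hCb _).trans ?_
    refine mul_le_mul_of_nonneg_left ?_ (tsum_nonneg fun i => (hl i).le)
    simp only [hq]; rw [hVeq]; linarith [hSnn (s - t)]
  have hqS : ∀ t, √(∫ x, ⟪s - t, x⟫ ^ 2 ∂Q) ≤ √(q t) := fun t => by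
    apply Real.sqrt_le_sqrt
    rw [← hSq]; simp only [hq]; rw [hVeq]; linarith [hCnn (s - t)]
  have hI : ∀ (f : X → X), AEStronglyMeasurable f Q → Integrable (fun x => ‖f x‖ ^ 2) Q →
      ∀ φ : ℝ → ℝ, Continuous φ → (∀ a, |φ a| ≤ 1) → (∀ a b, |φ a - φ b| ≤ |a - b|) →
      Tendsto (fun t => ∫ x, φ ⟪t, x⟫ • f x ∂Q) (comap q (nhds 0))
        (nhds (∫ x, φ ⟪s, x⟫ • f x ∂Q)) := by
    intro f hf hf2 φ h1 h2 h3
    refine key (fun t => ∫ x, φ ⟪t, x⟫ • f x ∂Q) (√(∫ x, ‖f x‖ ^ 2 ∂Q)) fun t => ?_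
    exact (vc_diff Q hQ2 f hf hf2 φ h1 h2 h3 s t).trans
      (mul_le_mul_of_nonneg_right (hqS t) (Real.sqrt_nonneg _))
  have hJ : ∀ φ : ℝ → ℝ, Continuous φ → (∀ a, |φ a| ≤ 1) → (∀ a b, |φ a - φ b| ≤ |a - b|) →
      Tendsto (fun t => ∫ x, φ ⟪t, x⟫ ∂Q) (comap q (nhds 0))
        (nhds (∫ x, φ ⟪s, x⟫ ∂Q)) := by
    intro φ h1 h2 h3
    rw [tendsto_iff_norm_sub_tendsto_zero]
    refine squeeze_zero (fun t => norm_nonneg _) (fun t => ?_) hsqrt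
    have := vc_diff Q hQ2 (fun _ => (1 : ℝ)) (by fun_prop) (by simp) φ h1 h2 h3 s t
    simp only [smul_eq_mul, mul_one, norm_one, one_pow, integral_const, probReal_univ,
      Real.sqrt_one] at this
    exact this.trans (hqS t)
  have hns : ∀ a b, |(-Real.sin a) - (-Real.sin b)| ≤ |a - b| := fun a b => by
    rw [neg_sub_neg, abs_sub_comm]; exact Real.abs_sin_sub_sin_le a b
  have hns1 : ∀ a, |-Real.sin a| ≤ 1 := fun a => by
    rw [abs_neg]; exact Real.abs_sin_le_one a
  have hid : AEStronglyMeasurable (fun x : X => x) Q := by fun_prop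
  have hGm : AEStronglyMeasurable G Q := hGmeas.aestronglyMeasurable
  have T1 := ((hJ _ Real.continuous_cos Real.abs_cos_le_one Real.abs_cos_sub_cos_le).smul hC).add
    (hI _ hid hQ2 _ Real.continuous_sin.neg hns1 hns) |>.add
    (hI _ hGm hG2 _ Real.continuous_sin.neg hns1 hns)
  have T2 := ((hJ _ Real.continuous_sin Real.abs_sin_le_one Real.abs_sin_sub_sin_le).smul hC).add
    (hI _ hid hQ2 _ Real.continuous_cos Real.abs_cos_le_one Real.abs_cos_sub_cos_le) |>.add
    (hI _ hGm hG2 _ Real.continuous_cos Real.abs_cos_le_one Real.abs_cos_sub_cos_le)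
  have T := (T1.norm.pow 2).add (T2.norm.pow 2)
  intro ε hε
  have hev := (Metric.tendsto_nhds.mp T) ε hε
  rw [((Metric.nhds_basis_ball (x := (0:ℝ))).comap q).eventually_iff] at hev
  obtain ⟨δ, hδ, hδ2⟩ := hev
  refine ⟨δ, hδ, fun t ht => ?_⟩
  have hmem : t ∈ q ⁻¹' Metric.ball 0 δ := by
    rw [Set.mem_preimage, mem_ball_zero_iff, Real.norm_of_nonneg (hq0 t)]
    exact ht
  have := hδ2 hmem
  rw [dist_comm, Real.dist_eq] at this
  exact this
end
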